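/- Let λ, μ, ν be partitions with |ν| = |λ| + |μ|, with λ and μ having at most r parts and ν having at most 2r parts. Then the Littlewood–Richardson coefficients satisfy c^ν_{λμ} ≤ c^{τ(ν,ν)}_{τ(λ,μ) τ(λ,μ)}. -/

import Mathlib

/-- A partition: a weakly decreasing, finitely supported sequence of nonnegative
integers (indexed from 0, so `f 0` is the first part `λ₁`). -/
def IsPartition (f : ℕ → ℕ) : Prop := Antitone f ∧ ∃ N, ∀ n, N ≤ n → f n = 0

/-- For `σ = (σ₁ ≥ σ₂ ≥ …)`, `sminus σ = σ₋ = (σ₁, σ₃, σ₅, …)` (0-indexed). -/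
def sminus (σ : ℕ → ℕ) : ℕ → ℕ := fun k => σ (2 * k)

/-- For `σ = (σ₁ ≥ σ₂ ≥ …)`, `splus σ = σ₊ = (σ₂, σ₄, σ₆, …)` (0-indexed). -/
def splus (σ : ℕ → ℕ) : ℕ → ℕ := fun k => σ (2 * k + 1)

/-- `dup ν = ν⁽²⁾ = (ν₁, ν₁, ν₂, ν₂, …)`: every part of `ν` is duplicated. -/
def dup (ν : ℕ → ℕ) : ℕ → ℕ := fun k => ν (k / 2)

/-- Cell `(i, j)` (row `i`, column `j`, 0-based) lies in the skew diagram `ν/λ`. -/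
def InSkew (lam ν : ℕ → ℕ) (c : ℕ × ℕ) : Prop := lam c.1 ≤ c.2 ∧ c.2 < ν c.1

/-- `T` is a Littlewood–Richardson filling of shape `ν/λ` and weight `μ`:
a semistandard skew tableau of shape `ν/λ` (entries `k+1` encode the label `k+1`,
cells outside the shape carry `0`) whose content is `μ` and whose reverse reading
word (rows top to bottom, each row right to left) is a lattice word. -/
def IsLRFilling (lam mu ν : ℕ → ℕ) (T : ℕ × ℕ → ℕ) : Prop :=
  (∀ c, ¬ InSkew lam ν c → T c = 0) ∧
  (∀ c, InSkew lam ν c → 1 ≤ T c) ∧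
  (∀ i j j', InSkew lam ν (i, j) → InSkew lam ν (i, j') → j ≤ j' →
    T (i, j) ≤ T (i, j')) ∧
  (∀ i j, InSkew lam ν (i, j) → InSkew lam ν (i + 1, j) → T (i, j) < T (i + 1, j)) ∧
  (∀ k, Nat.card {c : ℕ × ℕ | T c = k + 1} = mu k) ∧
  (∀ r c k l, k < l →
    Nat.card {x : ℕ × ℕ | T x = l + 1 ∧ (x.1 < r ∨ (x.1 = r ∧ c ≤ x.2))} ≤
    Nat.card {x : ℕ × ℕ | T x = k + 1 ∧ (x.1 < r ∨ (x.1 = r ∧ c ≤ x.2))})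

/-- The Littlewood–Richardson coefficient `c^ν_{λμ}`: the number of
Littlewood–Richardson fillings of shape `ν/λ` and weight `μ`. -/
noncomputable def LR (lam mu ν : ℕ → ℕ) : ℕ :=
  Nat.card {T : ℕ × ℕ → ℕ // IsLRFilling lam mu ν T}

/-- The operation `τ` of Fomin–Fulton–Li–Poon (computed with parameter `r`):
for partitions `λ, μ` with at most `r` parts, the increasing sequence
`I(λ, r) = (λ_r + 1 < … < λ_1 + r)` has elements `λ_{k+1} + r - k` (`k = 0, …, r-1`,
0-indexed parts); `τ(λ, μ)` is the partition with at most `2r` parts whose associated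
increasing sequence `I(τ(λ,μ), 2r)` is the increasing rearrangement of
`{2i - 1 : i ∈ I(λ, r)} ∪ {2j : j ∈ I(μ, r)}`. -/
def tauFFLP (r : ℕ) (lam mu : ℕ → ℕ) : ℕ → ℕ := fun m =>
  if m < 2 * r then
    (((Multiset.range r).map (fun k => 2 * (lam k + (r - k)) - 1) +
      (Multiset.range r).map (fun k => 2 * (mu k + (r - k)))).sort (· ≤ ·)).getD
      (2 * r - 1 - m) 0 - (2 * r - m)
  else 0

namespace LRT

/-- Add a cell of content `c`: the bead at `c` moves to `c + 1`. -/
def stepTo (M : Set ℤ) (c : ℤ) : Set ℤ := {x | (x ∈ M ∧ x ≠ c) ∨ x = c + 1}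

/-- `w` is a valid word of contents leading from the bead set `M` to `N`. -/
def Path : Set ℤ → List ℤ → Set ℤ → Prop
  | M, [], N => M = N
  | M, c :: w, N => c ∈ M ∧ c + 1 ∉ M ∧ Path (stepTo M c) w N

theorem path_append {M N : Set ℤ} {u v : List ℤ} :
    Path M (u ++ v) N ↔ ∃ K, Path M u K ∧ Path K v N := by
  induction u generalizing M with
  | nil => simp [Path]
  | cons a u ih => simp only [List.cons_append, Path, ih]; tauto

theorem mem_stepTo {M : Set ℤ} {c x : ℤ} : x ∈ stepTo M c ↔ (x ∈ M ∧ x ≠ c) ∨ x = c + 1 := Iff.rfl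

theorem path_det {M N N' : Set ℤ} {w : List ℤ} (h : Path M w N) (h' : Path M w N') : N = N' := by
  induction w generalizing M with
  | nil => simp only [Path] at h h'; rw [← h, ← h']
  | cons a w ih => exact ih h.2.2 h'.2.2

theorem step_back_inj {M M' : Set ℤ} {c : ℤ} (h1 : c ∈ M) (h2 : c + 1 ∉ M) (h1' : c ∈ M')
    (h2' : c + 1 ∉ M') (h : stepTo M c = stepTo M' c) : M = M' := by
  ext x
  have := Set.ext_iff.1 h x
  simp only [mem_stepTo] at this
  by_cases hx : x = c
  · subst hx; simp [h1, h1']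
  · by_cases hx' : x = c + 1
    · subst hx'; simp [h2, h2']
    · simpa [hx, hx'] using this

theorem path_det_left {M M' N : Set ℤ} {w : List ℤ} (h : Path M w N) (h' : Path M' w N) :
    M = M' := by
  induction w generalizing M M' with
  | nil => simp only [Path] at h h'; rw [h, h']
  | cons a w ih => exact step_back_inj h.1 h.2.1 h'.1 h'.2.1 (ih h.2.2 h'.2.2)

/-- commuting swap -/
theorem path_swap {M N : Set ℤ} {a b : ℤ} {t : List ℤ} (hab : a ≠ b) (h1 : a ≠ b + 1)
    (h2 : b ≠ a + 1) (h : Path M (a :: b :: t) N) : Path M (b :: a :: t) N := by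
  obtain ⟨h3, h4, h5, h6, h7⟩ := h
  have e : stepTo (stepTo M a) b = stepTo (stepTo M b) a := by
    ext x; simp only [mem_stepTo]; grind
  refine ⟨?_, ?_, ?_, ?_, e ▸ h7⟩ <;> simp only [mem_stepTo] at * <;> grind

theorem path_ne {M N : Set ℤ} {a b : ℤ} {t : List ℤ} (h : Path M (a :: b :: t) N) : a ≠ b := by
  obtain ⟨h3, h4, h5, h6, h7⟩ := h
  simp only [mem_stepTo] at *; grind

theorem path_mem_of_notMem {M N : Set ℤ} {w : List ℤ} {x : ℤ} (h : Path M w N) (hx : x ∉ M)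
    (hN : x ∈ N) : x - 1 ∈ w := by
  induction w generalizing M with
  | nil => simp only [Path] at h; subst h; exact absurd hN hx
  | cons a w ih =>
    by_cases hxa : x = a + 1
    · subst hxa; simp
    · exact List.mem_cons_of_mem _ (ih h.2.2 (by simp [mem_stepTo, hx, hxa]))

theorem path_notMem_of_mem {M N : Set ℤ} {w : List ℤ} {x : ℤ} (h : Path M w N) (hx : x ∈ M)
    (hN : x ∉ N) : x ∈ w := by
  induction w generalizing M with
  | nil => simp only [Path] at h; subst h; exact absurd hx hN
  | cons a w ih =>
    by_cases hxa : x = a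
    · subst hxa; simp
    · exact List.mem_cons_of_mem _ (ih h.2.2 (by simp [mem_stepTo, hx, hxa]))

/-- between two equal letters there are both neighbours -/
theorem path_between {M N : Set ℤ} {m t : List ℤ} {x : ℤ} (h : Path M (x :: (m ++ x :: t)) N) :
    x - 1 ∈ m ∧ x + 1 ∈ m := by
  obtain ⟨h1, h2, h3⟩ := h
  obtain ⟨K, h4, h5⟩ := path_append.1 h3
  constructor
  · exact path_mem_of_notMem h4 (by simp [mem_stepTo]) h5.1
  · exact path_notMem_of_mem h4 (by simp [mem_stepTo]) h5.2.1

theorem path_ne3 {M N : Set ℤ} {a b c : ℤ} {t : List ℤ} (h : Path M (a :: b :: c :: t) N) :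
    a ≠ c := by
  rintro rfl
  have := path_between (m := [b]) h
  simp at this; omega

theorem path_ne4 {M N : Set ℤ} {a b c d : ℤ} {t : List ℤ} (h : Path M (a :: b :: c :: d :: t) N) :
    a = d → (b = a + 1 ∧ c = a - 1) ∨ (c = a + 1 ∧ b = a - 1) := by
  rintro rfl
  have := path_between (m := [b, c]) h
  simp at this; omega

/-- local switching rule -/
def swp (c d : ℤ) : ℤ × ℤ := if c = d + 1 ∨ d = c + 1 then (c, d) else (d, c)

theorem swp_swp (c d : ℤ) : swp (swp c d).1 (swp c d).2 = (c, d) := by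
  unfold swp; split_ifs <;> simp_all

def slideR : ℤ → List ℤ → List ℤ × ℤ
  | d, [] => ([], d)
  | d, a :: w => ((swp d a).1 :: (slideR (swp d a).2 w).1, (slideR (swp d a).2 w).2)

def slideL : List ℤ → ℤ → ℤ × List ℤ
  | [], f => (f, [])
  | a :: w, f => ((swp a (slideL w f).1).1, (swp a (slideL w f).1).2 :: (slideL w f).2)

def sw : List ℤ → List ℤ → List ℤ × List ℤ
  | [], w => (w, [])
  | d :: u, w => ((slideR d (sw u w).1).1, (slideR d (sw u w).1).2 :: (sw u w).2)

theorem slideL_slideR (d : ℤ) (w : List ℤ) :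
    slideL (slideR d w).1 (slideR d w).2 = (d, w) := by
  induction w generalizing d with
  | nil => simp [slideR, slideL]
  | cons a w ih => simp [slideR, slideL, ih, swp_swp]

theorem slideR_slideL (f : ℤ) (w : List ℤ) :
    slideR (slideL w f).1 (slideL w f).2 = (w, f) := by
  induction w with
  | nil => simp [slideR, slideL]
  | cons a w ih => simp [slideR, slideL, ih, swp_swp]

theorem slideR_length (d : ℤ) (w : List ℤ) : (slideR d w).1.length = w.length := by
  induction w generalizing d with
  | nil => simp [slideR]
  | cons a w ih => simp [slideR, ih]

theorem slideL_length (f : ℤ) (w : List ℤ) : (slideL w f).2.length = w.length := by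
  induction w with
  | nil => simp [slideL]
  | cons a w ih => simp [slideL, ih]

theorem sw_length (u w : List ℤ) :
    (sw u w).1.length = w.length ∧ (sw u w).2.length = u.length := by
  induction u with
  | nil => simp [sw]
  | cons a u ih => simp [sw, slideR_length, ih]

theorem sw_cons_right (u : List ℤ) (f : ℤ) (w : List ℤ) :
    sw u (f :: w) = ((slideL u f).1 :: (sw (slideL u f).2 w).1, (sw (slideL u f).2 w).2) := by
  induction u with
  | nil => simp [sw, slideL]
  | cons d u ih => simp [sw, slideL, ih, slideR]

theorem slideR_append (d : ℤ) (u v : List ℤ) :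
    slideR d (u ++ v) = ((slideR d u).1 ++ (slideR (slideR d u).2 v).1,
      (slideR (slideR d u).2 v).2) := by
  induction u generalizing d with
  | nil => simp [slideR]
  | cons a u ih => simp [slideR, ih]

theorem sw_append_left (u u2 w : List ℤ) :
    sw (u ++ u2) w = ((sw u (sw u2 w).1).1, (sw u (sw u2 w).1).2 ++ (sw u2 w).2) := by
  induction u with
  | nil => simp [sw]
  | cons d u ih => simp [sw, ih]

theorem sw_append_right (u w w2 : List ℤ) :
    sw u (w ++ w2) = ((sw u w).1 ++ (sw (sw u w).2 w2).1, (sw (sw u w).2 w2).2) := by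
  induction u with
  | nil => simp [sw]
  | cons d u ih => simp [sw, ih, slideR_append]

theorem sw_nil_right (u : List ℤ) : sw u [] = ([], u) := by
  induction u with
  | nil => simp [sw]
  | cons d u ih => simp [sw, ih, slideR]

theorem path_swp {M N : Set ℤ} {c d : ℤ} {t : List ℤ} (h : Path M (c :: d :: t) N) :
    Path M ((swp c d).1 :: (swp c d).2 :: t) N := by
  have := path_ne h
  unfold swp; split_ifs with h1
  · exact h
  · exact path_swap this (by tauto) (by tauto) h

theorem path_slideR {M N : Set ℤ} {d : ℤ} {w t : List ℤ} (h : Path M (d :: (w ++ t)) N) :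
    Path M ((slideR d w).1 ++ (slideR d w).2 :: t) N := by
  induction w generalizing d M with
  | nil => simpa [slideR] using h
  | cons a w ih =>
    have := path_swp h
    exact ⟨this.1, this.2.1, ih this.2.2⟩

theorem path_slideL {M N : Set ℤ} {f : ℤ} {w t : List ℤ} (h : Path M (w ++ f :: t) N) :
    Path M ((slideL w f).1 :: ((slideL w f).2 ++ t)) N := by
  induction w generalizing M with
  | nil => simpa [slideL] using h
  | cons a w ih =>
    have h1 : Path M (a :: (slideL w f).1 :: ((slideL w f).2 ++ t)) N := ⟨h.1, h.2.1, ih h.2.2⟩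
    exact path_swp h1

theorem path_sw {M N : Set ℤ} {u w t : List ℤ} (h : Path M (u ++ (w ++ t)) N) :
    Path M ((sw u w).1 ++ ((sw u w).2 ++ t)) N := by
  induction u generalizing M with
  | nil => simpa [sw] using h
  | cons d u ih =>
    have h1 : Path M (d :: ((sw u w).1 ++ ((sw u w).2 ++ t))) N := ⟨h.1, h.2.1, ih h.2.2⟩
    exact path_slideR h1

/-- ascents -/
def Asc : ℕ → List ℤ → Prop
  | 0, a :: b :: _ => a < b
  | k + 1, _ :: w => Asc k w
  | _, _ => False

theorem asc_zero (a b : ℤ) (t : List ℤ) : Asc 0 (a :: b :: t) ↔ a < b := Iff.rfl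
theorem asc_succ (k : ℕ) (a : ℤ) (t : List ℤ) : Asc (k + 1) (a :: t) ↔ Asc k t := by
  cases t <;> rfl

theorem asc_slideR {M N : Set ℤ} {d : ℤ} {w : List ℤ} (h : Path M (d :: w) N) (k : ℕ) :
    Asc k (slideR d w).1 ↔ Asc k w := by
  induction k generalizing d w M with
  | zero =>
    match w with
    | [] => simp [slideR, Asc]
    | [a] => simp [slideR, Asc]
    | a :: b :: t =>
      have h1 := path_ne h
      have h2 := path_ne3 h
      have h3 := path_ne h.2.2
      simp only [slideR, asc_zero]
      unfold swp
      split_ifs <;> simp only at * <;> omega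
  | succ k ih =>
    match w with
    | [] => simp [slideR, Asc]
    | a :: t =>
      simp only [slideR, asc_succ]
      exact ih (path_swp h).2.2

theorem asc_sw {M N : Set ℤ} {u w : List ℤ} (h : Path M (u ++ w) N) (k : ℕ) :
    Asc k (sw u w).1 ↔ Asc k w := by
  induction u generalizing M with
  | nil => simp [sw]
  | cons d u ih =>
    have h2 : Path M (u ++ w |>.cons d) N := h
    have h3 := path_sw (t := []) (u := u) (w := w) (by simpa using h.2.2)
    have h4 : Path M (d :: ((sw u w).1 ++ ((sw u w).2 ++ []))) N := ⟨h.1, h.2.1, h3⟩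
    have h4' : Path M ((d :: (sw u w).1) ++ ((sw u w).2 ++ [])) N := h4
    obtain ⟨K, h5, -⟩ := path_append.1 h4'
    simp only [sw]
    rw [asc_slideR h5, ih h.2.2]

/-- elementary dual equivalence on three letters -/
def tri (a b c : ℤ) : List ℤ :=
  if (b < a ∧ a < c) ∨ (c < a ∧ a < b) then [a, c, b]
  else if (a < c ∧ c < b) ∨ (b < c ∧ c < a) then [b, a, c] else [a, b, c]

def dk : ℕ → List ℤ → List ℤ
  | 0, a :: b :: c :: t => tri a b c ++ t
  | k + 1, a :: t => a :: dk k t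
  | _, w => w

theorem dk_zero (a b c : ℤ) (t : List ℤ) : dk 0 (a :: b :: c :: t) = tri a b c ++ t := rfl
theorem dk_succ (k : ℕ) (a : ℤ) (t : List ℤ) : dk (k + 1) (a :: t) = a :: dk k t := by
  cases t <;> rfl
theorem dk_nil (k : ℕ) : dk k [] = [] := by cases k <;> rfl

theorem dk_dk (k : ℕ) (w : List ℤ) : dk k (dk k w) = w := by
  induction k generalizing w with
  | zero =>
    match w with
    | [] => rfl
    | [a] => rfl
    | [a, b] => rfl
    | a :: b :: c :: t =>
      simp only [dk_zero]
      unfold tri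
      split_ifs with h1 h2 <;> simp only [List.cons_append, List.nil_append, dk_zero] <;>
        unfold tri <;> split_ifs <;> first | rfl | (exfalso; omega)
  | succ k ih =>
    match w with
    | [] => rfl
    | a :: t => simp [dk_succ, ih]

theorem dk_cases (k : ℕ) (w : List ℤ) : dk k w = w ∨ ∃ s a b t, w = s ++ a :: b :: t ∧
    dk k w = s ++ b :: a :: t ∧ (a + 2 ≤ b ∨ b + 2 ≤ a) := by
  induction k generalizing w with
  | zero =>
    match w with
    | [] => left; rfl
    | [a] => left; rfl
    | [a, b] => left; rfl
    | a :: b :: c :: t =>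
      simp only [dk_zero]
      unfold tri
      split_ifs with h1 h2
      · right; exact ⟨[a], b, c, t, rfl, rfl, by omega⟩
      · right; exact ⟨[], a, b, c :: t, rfl, rfl, by omega⟩
      · left; rfl
  | succ k ih =>
    match w with
    | [] => left; rfl
    | x :: t =>
      rw [dk_succ]
      rcases ih t with h | ⟨s, a, b, t', h1, h2, h3⟩
      · left; rw [h]
      · right; exact ⟨x :: s, a, b, t', by rw [h1]; rfl, by rw [h2]; rfl, h3⟩

theorem path_dk {M N : Set ℤ} {k : ℕ} {w : List ℤ} (h : Path M w N) : Path M (dk k w) N := by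
  rcases dk_cases k w with h0 | ⟨s, a, b, t, h1, h2, h3⟩
  · rw [h0]; exact h
  · rw [h2]; rw [h1] at h
    obtain ⟨K, h4, h5⟩ := path_append.1 h
    exact path_append.2 ⟨K, h4, path_swap (by omega) (by omega) (by omega) h5⟩

theorem dk_length (k : ℕ) (w : List ℤ) : (dk k w).length = w.length := by
  rcases dk_cases k w with h0 | ⟨s, a, b, t, h1, h2, h3⟩
  · rw [h0]
  · rw [h2, h1]; simp

theorem dk_sum (k : ℕ) (w : List ℤ) : (dk k w).sum = w.sum := by
  rcases dk_cases k w with h0 | ⟨s, a, b, t, h1, h2, h3⟩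
  · rw [h0]
  · rw [h2, h1]; simp; ring

theorem swp_cases (c d : ℤ) : ((c = d + 1 ∨ d = c + 1) ∧ swp c d = (c, d)) ∨
    ((c ≠ d + 1 ∧ d ≠ c + 1) ∧ swp c d = (d, c)) := by
  unfold swp; split_ifs with h
  · left; exact ⟨h, rfl⟩
  · right; exact ⟨by omega, rfl⟩

theorem tri_cases (a b c : ℤ) :
    (((b < a ∧ a < c) ∨ (c < a ∧ a < b)) ∧ tri a b c = [a, c, b]) ∨
    (((a < c ∧ c < b) ∨ (b < c ∧ c < a)) ∧ tri a b c = [b, a, c]) ∨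
    (¬ ((b < a ∧ a < c) ∨ (c < a ∧ a < b)) ∧ ¬ ((a < c ∧ c < b) ∨ (b < c ∧ c < a)) ∧
      tri a b c = [a, b, c]) := by
  unfold tri; split_ifs with h h'
  · left; exact ⟨h, rfl⟩
  · right; left; exact ⟨h', rfl⟩
  · right; right; exact ⟨h, h', rfl⟩

set_option linter.unusedSimpArgs false
theorem swp_two {a b : ℤ} (h : a < b) :
    (b = a + 1 ∧ swp a b = (a, b) ∧ swp b a = (b, a)) ∨
    (a + 2 ≤ b ∧ swp a b = (b, a) ∧ swp b a = (a, b)) := by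
  by_cases h1 : b = a + 1
  · left; simp [swp, h1]
  · right
    refine ⟨by omega, ?_, ?_⟩ <;> unfold swp <;> rw [if_neg (by omega)]

theorem swp_three {a b : ℤ} (h : a ≠ b) :
    (b = a + 1 ∧ swp a b = (a, b) ∧ swp b a = (b, a)) ∨
    (a + 2 ≤ b ∧ swp a b = (b, a) ∧ swp b a = (a, b)) ∨
    (a = b + 1 ∧ swp a b = (a, b) ∧ swp b a = (b, a)) ∨
    (b + 2 ≤ a ∧ swp a b = (b, a) ∧ swp b a = (a, b)) := by
  rcases lt_or_gt_of_ne h with h | h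
  · rcases swp_two h with h | h <;> tauto
  · rcases swp_two h with h | h <;> tauto

theorem tri_eq1 {a b c : ℤ} (h : (b < a ∧ a < c) ∨ (c < a ∧ a < b)) : tri a b c = [a, c, b] := by
  unfold tri; rw [if_pos h]
theorem tri_eq2 {a b c : ℤ} (h : (a < c ∧ c < b) ∨ (b < c ∧ c < a)) : tri a b c = [b, a, c] := by
  unfold tri; rw [if_neg (by omega), if_pos h]
theorem tri_eq3 {a b c : ℤ} (h : (a < b ∧ b < c) ∨ (c < b ∧ b < a)) : tri a b c = [a, b, c] := by
  unfold tri; rw [if_neg (by omega), if_neg (by omega)]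

theorem slideR3 (d x y z x1 y1 z1 c1 c2 c3 : ℤ) (h1 : swp d x = (x1, c1)) (h2 : swp c1 y = (y1, c2))
    (h3 : swp c2 z = (z1, c3)) : slideR d [x, y, z] = ([x1, y1, z1], c3) := by
  simp only [slideR, h1, h2, h3]

theorem slideR_tri {a b c d : ℤ} (h1 : d ≠ a) (h2 : d ≠ b) (h3 : a ≠ b) (h4 : b ≠ c) (h5 : a ≠ c)
    (h6 : d = c → (a = d + 1 ∧ b = d - 1) ∨ (b = d + 1 ∧ a = d - 1)) :
    slideR d (tri a b c) = (dk 0 (slideR d [a, b, c]).1, (slideR d [a, b, c]).2) := by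
  by_cases hdc : d = c
  · subst hdc
    have hh := h6 rfl
    rw [tri_eq2 (by omega)]
    rcases swp_three h1 with ⟨x4, e4, e4'⟩ | ⟨x4, e4, e4'⟩ | ⟨x4, e4, e4'⟩ | ⟨x4, e4, e4'⟩ <;>
    rcases swp_three h2 with ⟨x5, e5, e5'⟩ | ⟨x5, e5, e5'⟩ | ⟨x5, e5, e5'⟩ | ⟨x5, e5, e5'⟩ <;>
    rcases swp_three h3 with ⟨x6, e6, e6'⟩ | ⟨x6, e6, e6'⟩ | ⟨x6, e6, e6'⟩ | ⟨x6, e6, e6'⟩ <;>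
    first
    | (exfalso; omega)
    | (simp only [slideR, e4, e5, e6, e4', e5', e6', dk_zero]
       rw [tri_eq1 (by omega)]; rfl)
  clear h6
  rcases swp_three h3 with ⟨x1, e1, e1'⟩ | ⟨x1, e1, e1'⟩ | ⟨x1, e1, e1'⟩ | ⟨x1, e1, e1'⟩ <;> clear h3 <;>
  rcases swp_three h4 with ⟨x2, e2, e2'⟩ | ⟨x2, e2, e2'⟩ | ⟨x2, e2, e2'⟩ | ⟨x2, e2, e2'⟩ <;> clear h4 <;>
  rcases swp_three h5 with ⟨x3, e3, e3'⟩ | ⟨x3, e3, e3'⟩ | ⟨x3, e3, e3'⟩ | ⟨x3, e3, e3'⟩ <;> clear h5 <;>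
  first
  | (exfalso; omega)
  | (rcases swp_three h1 with ⟨x4, e4, e4'⟩ | ⟨x4, e4, e4'⟩ | ⟨x4, e4, e4'⟩ | ⟨x4, e4, e4'⟩ <;> clear h1 <;>
     rcases swp_three h2 with ⟨x5, e5, e5'⟩ | ⟨x5, e5, e5'⟩ | ⟨x5, e5, e5'⟩ | ⟨x5, e5, e5'⟩ <;> clear h2 <;>
     first
     | (exfalso; omega)
     | (rcases swp_three hdc with ⟨x6, e6, e6'⟩ | ⟨x6, e6, e6'⟩ | ⟨x6, e6, e6'⟩ | ⟨x6, e6, e6'⟩ <;>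
        clear hdc <;>
        first
        | (exfalso; omega)
        | (first
          | rw [tri_eq1 (a := a) (b := b) (c := c) (by omega)]
          | rw [tri_eq2 (a := a) (b := b) (c := c) (by omega)]
          | rw [tri_eq3 (a := a) (b := b) (c := c) (by omega)]
           simp only [slideR, e1, e2, e3, e4, e5, e6, e1', e2', e3', dk_zero]
           first
           | rfl
           | (rw [tri_eq1 (by omega)]; rfl)
           | (rw [tri_eq2 (by omega)]; rfl)
           | (rw [tri_eq3 (by omega)]; rfl))))

theorem slideR_length3 (d a b c : ℤ) : ∃ x y z, (slideR d [a, b, c]).1 = [x, y, z] := by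
  simp [slideR]

theorem slideR_dk {M N : Set ℤ} {d : ℤ} {w : List ℤ} (h : Path M (d :: w) N) (k : ℕ) :
    slideR d (dk k w) = (dk k (slideR d w).1, (slideR d w).2) := by
  induction k generalizing d w M with
  | zero =>
    match w with
    | [] => rfl
    | [a] => rfl
    | [a, b] => rfl
    | a :: b :: c :: t =>
      have h0 := slideR_tri (path_ne h) (path_ne3 h) (path_ne h.2.2) (path_ne h.2.2.2.2)
        (path_ne3 h.2.2) (path_ne4 h)
      have e : a :: b :: c :: t = [a, b, c] ++ t := rfl
      rw [dk_zero, e, slideR_append, slideR_append, h0]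
      obtain ⟨x, y, z, h7⟩ := slideR_length3 d a b c
      rw [h7]
      simp [dk_zero]
  | succ k ih =>
    match w with
    | [] => rfl
    | a :: t =>
      simp only [slideR, dk_succ]
      rw [ih (path_swp h).2.2]

theorem dk_append (k : ℕ) (u v : List ℤ) : dk (u.length + k) (u ++ v) = u ++ dk k v := by
  induction u with
  | nil => simp
  | cons a u ih =>
    rw [List.length_cons, show u.length + 1 + k = (u.length + k) + 1 by ring, List.cons_append,
      dk_succ, ih]; rfl

theorem path_append_left {M N : Set ℤ} {u v : List ℤ} (h : Path M (u ++ v) N) :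
    ∃ K, Path M u K := by
  obtain ⟨K, h1, -⟩ := path_append.1 h
  exact ⟨K, h1⟩

theorem slideL_dk {M N : Set ℤ} {f : ℤ} {u : List ℤ} (h : Path M (u ++ [f]) N) (k : ℕ) :
    slideL (dk k u) f = ((slideL u f).1, dk k (slideL u f).2) := by
  have h1 := path_slideL (t := []) h
  rw [List.append_nil] at h1
  have h2 := slideR_dk h1 k
  rw [slideR_slideL] at h2
  have h3 := slideL_slideR (slideL u f).1 (dk k (slideL u f).2)
  rw [h2] at h3
  exact h3

theorem sw_dk_right {M N : Set ℤ} {u w : List ℤ} (h : Path M (u ++ w) N) (k : ℕ) :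
    sw u (dk k w) = (dk k (sw u w).1, (sw u w).2) := by
  induction u generalizing M with
  | nil => simp [sw]
  | cons d u ih =>
    have h3 := path_sw (t := []) (u := u) (w := w) (by simpa using h.2.2)
    have h4 : Path M ((d :: (sw u w).1) ++ ((sw u w).2 ++ [])) N := ⟨h.1, h.2.1, h3⟩
    obtain ⟨K, h5⟩ := path_append_left h4
    simp only [sw]
    rw [ih h.2.2, slideR_dk h5]

theorem sw_dk_left {M N : Set ℤ} {u w : List ℤ} (h : Path M (u ++ w) N) (k : ℕ) :
    sw (dk k u) w = ((sw u w).1, dk k (sw u w).2) := by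
  induction w generalizing u M with
  | nil => simp [sw_nil_right]
  | cons f w ih =>
    have h1 : Path M ((u ++ [f]) ++ w) N := by simpa using h
    obtain ⟨K, h2⟩ := path_append_left h1
    have h3 := (path_slideL h).2.2
    rw [sw_cons_right, sw_cons_right, slideL_dk h2]
    simp only
    rw [ih h3]

theorem sw_sw (u w : List ℤ) : sw (sw u w).1 (sw u w).2 = (u, w) := by
  induction u with
  | nil => simp [sw, sw_nil_right]
  | cons d u ih => simp [sw, sw_cons_right, slideL_slideR, ih]

end LRT

namespace LRT

def M0 : Set ℤ := {x | x ≤ 0}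

theorem path_concat {M N : Set ℤ} {u : List ℤ} {a : ℤ} : Path M (u ++ [a]) N ↔
    ∃ K, Path M u K ∧ a ∈ K ∧ a + 1 ∉ K ∧ stepTo K a = N := by
  rw [path_append]; simp [Path]

theorem path_concat_two {M N : Set ℤ} {u : List ℤ} {a b : ℤ} (hab : a ≠ b) (h1 : a ≠ b + 1)
    (h2 : b ≠ a + 1) (h : Path M (u ++ [a, b]) N) : Path M (u ++ [b, a]) N := by
  obtain ⟨K, h3, h4⟩ := path_append.1 h
  exact path_append.2 ⟨K, h3, path_swap hab h1 h2 h4⟩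

theorem rem_lemma {P : List ℤ} {N : Set ℤ} {c : ℤ} (h : Path M0 P N) (h1 : c + 1 ∈ N)
    (h2 : c ∉ N) : ∃ P', P'.length + 1 = P.length ∧ Path M0 (P' ++ [c]) N := by
  induction P using List.reverseRecOn generalizing N with
  | nil =>
    simp only [Path] at h; subst h
    simp only [M0, Set.mem_ofPred_eq] at h1 h2; omega
  | append_singleton R a ih =>
    by_cases hac : a = c
    · subst hac; exact ⟨R, by simp, h⟩
    · obtain ⟨K, h3, h4, h5, rfl⟩ := path_concat.1 h
      simp only [mem_stepTo] at h1 h2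
      have e1 : c + 1 ∈ K ∧ c + 1 ≠ a := by
        rcases h1 with h1 | h1
        · exact h1
        · omega
      have e2 : c ∉ K := fun hc => h2 (Or.inl ⟨hc, fun h => hac h.symm⟩)
      obtain ⟨P', h6, h7⟩ := ih h3 e1.1 e2
      refine ⟨P' ++ [a], by simp [h6], ?_⟩
      have h8 : Path M0 ((P' ++ [c]) ++ [a]) (stepTo K a) := path_concat.2 ⟨K, h7, h4, h5, rfl⟩
      have := path_concat_two (u := P') (a := c) (b := a) (fun h => hac h.symm) (by tauto)
        (fun h => e1.2 h.symm) (by simpa using h8)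
      simpa using this

theorem dk_append_right (k : ℕ) (u t : List ℤ) (h : k + 3 ≤ u.length) :
    dk k (u ++ t) = dk k u ++ t := by
  induction k generalizing u with
  | zero =>
    match u with
    | [] => simp at h
    | [a] => simp at h
    | [a, b] => simp at h
    | a :: b :: c :: s => simp [dk_zero]
  | succ k ih =>
    match u with
    | [] => simp at h
    | a :: s =>
      simp only [List.length_cons] at h
      simp [dk_succ, ih s (by omega)]

theorem dk_short (k : ℕ) (u : List ℤ) (h : u.length < k + 3) : dk k u = u := by
  induction k generalizing u with
  | zero =>
    match u with
    | [] => rfl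
    | [a] => rfl
    | [a, b] => rfl
    | a :: b :: c :: s => simp at h; omega
  | succ k ih =>
    match u with
    | [] => rfl
    | a :: s =>
      simp only [List.length_cons] at h
      simp [dk_succ, ih s (by omega)]

def Conn : List ℤ → List ℤ → Prop := Relation.ReflTransGen (fun w w' => ∃ k, w' = dk k w)

theorem Conn.symm {u v : List ℤ} (h : Conn u v) : Conn v u := by
  induction h with
  | refl => exact Relation.ReflTransGen.refl
  | tail _ h2 ih =>
    obtain ⟨k, rfl⟩ := h2
    exact Relation.ReflTransGen.head ⟨k, (dk_dk _ _).symm⟩ ih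

theorem Conn.append {u v : List ℤ} (h : Conn u v) (t : List ℤ) : Conn (u ++ t) (v ++ t) := by
  induction h with
  | refl => exact Relation.ReflTransGen.refl
  | @tail b c _ h2 ih =>
    obtain ⟨k, rfl⟩ := h2
    by_cases hk : k + 3 ≤ b.length
    · exact Relation.ReflTransGen.tail ih ⟨k, (dk_append_right _ _ _ hk).symm⟩
    · rw [dk_short k b (by omega)]; exact ih

theorem ivt (L : Set ℤ) (x : ℤ) (n : ℕ) (h1 : x ∉ L) (h2 : x + n ∈ L) :
    ∃ c, x ≤ c ∧ c < x + n ∧ c ∉ L ∧ c + 1 ∈ L := by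
  induction n with
  | zero => simp at h2; contradiction
  | succ n ih =>
    by_cases h : x + n ∈ L
    · obtain ⟨c, h3, h4, h5⟩ := ih h
      exact ⟨c, h3, by push_cast; omega, h5⟩
    · exact ⟨x + n, by omega, by push_cast; omega, h, by rw [add_assoc]; exact_mod_cast h2⟩

theorem conn_lt {n : ℕ} (ih : ∀ N (P Q : List ℤ), P.length = n → Q.length = n → Path M0 P N →
    Path M0 Q N → Conn P Q) {N : Set ℤ} {R S : List ℤ} {a b : ℤ} (hab : b < a)
    (hR : R.length = n) (hS : S.length = n) (h1 : Path M0 (R ++ [a]) N)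
    (h2 : Path M0 (S ++ [b]) N) : Conn (R ++ [a]) (S ++ [b]) := by
  obtain ⟨K, k1, k2, k3, k4⟩ := path_concat.1 h1
  obtain ⟨K', k1', k2', k3', k4'⟩ := path_concat.1 h2
  have n1 : a + 1 ∈ N ∧ a ∉ N := by rw [← k4]; simp [mem_stepTo]
  have n2 : b + 1 ∈ N ∧ b ∉ N := by rw [← k4']; simp [mem_stepTo]
  have hab2 : b + 1 ≠ a := fun h => n1.2 (h ▸ n2.1)
  have n2' : b + 1 ∈ K ∧ b ∉ K := by
    rw [← k4] at n2; simp only [mem_stepTo] at n2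
    constructor
    · rcases n2.1 with h | h
      · exact h.1
      · omega
    · intro h; exact n2.2 (Or.inl ⟨h, by omega⟩)
  obtain ⟨R', r1, r2⟩ := rem_lemma k1 n2'.1 n2'.2
  obtain ⟨L, l1, l2, l3, l4⟩ := path_concat.1 r2
  have hL : a ∈ L := by
    rw [← l4] at k2; simp only [mem_stepTo] at k2
    rcases k2 with h | h
    · exact h.1
    · omega
  obtain ⟨c, c1, c2, c3, c4⟩ := ivt L (b + 1) (a - (b + 1)).toNat l3 (by
    rw [Int.toNat_of_nonneg (by omega)]; simpa using hL)
  rw [Int.toNat_of_nonneg (by omega)] at c2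
  obtain ⟨R'', s1, s2⟩ := rem_lemma l1 c4 c3
  have p1 : Path M0 (R'' ++ [c, b]) K := by
    have : Path M0 ((R'' ++ [c]) ++ [b]) K := path_concat.2 ⟨L, s2, l2, l3, l4⟩
    simpa using this
  have p2 : Path M0 (R'' ++ [c, b, a]) N := by
    have : Path M0 ((R'' ++ [c, b]) ++ [a]) N := path_concat.2 ⟨K, p1, k2, k3, k4⟩
    simpa using this
  have hd : dk R''.length (R'' ++ [c, b, a]) = R'' ++ [c, a, b] := by
    have := dk_append 0 R'' [c, b, a]
    rw [Nat.add_zero] at this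
    rw [this, dk_zero, tri_eq1 (by omega)]; rfl
  have p3 : Path M0 (R'' ++ [c, a, b]) N := by rw [← hd]; exact path_dk p2
  have p4 : Path M0 ((R'' ++ [c, a]) ++ [b]) N := by simpa using p3
  obtain ⟨K2, q1, q2, q3, q4⟩ := path_concat.1 p4
  have hK : K2 = K' := step_back_inj q2 q3 k2' k3' (by rw [q4, k4'])
  subst hK
  have c1 := (ih K R (R'' ++ [c, b]) hR (by simp; omega) k1 p1).append [a]
  have c2 := (ih K2 (R'' ++ [c, a]) S (by simp; omega) hS q1 k1').append [b]
  have c3 : Conn (R'' ++ [c, b, a]) (R'' ++ [c, a, b]) :=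
    Relation.ReflTransGen.single ⟨_, hd.symm⟩
  simp only [List.append_assoc, List.cons_append, List.nil_append] at c1 c2
  exact (Relation.ReflTransGen.trans c1 c3).trans c2

theorem conn_of_path (n : ℕ) : ∀ N (P Q : List ℤ), P.length = n → Q.length = n → Path M0 P N →
    Path M0 Q N → Conn P Q := by
  induction n with
  | zero =>
    intro N P Q h1 h2 _ _
    rw [List.length_eq_zero_iff.1 h1, List.length_eq_zero_iff.1 h2]
    exact Relation.ReflTransGen.refl
  | succ n ih =>
    intro N P Q h1 h2 hP hQ
    obtain ⟨R, a, rfl⟩ := List.eq_nil_or_concat P |>.resolve_left (by rintro rfl; simp at h1)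
    obtain ⟨S, b, rfl⟩ := List.eq_nil_or_concat Q |>.resolve_left (by rintro rfl; simp at h2)
    simp only [List.concat_eq_append] at *
    simp only [List.length_append, List.length_cons, List.length_nil] at h1 h2
    rcases lt_trichotomy a b with h | rfl | h
    · exact (conn_lt ih h (by omega) (by omega) hQ hP).symm
    · obtain ⟨K, k1, k2, k3, k4⟩ := path_concat.1 hP
      obtain ⟨K', k1', k2', k3', k4'⟩ := path_concat.1 hQ
      have : K = K' := step_back_inj k2 k3 k2' k3' (by rw [k4, k4'])
      subst this
      exact (ih K R S (by omega) (by omega) k1 k1').append [a]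
    · exact conn_lt ih h (by omega) (by omega) hP hQ

/-- straight words of length m -/
def Str (m : ℕ) : Set (List ℤ) := {P | P.length = m ∧ ∃ N, Path M0 P N}

theorem inv_of_conn {α : Type*} {m : ℕ} (F : List ℤ → α)
    (hF : ∀ k, ∀ P ∈ Str m, F (dk k P) = F P) {P Q : List ℤ} (hP : P ∈ Str m) (h : Conn P Q) :
    F Q = F P ∧ Q ∈ Str m := by
  induction h with
  | refl => exact ⟨rfl, hP⟩
  | tail _ h2 ih =>
    obtain ⟨k, rfl⟩ := h2
    refine ⟨by rw [hF k _ ih.2, ih.1], by rw [dk_length, ih.2.1], ?_⟩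
    obtain ⟨N, hN⟩ := ih.2.2
    exact ⟨N, path_dk hN⟩

theorem inv_of_path {α : Type*} {m : ℕ} (F : List ℤ → α)
    (hF : ∀ k, ∀ P ∈ Str m, F (dk k P) = F P) {N : Set ℤ} {P Q : List ℤ} (hP : P.length = m)
    (hQ : Q.length = m) (h1 : Path M0 P N) (h2 : Path M0 Q N) : F Q = F P :=
  (inv_of_conn F hF ⟨hP, N, h1⟩ (conn_of_path m N P Q hP hQ h1 h2)).1

theorem path_bound {M N : Set ℤ} {w : List ℤ} {a b : ℤ} (h : Path M w N)
    (h1 : ∀ x ∈ M, x ≤ b) (h2 : ∀ x ≤ a, x ∈ M) :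
    ∀ c ∈ w, a - w.length ≤ c ∧ c ≤ b + w.length := by
  induction w generalizing M a b with
  | nil => simp
  | cons d w ih =>
    obtain ⟨k1, k2, k3⟩ := h
    have e1 : a ≤ d := by
      by_contra hc
      exact k2 (h2 _ (by omega))
    have e2 := h1 _ k1
    have := ih k3 (a := a - 1) (b := b + 1)
      (by
        intro x hx
        rcases hx with hx | hx
        · have := h1 _ hx.1; omega
        · omega)
      (by intro x hx; exact Or.inl ⟨h2 x (by omega), by omega⟩)
    intro c hc
    simp only [List.mem_cons, List.length_cons] at hc ⊢
    push_cast
    rcases hc with rfl | hc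
    · omega
    · have := this c hc; omega

theorem finite_lists {α : Type*} (S : Set α) (hS : S.Finite) (m : ℕ) :
    {P : List α | P.length = m ∧ ∀ c ∈ P, c ∈ S}.Finite := by
  have := hS.to_subtype
  refine ((List.finite_length_eq S m).image (List.map Subtype.val)).subset ?_
  rintro P ⟨h1, h2⟩
  refine ⟨P.attach.map (fun c => ⟨c.1, h2 _ c.2⟩), by simp [h1], ?_⟩
  simp [List.map_map, Function.comp_def]

theorem str_bound {m : ℕ} {P : List ℤ} (h : P ∈ Str m) : ∀ c ∈ P, -(m : ℤ) ≤ c ∧ c ≤ m := by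
  obtain ⟨h1, N, h2⟩ := h
  have := path_bound h2 (a := 0) (b := 0) (fun x hx => hx) (fun x hx => hx)
  intro c hc
  have := this c hc
  rw [h1] at this; omega

theorem str_finite (m : ℕ) : (Str m).Finite := by
  refine (finite_lists (Set.Icc (-(m : ℤ)) m) (Set.finite_Icc _ _) m).subset ?_
  intro P h
  exact ⟨h.1, fun c hc => str_bound h c hc⟩

end LRT

namespace LRT

/-- bead set of a partition -/
def bd (π : ℕ → ℕ) : Set ℤ := {x | ∃ i : ℕ, x = (π i : ℤ) - i}

theorem bd_zero : bd (fun _ => 0) = M0 := by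
  ext x
  simp only [bd, M0, Set.mem_ofPred_eq]
  constructor
  · rintro ⟨i, rfl⟩; push_cast; omega
  · intro h; exact ⟨x.natAbs, by omega⟩

theorem bead_lt {π : ℕ → ℕ} (h : Antitone π) {i j : ℕ} (hij : i < j) :
    (π j : ℤ) - j < (π i : ℤ) - i := by
  have := h hij.le
  omega

theorem bead_inj {π : ℕ → ℕ} (h : Antitone π) {i j : ℕ}
    (hij : (π j : ℤ) - j = (π i : ℤ) - i) : i = j := by
  rcases lt_trichotomy i j with h1 | h1 | h1
  · have := bead_lt h h1; omega
  · exact h1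
  · have := bead_lt h h1; omega

theorem isPartition_update {π : ℕ → ℕ} (h : IsPartition π) {i : ℕ}
    (hi : ∀ k, k + 1 = i → π i < π k) : IsPartition (Function.update π i (π i + 1)) := by
  obtain ⟨h1, n, hn⟩ := h
  constructor
  · apply antitone_nat_of_succ_le
    intro k
    have := h1 (Nat.le_succ k)
    simp only [Function.update_apply]
    split_ifs with e1 e2 e2
    · omega
    · have := hi k e1; subst e1; omega
    · subst e2; simp at this; omega
    · exact this
  · refine ⟨max n (i + 1), fun k hk => ?_⟩
    rw [Function.update_of_ne (by omega)]
    exact hn k (by omega)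

theorem stepTo_bd {π : ℕ → ℕ} (h : Antitone π) (i : ℕ) :
    stepTo (bd π) ((π i : ℤ) - i) = bd (Function.update π i (π i + 1)) := by
  ext x
  simp only [mem_stepTo, bd, Set.mem_ofPred_eq]
  constructor
  · rintro (⟨⟨j, rfl⟩, hj⟩ | rfl)
    · have : j ≠ i := by rintro rfl; exact hj rfl
      exact ⟨j, by rw [Function.update_of_ne this]⟩
    · exact ⟨i, by simp; ring⟩
  · rintro ⟨j, rfl⟩
    by_cases hj : j = i
    · subst hj; right; simp; ring
    · left
      rw [Function.update_of_ne hj]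
      exact ⟨⟨j, rfl⟩, fun hc => hj (bead_inj h hc).symm⟩

theorem bd_step {π : ℕ → ℕ} (h : IsPartition π) {c : ℤ} (h1 : c ∈ bd π) (h2 : c + 1 ∉ bd π) :
    ∃ i, c = (π i : ℤ) - i ∧ IsPartition (Function.update π i (π i + 1)) ∧
      stepTo (bd π) c = bd (Function.update π i (π i + 1)) := by
  obtain ⟨i, rfl⟩ := h1
  refine ⟨i, rfl, isPartition_update h ?_, stepTo_bd h.1 i⟩
  rintro k rfl
  have := h.1 (Nat.le_succ k)
  rcases Nat.lt_or_ge (π (k + 1)) (π k) with h3 | h3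
  · exact h3
  · exfalso; apply h2
    refine ⟨k, ?_⟩
    simp only [Nat.succ_eq_add_one] at this
    have : π k = π (k + 1) := by omega
    rw [this]; push_cast; ring

theorem bd_step_conv {π : ℕ → ℕ} (h : IsPartition π) {i : ℕ} (hi : ∀ k, k + 1 = i → π i < π k) :
    (π i : ℤ) - i ∈ bd π ∧ (π i : ℤ) - i + 1 ∉ bd π ∧
      stepTo (bd π) ((π i : ℤ) - i) = bd (Function.update π i (π i + 1)) := by
  refine ⟨⟨i, rfl⟩, ?_, stepTo_bd h.1 i⟩
  rintro ⟨j, hj⟩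
  rcases lt_trichotomy j i with h1 | rfl | h1
  · have h2 := h.1 (show j ≤ i - 1 by omega)
    have h3 := hi (i - 1) (by omega)
    omega
  · omega
  · have := bead_lt h.1 h1; omega

theorem bd_inj {π ρ : ℕ → ℕ} (h : IsPartition π) (h' : IsPartition ρ) (he : bd π = bd ρ) :
    π = ρ := by
  have key : ∀ (π ρ : ℕ → ℕ), Antitone π → Antitone ρ → bd π = bd ρ →
      ∀ n, (∀ k < n, π k = ρ k) → π n ≤ ρ n := by
    intro π ρ h h' he n hn
    have : (π n : ℤ) - n ∈ bd ρ := he ▸ ⟨n, rfl⟩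
    obtain ⟨j, hj⟩ := this
    rcases lt_or_ge j n with h1 | h1
    · have h2 := bead_lt h h1
      rw [hn j h1] at h2; omega
    · have := h' h1; omega
  funext n
  induction n using Nat.strong_induction_on with
  | _ n ih =>
    exact le_antisymm (key π ρ h.1 h'.1 he n ih)
      (key ρ π h'.1 h.1 he.symm n (fun k hk => (ih k hk).symm))

theorem path_bd {π : ℕ → ℕ} (h : IsPartition π) {w : List ℤ} {N : Set ℤ} (hw : Path (bd π) w N) :
    ∃ ρ, IsPartition ρ ∧ N = bd ρ ∧ (∀ i, π i ≤ ρ i) ∧ ∀ n, (∀ k, n ≤ k → ρ k = 0) →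
      ∑ i ∈ Finset.range n, ρ i = ∑ i ∈ Finset.range n, π i + w.length := by
  induction w generalizing π with
  | nil => exact ⟨π, h, hw.symm, fun i => le_rfl, fun n _ => by simp⟩
  | cons c w ih =>
    obtain ⟨h1, h2, h3⟩ := hw
    obtain ⟨i, rfl, h5, h6⟩ := bd_step h h1 h2
    rw [h6] at h3
    obtain ⟨ρ, k1, k2, k3, k4⟩ := ih h5 h3
    refine ⟨ρ, k1, k2, ?_, ?_⟩
    · intro j
      have := k3 j
      simp only [Function.update_apply] at this
      split_ifs at this with e
      · subst e; omega
      · exact this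
    · intro n hn
      have hi : i < n := by
        by_contra hc
        have h7 := k3 i
        rw [hn i (by omega)] at h7
        simp at h7
      rw [k4 n hn, Finset.sum_update_of_mem (Finset.mem_range.2 hi),
        ← Finset.add_sum_erase _ π (Finset.mem_range.2 hi), ← Finset.erase_eq]
      simp; ring

theorem isPartition_zero : IsPartition (fun _ => 0) := ⟨fun _ _ _ => le_rfl, 0, fun _ _ => rfl⟩

theorem path_length_eq {N : Set ℤ} {P Q : List ℤ} (h1 : Path M0 P N) (h2 : Path M0 Q N) :
    P.length = Q.length := by
  rw [← bd_zero] at h1 h2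
  obtain ⟨ρ, a1, a2, a3, a4⟩ := path_bd isPartition_zero h1
  obtain ⟨ρ', b1, b2, b3, b4⟩ := path_bd isPartition_zero h2
  have := bd_inj a1 b1 (by rw [← a2, ← b2])
  subst this
  obtain ⟨n, hn⟩ := a1.2
  have := a4 n hn
  have := b4 n hn
  omega

/-- consecutive run of integers -/
def run : ℤ → ℕ → List ℤ
  | _, 0 => []
  | s, a + 1 => s :: run (s + 1) a

theorem run_length (s : ℤ) (a : ℕ) : (run s a).length = a := by
  induction a generalizing s with
  | zero => rfl
  | succ a ih => simp [run, ih]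

theorem run_succ (s : ℤ) (a : ℕ) : run s (a + 1) = run s a ++ [s + a] := by
  induction a generalizing s with
  | zero => simp [run]
  | succ a ih =>
    have := ih (s + 1)
    rw [run, this, run]; simp; ring

theorem mem_run {s x : ℤ} {a : ℕ} : x ∈ run s a ↔ s ≤ x ∧ x < s + a := by
  induction a generalizing s with
  | zero => simp [run]
  | succ a ih =>
    simp only [run, List.mem_cons, ih]; push_cast; omega

theorem run_sorted (s : ℤ) (a : ℕ) : (run s a).Pairwise (· < ·) := by
  induction a generalizing s with
  | zero => simp [run]
  | succ a ih =>
    rw [run, List.pairwise_cons]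
    exact ⟨fun x hx => by have := mem_run.1 hx; omega, ih _⟩

theorem run_min {w : List ℤ} {s : ℤ} (h : w.Pairwise (· < ·)) (hs : ∀ x ∈ w, s ≤ x) :
    (run s w.length).sum ≤ w.sum ∧ ((run s w.length).sum = w.sum → w = run s w.length) := by
  induction w generalizing s with
  | nil => simp [run]
  | cons a w ih =>
    rw [List.pairwise_cons] at h
    have h0 := hs a (by simp)
    have := ih h.2 (s := s + 1) (fun x hx => by have := h.1 x hx; omega)
    simp only [List.length_cons, run, List.sum_cons]
    refine ⟨by omega, fun he => ?_⟩
    have e1 : a = s := by omega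
    rw [← this.2 (by omega), e1]

/-- superstandard word -/
def U : ℤ → List ℕ → List ℤ
  | _, [] => []
  | i, a :: α => run (-i) a ++ U (i + 1) α

theorem U_append (i : ℤ) (α β : List ℕ) : U i (α ++ β) = U i α ++ U (i + α.length) β := by
  induction α generalizing i with
  | nil => simp [U]
  | cons a α ih =>
    simp only [List.cons_append, U, ih, List.append_assoc, List.length_cons]
    congr 3; push_cast; ring

theorem U_length (i : ℤ) (α : List ℕ) : (U i α).length = α.sum := by
  induction α generalizing i with
  | nil => simp [U]
  | cons a α ih => simp [U, ih, run_length]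

/-- block increasing words -/
def BI : List ℕ → List ℤ → Prop
  | [], w => w = []
  | a :: α, w => ∃ u v, w = u ++ v ∧ u.length = a ∧ u.Pairwise (· < ·) ∧ BI α v

theorem BI_length {α : List ℕ} {w : List ℤ} (h : BI α w) : w.length = α.sum := by
  induction α generalizing w with
  | nil => simp [BI] at h; simp [h]
  | cons a α ih =>
    obtain ⟨u, v, rfl, h1, h2, h3⟩ := h
    simp [h1, ih h3]

theorem BI_U (i : ℤ) (α : List ℕ) : BI α (U i α) := by
  induction α generalizing i with
  | nil => rfl
  | cons a α ih => exact ⟨_, _, rfl, run_length _ _, run_sorted _ _, ih _⟩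

theorem asc_lt_length {k : ℕ} {w : List ℤ} (h : Asc k w) : k + 1 < w.length := by
  induction k generalizing w with
  | zero =>
    match w with
    | [] => exact h.elim
    | [a] => exact h.elim
    | a :: b :: t => simp
  | succ k ih =>
    match w with
    | [] => exact h.elim
    | a :: t =>
      rw [asc_succ] at h
      have := ih h
      simp; omega

theorem asc_append_right (u v : List ℤ) (k : ℕ) : Asc (u.length + k) (u ++ v) ↔ Asc k v := by
  induction u with
  | nil => simp
  | cons a u ih =>
    rw [List.length_cons, show u.length + 1 + k = (u.length + k) + 1 by ring, List.cons_append,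
      asc_succ, ih]

theorem asc_append_left (u v : List ℤ) (k : ℕ) (hk : k + 1 < u.length) :
    Asc k (u ++ v) ↔ Asc k u := by
  induction k generalizing u with
  | zero =>
    match u with
    | [] => simp at hk
    | [a] => simp at hk
    | a :: b :: t => rfl
  | succ k ih =>
    match u with
    | [] => simp at hk
    | a :: t =>
      rw [List.cons_append, asc_succ, asc_succ]
      exact ih t (by simpa using hk)

theorem pairwise_iff_asc (u : List ℤ) :
    u.Pairwise (· < ·) ↔ ∀ k, k + 1 < u.length → Asc k u := by
  rw [← List.isChain_iff_pairwise]
  induction u with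
  | nil => simp
  | cons a u ih =>
    match u with
    | [] => simp
    | b :: t =>
      rw [List.isChain_cons_cons, ih]
      constructor
      · rintro ⟨h1, h2⟩ k hk
        match k with
        | 0 => exact h1
        | k + 1 => rw [asc_succ]; exact h2 k (by simpa using hk)
      · intro h
        refine ⟨h 0 (by simp), fun k hk => ?_⟩
        have := h (k + 1) (by simpa using hk)
        rwa [asc_succ] at this

theorem BI_congr {α : List ℕ} {w w' : List ℤ} (hl : w.length = w'.length)
    (h : ∀ k, Asc k w ↔ Asc k w') (hb : BI α w) : BI α w' := by
  induction α generalizing w w' with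
  | nil =>
    simp only [BI] at hb ⊢; subst hb; exact List.length_eq_zero_iff.1 hl.symm
  | cons a α ih =>
    obtain ⟨u, v, rfl, h1, h2, h3⟩ := hb
    rw [List.length_append] at hl
    have e1 : (w'.take a).length = a := by rw [List.length_take]; omega
    refine ⟨w'.take a, w'.drop a, (List.take_append_drop a w').symm, e1, ?_, ?_⟩
    · rw [pairwise_iff_asc] at h2 ⊢
      intro k hk
      rw [e1] at hk
      rw [← asc_append_left _ (w'.drop a) k (by omega), List.take_append_drop, ← h,
        asc_append_left _ _ _ (by omega)]
      exact h2 k (by omega)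
    · refine ih ?_ ?_ h3
      · rw [List.length_drop]; omega
      · intro k
        rw [← asc_append_right u v, h, ← asc_append_right (w'.take a) (w'.drop a),
          List.take_append_drop, e1, h1]

theorem BI_min {α : List ℕ} {i : ℤ} {M N : Set ℤ} {P : List ℤ} (h : BI α P) (hP : Path M P N)
    (hM : ∀ x ≤ -i, x ∈ M) :
    (U i α).sum ≤ P.sum ∧ ((U i α).sum = P.sum → P = U i α) := by
  induction α generalizing i M P with
  | nil => simp only [BI] at h; subst h; simp [U]
  | cons a α ih =>
    obtain ⟨u, v, rfl, h1, h2, h3⟩ := h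
    obtain ⟨K, k1, k2⟩ := path_append.1 hP
    have hge : ∀ x ∈ u, -i ≤ x := by
      match u with
      | [] => simp
      | c :: u =>
        have hc : -i ≤ c := by
          by_contra hc
          exact k1.2.1 (hM _ (by omega))
        rw [List.pairwise_cons] at h2
        intro x hx
        rcases List.mem_cons.1 hx with rfl | hx
        · exact hc
        · have := h2.1 x hx; omega
    have hK : ∀ x ≤ -(i + 1), x ∈ K := by
      intro x hx
      by_contra hc
      have := hge x (path_notMem_of_mem k1 (hM x (by omega)) hc)
      omega
    have e1 := ih h3 k2 hK
    have e2 := run_min h2 hge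
    rw [h1] at e2
    simp only [U, List.sum_append]
    refine ⟨by omega, fun he => ?_⟩
    rw [← e1.2 (by omega), ← e2.2 (by omega)]

/-- truncated partition -/
def trunc (ν : ℕ → ℕ) (i a : ℕ) : ℕ → ℕ := fun k => if k < i then ν k else if k = i then a else 0

theorem isPartition_trunc {ν : ℕ → ℕ} (h : IsPartition ν) {i a : ℕ} (ha : a ≤ ν i) :
    IsPartition (trunc ν i a) := by
  constructor
  · apply antitone_nat_of_succ_le
    intro k
    have := h.1 (Nat.le_succ k)
    simp only [Nat.succ_eq_add_one] at this
    have ha2 : k + 1 = i → a ≤ ν (k + 1) := by rintro rfl; exact ha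
    unfold trunc
    split_ifs <;> omega
  · refine ⟨i + 1, fun k hk => ?_⟩
    unfold trunc
    rw [if_neg (by omega), if_neg (by omega)]

theorem path_row {ν : ℕ → ℕ} (h : IsPartition ν) (i a : ℕ) (ha : a ≤ ν i) :
    Path (bd (trunc ν i 0)) (run (-(i : ℤ)) a) (bd (trunc ν i a)) := by
  induction a with
  | zero => rfl
  | succ a ih =>
    rw [run_succ]
    have h1 : trunc ν i a i = a := by simp [trunc]
    have := bd_step_conv (isPartition_trunc h (show a ≤ ν i by omega)) (i := i) (by
      rintro k rfl
      rw [h1]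
      have := h.1 (Nat.le_succ k)
      simp only [Nat.succ_eq_add_one] at this
      simp only [trunc]
      rw [if_pos (by omega)]; omega)
    rw [h1] at this
    refine path_concat.2 ⟨_, ih (by omega), ?_⟩
    rw [show (-(i : ℤ) + a) = a - i by ring]
    refine ⟨this.1, this.2.1, this.2.2.trans ?_⟩
    congr 1
    funext k
    by_cases hk : k = i
    · subst hk; simp [trunc]
    · rw [Function.update_of_ne hk]; simp [trunc, hk]

theorem path_U {ν : ℕ → ℕ} (h : IsPartition ν) (n : ℕ) :
    Path M0 (U 0 ((List.range n).map ν)) (bd (trunc ν n 0)) := by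
  induction n with
  | zero =>
    simp only [List.range_zero, List.map_nil, U, Path]
    rw [← bd_zero]; congr 1; funext k; simp [trunc]
  | succ n ih =>
    rw [List.range_succ, List.map_append, U_append]
    refine path_append.2 ⟨_, ih, ?_⟩
    have := path_row h n (ν n) le_rfl
    simp only [U, List.map_cons, List.map_nil, List.append_nil, List.length_map, List.length_range]
    rw [zero_add]
    have e : trunc ν n (ν n) = trunc ν (n + 1) 0 := by
      funext k; simp only [trunc]
      by_cases h1 : k < n
      · simp [h1, show k < n + 1 by omega]
      · by_cases h2 : k = n
        · simp [h2]
        · simp [h1, h2, show ¬ k < n + 1 by omega]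
    rw [← e]; exact this

theorem path_U' {ν : ℕ → ℕ} (h : IsPartition ν) {n : ℕ} (hn : ∀ k, n ≤ k → ν k = 0) :
    Path M0 (U 0 ((List.range n).map ν)) (bd ν) := by
  have := path_U h n
  have e : trunc ν n 0 = ν := by
    funext k; simp only [trunc]
    split_ifs with h1 h2
    · rfl
    · exact (hn k (by omega)).symm
    · exact (hn k (by omega)).symm
  rwa [e] at this

theorem exists_U {N : Set ℤ} {P : List ℤ} (h : Path M0 P N) : ∃ α, Path M0 (U 0 α) N := by
  rw [← bd_zero] at h
  obtain ⟨ρ, a1, a2, a3, a4⟩ := path_bd isPartition_zero h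
  obtain ⟨n, hn⟩ := a1.2
  exact ⟨_, a2 ▸ path_U' a1 hn⟩

open Classical in
theorem uniq {X Y : Type} [Fintype X] [Fintype Y] (m : ℕ) (φ : X → List ℤ) (ψ : Y → List ℤ)
    (hφ : ∀ x, φ x ∈ Str m) (hψ : ∀ y, ψ y ∈ Str m)
    (iφ : ∀ k, ∀ P ∈ Str m, (Finset.univ.filter (fun x => φ x = dk k P)).card =
      (Finset.univ.filter (fun x => φ x = P)).card)
    (iψ : ∀ k, ∀ P ∈ Str m, (Finset.univ.filter (fun x => ψ x = dk k P)).card =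
      (Finset.univ.filter (fun x => ψ x = P)).card)
    (hs : ∀ α, (Finset.univ.filter (fun x => BI α (φ x))).card =
      (Finset.univ.filter (fun y => BI α (ψ y))).card) :
    ∀ P ∈ Str m, (Finset.univ.filter (fun x => φ x = P)).card =
      (Finset.univ.filter (fun x => ψ x = P)).card := by
  set f : List ℤ → ℕ := fun P => (Finset.univ.filter (fun x => φ x = P)).card with hf
  set g : List ℤ → ℕ := fun P => (Finset.univ.filter (fun x => ψ x = P)).card with hg
  change ∀ P ∈ Str m, f P = g P
  set S := (str_finite m).toFinset with hS
  by_contra hcon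
  push Not at hcon
  obtain ⟨P0, hP0, hne0⟩ := hcon
  obtain ⟨P, hP, hmax⟩ := Finset.exists_max_image (S.filter (fun P => f P ≠ g P)) List.sum
    ⟨P0, by simp [hS, hP0, hne0]⟩
  simp only [Finset.mem_filter, hS, Set.Finite.mem_toFinset] at hP hmax
  obtain ⟨⟨hlen, N, hN⟩, hne⟩ := hP
  obtain ⟨α, hα⟩ := exists_U hN
  have hl : (U 0 α).length = m := by rw [path_length_eq hα hN, hlen]
  have e1 : f (U 0 α) = f P := inv_of_path f iφ hlen hl hN hα
  have e2 : g (U 0 α) = g P := inv_of_path g iψ hlen hl hN hα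
  have e3 : (U 0 α).sum = P.sum :=
    inv_of_path (m := m) List.sum (fun k P _ => dk_sum k P) hlen hl hN hα
  have c1 : (Finset.univ.filter (fun x => BI α (φ x))).card =
      ∑ Q ∈ S.filter (fun Q => BI α Q), f Q := by
    rw [Finset.card_eq_sum_card_fiberwise (f := φ) (t := S.filter (fun Q => BI α Q))]
    · refine Finset.sum_congr rfl fun Q hQ => ?_
      rw [hf, Finset.filter_filter]
      congr 1; ext x; simp only [Finset.mem_filter, Finset.mem_univ, true_and] at hQ ⊢
      constructor
      · exact fun h => h.2
      · rintro rfl; exact ⟨hQ.2, rfl⟩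
    · intro x hx
      simp only [Finset.coe_filter, Finset.mem_univ, true_and, Set.mem_ofPred_eq] at hx ⊢
      exact ⟨by simp [hS, hφ], hx⟩
  have c2 : (Finset.univ.filter (fun x => BI α (ψ x))).card =
      ∑ Q ∈ S.filter (fun Q => BI α Q), g Q := by
    rw [Finset.card_eq_sum_card_fiberwise (f := ψ) (t := S.filter (fun Q => BI α Q))]
    · refine Finset.sum_congr rfl fun Q hQ => ?_
      rw [hg, Finset.filter_filter]
      congr 1; ext x; simp only [Finset.mem_filter, Finset.mem_univ, true_and] at hQ ⊢
      constructor
      · exact fun h => h.2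
      · rintro rfl; exact ⟨hQ.2, rfl⟩
    · intro x hx
      simp only [Finset.coe_filter, Finset.mem_univ, true_and, Set.mem_ofPred_eq] at hx ⊢
      exact ⟨by simp [hS, hψ], hx⟩
  have hU : U 0 α ∈ S.filter (fun Q => BI α Q) := by
    simp only [Finset.mem_filter, hS, Set.Finite.mem_toFinset]
    exact ⟨⟨hl, N, hα⟩, BI_U 0 α⟩
  have hh := hs α
  rw [c1, c2, ← Finset.add_sum_erase _ f hU, ← Finset.add_sum_erase _ g hU] at hh
  have : ∑ Q ∈ (S.filter (fun Q => BI α Q)).erase (U 0 α), f Q =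
      ∑ Q ∈ (S.filter (fun Q => BI α Q)).erase (U 0 α), g Q := by
    refine Finset.sum_congr rfl fun Q hQ => ?_
    simp only [Finset.mem_erase, Finset.mem_filter, hS, Set.Finite.mem_toFinset] at hQ
    obtain ⟨q1, ⟨q2, N', q3⟩, q4⟩ := hQ
    by_contra hc
    have h1 := hmax Q ⟨⟨q2, N', q3⟩, hc⟩
    have h2 := BI_min q4 q3 (i := 0) (fun x hx => by simpa [M0] using hx)
    exact q1 (h2.2 (by omega))
  rw [this] at hh
  apply hne
  rw [← e1, ← e2]; omega

end LRT

namespace LRT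

theorem ncard_filter_eq {X : Type} (A : Set X) [Fintype A] (p : X → Prop)
    [DecidablePred fun x : A => p x.1] :
    (Finset.univ.filter (fun x : A => p x.1)).card = {x | x ∈ A ∧ p x}.ncard := by
  have : {x | x ∈ A ∧ p x} =
      ((Finset.univ.filter (fun x : A => p x.1)).map (Function.Embedding.subtype _) : Set X) := by
    ext x; simp [and_comm]
  rw [this, Set.ncard_coe_finset, Finset.card_map]

theorem uniq' {X Y : Type} (A : Set X) (B : Set Y) (hA : A.Finite) (hB : B.Finite)
    (m : ℕ) (φ : X → List ℤ) (ψ : Y → List ℤ)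
    (hφ : ∀ x ∈ A, φ x ∈ Str m) (hψ : ∀ y ∈ B, ψ y ∈ Str m)
    (iφ : ∀ k, ∀ P ∈ Str m, {x | x ∈ A ∧ φ x = dk k P}.ncard = {x | x ∈ A ∧ φ x = P}.ncard)
    (iψ : ∀ k, ∀ P ∈ Str m, {x | x ∈ B ∧ ψ x = dk k P}.ncard = {x | x ∈ B ∧ ψ x = P}.ncard)
    (hs : ∀ α, {x | x ∈ A ∧ BI α (φ x)}.ncard = {x | x ∈ B ∧ BI α (ψ x)}.ncard) :
    ∀ P ∈ Str m, {x | x ∈ A ∧ φ x = P}.ncard = {x | x ∈ B ∧ ψ x = P}.ncard := by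
  classical
  have := hA.fintype
  have := hB.fintype
  have h := uniq (X := A) (Y := B) m (fun x => φ x.1) (fun y => ψ y.1) (fun x => hφ _ x.2)
    (fun y => hψ _ y.2)
    (fun k P hP => by
      rw [ncard_filter_eq A (fun x => φ x = dk k P), ncard_filter_eq A (fun x => φ x = P)]
      exact iφ k P hP)
    (fun k P hP => by
      rw [ncard_filter_eq B (fun x => ψ x = dk k P), ncard_filter_eq B (fun x => ψ x = P)]
      exact iψ k P hP)
    (fun α => by
      rw [ncard_filter_eq A (fun x => BI α (φ x)), ncard_filter_eq B (fun x => BI α (ψ x))]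
      exact hs α)
  intro P hP
  have := h P hP
  rwa [ncard_filter_eq A (fun x => φ x = P), ncard_filter_eq B (fun x => ψ x = P)] at this

theorem ncard_eq_of_rel {X Y : Type} (A : Set X) (B : Set Y) (R : X → Y → Prop)
    (h1 : ∀ a ∈ A, ∃ b ∈ B, R a b) (h2 : ∀ b ∈ B, ∃ a ∈ A, R a b)
    (h3 : ∀ a ∈ A, ∀ b ∈ B, ∀ b' ∈ B, R a b → R a b' → b = b')
    (h4 : ∀ a ∈ A, ∀ a' ∈ A, ∀ b ∈ B, R a b → R a' b → a = a') : A.ncard = B.ncard := by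
  choose f hf using h1
  refine Set.ncard_congr f (fun a ha => (hf a ha).1) ?_ ?_
  · intro a b ha hb hab
    exact h4 a ha b hb _ (hf a ha).1 (hf a ha).2 (hab ▸ (hf b hb).2)
  · intro b hb
    obtain ⟨a, ha, hab⟩ := h2 b hb
    exact ⟨a, ha, h3 a ha _ (hf a ha).1 _ hb (hf a ha).2 hab⟩

def dstep (M : Set ℤ) (p : ℤ) : Set ℤ := {x | (x ∈ M ∧ x ≠ p) ∨ x = p + 2}

theorem mem_dstep {M : Set ℤ} {c x : ℤ} : x ∈ dstep M c ↔ (x ∈ M ∧ x ≠ c) ∨ x = c + 2 := Iff.rfl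

/-- domino words -/
def DPath : Set ℤ → List ℤ → Set ℤ → Prop
  | M, [], N => M = N
  | M, c :: w, N => c ∈ M ∧ c + 2 ∉ M ∧ DPath (dstep M c) w N

theorem dpath_append {M N : Set ℤ} {u v : List ℤ} :
    DPath M (u ++ v) N ↔ ∃ K, DPath M u K ∧ DPath K v N := by
  induction u generalizing M with
  | nil => simp [DPath]
  | cons a u ih => simp only [List.cons_append, DPath, ih]; tauto

theorem dpath_concat {M N : Set ℤ} {u : List ℤ} {a : ℤ} : DPath M (u ++ [a]) N ↔
    ∃ K, DPath M u K ∧ a ∈ K ∧ a + 2 ∉ K ∧ dstep K a = N := by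
  rw [dpath_append]; simp [DPath]

theorem dpath_det {M N N' : Set ℤ} {w : List ℤ} (h : DPath M w N) (h' : DPath M w N') :
    N = N' := by
  induction w generalizing M with
  | nil => simp only [DPath] at h h'; rw [← h, ← h']
  | cons a w ih => exact ih h.2.2 h'.2.2

theorem domino_of_path {K N : Set ℤ} {c c' : ℤ} (hc : c' = c + 1 ∨ c = c' + 1)
    (h : Path K [c, c'] N) :
    min c c' ∈ K ∧ min c c' + 2 ∉ K ∧ dstep K (min c c') = N := by
  obtain ⟨h1, h2, h3, h4, rfl⟩ := h
  simp only [mem_stepTo] at h3 h4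
  rcases hc with rfl | rfl
  · rw [min_eq_left (by omega)]
    refine ⟨h1, ?_, ?_⟩
    · intro h; exact h4 (Or.inl ⟨by rw [add_assoc]; exact h, by omega⟩)
    · ext x; simp only [mem_dstep, mem_stepTo]
      by_cases hx : x = c + 1
      · subst hx; simp [h2]
      · have : c + 1 + 1 = c + 2 := by ring
        rw [this]; tauto
  · rw [min_eq_right (by omega)]
    refine ⟨?_, ?_, ?_⟩
    · rcases h3 with h | h
      · exact h.1
      · omega
    · rwa [show c' + 2 = c' + 1 + 1 by ring]
    · ext x; simp only [mem_dstep, mem_stepTo]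
      have : c' + 1 + 1 = c' + 2 := by ring
      rw [this]
      by_cases hx : x = c' + 1
      · subst hx; simp [h1]
      · by_cases hx2 : x = c' + 2
        · subst hx2; simp
        · tauto

theorem path_of_domino {K : Set ℤ} {p : ℤ} (h1 : p ∈ K) (h2 : p + 2 ∉ K) :
    ∃ c c', (c' = c + 1 ∨ c = c' + 1) ∧ min c c' = p ∧ Path K [c, c'] (dstep K p) := by
  have key : ∀ c c', (c' = c + 1 ∨ c = c' + 1) → min c c' = p → c ∈ K → c + 1 ∉ K →
      c' ∈ stepTo K c → c' + 1 ∉ stepTo K c → 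
      ∃ c c', (c' = c + 1 ∨ c = c' + 1) ∧ min c c' = p ∧ Path K [c, c'] (dstep K p) := by
    intro c c' a1 a2 a3 a4 a5 a6
    have : Path K [c, c'] (stepTo (stepTo K c) c') := ⟨a3, a4, a5, a6, rfl⟩
    refine ⟨c, c', a1, a2, ?_⟩
    have e := (domino_of_path a1 this).2.2
    rw [a2] at e; rw [e]; exact this
  by_cases h3 : p + 1 ∈ K
  · refine key (p + 1) p (by omega) (by omega) h3 (by rwa [add_assoc]) ?_ ?_
    · exact Or.inl ⟨h1, by omega⟩
    · simp [mem_stepTo]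
  · refine key p (p + 1) (by omega) (by omega) h1 h3 ?_ ?_
    · exact Or.inr rfl
    · simp only [mem_stepTo]
      rintro (h | h)
      · exact h2 (by rw [show p + 2 = p + 1 + 1 by ring]; exact h.1)
      · omega

/-- the order of the two letters is determined -/
theorem domino_unique {K N N' : Set ℤ} {c c' d d' : ℤ} (hc : c' = c + 1 ∨ c = c' + 1)
    (hd : d' = d + 1 ∨ d = d' + 1) (h : Path K [c, c'] N) (h' : Path K [d, d'] N')
    (he : min c c' = min d d') : c = d ∧ c' = d' := by
  obtain ⟨h1, h2, h3, h4, -⟩ := h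
  obtain ⟨k1, k2, k3, k4, -⟩ := h'
  rcases hc with rfl | rfl <;> rcases hd with rfl | rfl
  · omega
  · have : c = d' := by omega
    subst this; exact absurd k1 h2
  · have : c' = d := by omega
    subst this; exact absurd h1 k2
  · omega

inductive Rel : List ℤ → List ℤ → List ℤ → Prop
  | nil : Rel [] [] []
  | snoc {p P Q Q' : List ℤ} {x c c' : ℤ} (h : Rel p P Q) (hs : slideR x Q' = (Q, c))
      (hc : c' = c + 1 ∨ c = c' + 1) : Rel (p ++ [min c c']) (P ++ [x]) (Q' ++ [c'])

theorem Rel.length {p P Q : List ℤ} (h : Rel p P Q) :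
    P.length = p.length ∧ Q.length = p.length := by
  induction h with
  | nil => simp
  | @snoc p P Q Q' x c c' h hs hc ih =>
    have := slideR_length x Q'
    rw [hs] at this
    simp only [List.length_append, List.length_cons, List.length_nil]
    simp only at this
    omega

theorem Rel.fixed {p P Q : List ℤ} (h : Rel p P Q) : sw P Q = (P, Q) := by
  induction h with
  | nil => rfl
  | @snoc p P Q Q' x c c' h hs hc ih =>
    have e1 : sw [x] (Q' ++ [c']) = (Q ++ [c], [c']) := by
      simp only [sw, slideR_append, hs, slideR]
      have : swp c c' = (c, c') := by unfold swp; rw [if_pos (by omega)]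
      simp [this]
    have e2 : sw Q [c] = ([x], Q') := by
      have := slideL_slideR x Q'
      rw [hs] at this
      simp only at this
      rw [sw_cons_right, this]; simp [sw_nil_right]
    rw [sw_append_left, e1]
    simp only [sw_append_right, ih, e2]

theorem Rel.path_snoc {P Q Q' : List ℤ} {x c c' : ℤ} {M N : Set ℤ}
    (hs : slideR x Q' = (Q, c)) :
    Path M ((P ++ [x]) ++ (Q' ++ [c'])) N ↔ Path M ((P ++ Q) ++ [c, c']) N := by
  have hs' := slideL_slideR x Q'
  rw [hs] at hs'
  simp only at hs'
  constructor
  · intro h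
    rw [List.append_assoc] at h
    obtain ⟨K, h1, h2⟩ := path_append.1 h
    have h3 : Path K (x :: (Q' ++ [c'])) N := h2
    have := path_slideR h3
    rw [hs] at this
    rw [List.append_assoc]
    exact path_append.2 ⟨K, h1, this⟩
  · intro h
    rw [List.append_assoc] at h
    obtain ⟨K, h1, h2⟩ := path_append.1 h
    have := path_slideL h2
    rw [hs'] at this
    rw [List.append_assoc]
    exact path_append.2 ⟨K, h1, this⟩

theorem Rel.dpath {p P Q : List ℤ} {M N : Set ℤ} (h : Rel p P Q) (hP : Path M (P ++ Q) N) :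
    DPath M p N := by
  induction h generalizing N with
  | nil => exact hP
  | @snoc p P Q Q' x c c' h hs hc ih =>
    rw [Rel.path_snoc hs] at hP
    obtain ⟨K, h1, h2⟩ := path_append.1 hP
    exact dpath_concat.2 ⟨K, ih h1, domino_of_path hc h2⟩

theorem Rel.exists_of_dpath {p : List ℤ} {M N : Set ℤ} (h : DPath M p N) :
    ∃ P Q, Rel p P Q ∧ Path M (P ++ Q) N := by
  induction p using List.reverseRecOn generalizing N with
  | nil => exact ⟨[], [], Rel.nil, h⟩
  | append_singleton p a ih =>
    obtain ⟨K, h1, h2, h3, rfl⟩ := dpath_concat.1 h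
    obtain ⟨P, Q, h4, h5⟩ := ih h1
    obtain ⟨c, c', h6, rfl, h8⟩ := path_of_domino h2 h3
    have hs := slideR_slideL c Q
    refine ⟨P ++ [(slideL Q c).1], (slideL Q c).2 ++ [c'], Rel.snoc h4 hs h6, ?_⟩
    rw [Rel.path_snoc hs]
    exact path_append.2 ⟨K, h5, h8⟩

theorem Rel.exists_of_fixed (n : ℕ) : ∀ {P Q : List ℤ} {M N : Set ℤ}, P.length = n →
    Q.length = n → sw P Q = (P, Q) → Path M (P ++ Q) N → ∃ p, Rel p P Q := by
  induction n with
  | zero =>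
    intro P Q M N h1 h2 _ _
    rw [List.length_eq_zero_iff.1 h1, List.length_eq_zero_iff.1 h2]
    exact ⟨[], Rel.nil⟩
  | succ n ih =>
    intro P Q M N h1 h2 hf hP
    obtain ⟨P, x, rfl⟩ := List.eq_nil_or_concat P |>.resolve_left (by rintro rfl; simp at h1)
    obtain ⟨Q', c', rfl⟩ := List.eq_nil_or_concat Q |>.resolve_left (by rintro rfl; simp at h2)
    simp only [List.concat_eq_append] at *
    obtain ⟨Q, c, hs⟩ : ∃ Q c, slideR x Q' = (Q, c) := ⟨_, _, rfl⟩
    rw [Rel.path_snoc hs] at hP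
    obtain ⟨K, k1, k2⟩ := path_append.1 hP
    have hne : c ≠ c' := path_ne k2
    have e1 : sw [x] (Q' ++ [c']) = (Q ++ [(swp c c').1], [(swp c c').2]) := by
      simp only [sw, slideR_append, hs, slideR]
    rw [sw_append_left, e1] at hf
    simp only [Prod.mk.injEq] at hf
    obtain ⟨f1, f2⟩ := hf
    have f3 := List.append_inj' f2 rfl
    have hc : (c = c' + 1 ∨ c' = c + 1) ∧ (swp c c').1 = c := by
      rcases swp_cases c c' with ⟨g1, g2⟩ | ⟨g1, g2⟩
      · exact ⟨g1, by rw [g2]⟩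
      · rw [g2] at f3; simp at f3; exact absurd f3.2 hne
    rw [hc.2] at f1 f3
    rw [sw_append_right, sw_cons_right, sw_nil_right] at f1 f3
    have f4 := List.append_inj' f1 rfl
    simp only [List.cons.injEq, and_true] at f4
    have f5 := f3.1
    have hs2 := slideR_slideL c (sw P Q).2
    rw [f4.2, f5, hs] at hs2
    simp only [Prod.mk.injEq, and_true] at hs2
    have hl := slideR_length x Q'
    rw [hs] at hl
    simp only [List.length_append, List.length_cons, List.length_nil] at h1 h2 hl
    obtain ⟨p, hp⟩ := ih (P := P) (Q := Q) (by omega) (by omega) (Prod.ext f4.1 hs2.symm) k1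
    exact ⟨_, Rel.snoc hp hs (by omega)⟩

theorem Rel.inv {p P Q : List ℤ} (h : Rel p P Q) : (p = [] ∧ P = [] ∧ Q = []) ∨
    ∃ p' P' Q' Q1 x c c', p = p' ++ [min c c'] ∧ P = P' ++ [x] ∧ Q = Q1 ++ [c'] ∧ Rel p' P' Q' ∧
      slideR x Q1 = (Q', c) ∧ (c' = c + 1 ∨ c = c' + 1) := by
  cases h with
  | nil => left; simp
  | @snoc p P Q Q' x c c' h hs hc => right; exact ⟨p, P, Q, Q', x, c, c', rfl, rfl, rfl, h, hs, hc⟩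

theorem Rel.unique_p {p p' P Q : List ℤ} (h : Rel p P Q) (h' : Rel p' P Q) : p = p' := by
  induction h generalizing p' with
  | nil =>
    rcases h'.inv with h | ⟨p', P', Q', Q1, x, c, c', h1, h2, h3, h4, h5, h6⟩
    · exact h.1.symm
    · simp at h2
  | @snoc p P Q Q' x c c' h hs hc ih =>
    rcases h'.inv with h | ⟨p1, P1, Q2, Q1, x1, c1, c1', h1, h2, h3, h4, h5, h6⟩
    · simp at h
    · have e2 := List.append_inj' h2 rfl
      have e3 := List.append_inj' h3 rfl
      simp only [List.cons.injEq, and_true] at e2 e3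
      obtain ⟨rfl, rfl⟩ := e2
      obtain ⟨rfl, rfl⟩ := e3
      rw [hs] at h5
      simp only [Prod.mk.injEq] at h5
      obtain ⟨rfl, rfl⟩ := h5
      rw [h1, ih h4]

theorem Rel.unique_PQ {p P Q P' Q' : List ℤ} {M N N' : Set ℤ} (h : Rel p P Q) (h' : Rel p P' Q')
    (hP : Path M (P ++ Q) N) (hP' : Path M (P' ++ Q') N') : P = P' ∧ Q = Q' := by
  induction h generalizing P' Q' N N' with
  | nil =>
    rcases h'.inv with h | ⟨p', P', Q', Q1, x, c, c', h1, h2, h3, h4, h5, h6⟩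
    · exact ⟨h.2.1.symm, h.2.2.symm⟩
    · simp at h1
  | @snoc p P Q Q1 x c c' h hs hc ih =>
    rcases h'.inv with h | ⟨p1, P1, Q2, Q3, x1, c1, c1', h1, rfl, rfl, h4, h5, h6⟩
    · simp at h
    · have e2 := List.append_inj' h1 rfl
      simp only [List.cons.injEq, and_true] at e2
      obtain ⟨rfl, e3⟩ := e2
      rw [Rel.path_snoc hs] at hP
      rw [Rel.path_snoc h5] at hP'
      obtain ⟨K, k1, k2⟩ := path_append.1 hP
      obtain ⟨K', k1', k2'⟩ := path_append.1 hP'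
      obtain ⟨rfl, rfl⟩ := ih h4 k1 k1'
      obtain rfl := path_det k1 k1'
      obtain ⟨rfl, rfl⟩ := domino_unique hc h6 k2 k2' e3
      have s1 := slideL_slideR x Q1
      have s2 := slideL_slideR x1 Q3
      rw [hs] at s1; rw [h5, s1] at s2
      simp only [Prod.mk.injEq] at s2
      rw [s2.1, s2.2]; simp

theorem domino_compare {K N : Set ℤ} {a a' b b' : ℤ} (ha : a' = a + 1 ∨ a = a' + 1)
    (hb : b' = b + 1 ∨ b = b' + 1) (h : Path K [a, a', b, b'] N) :
    a < (swp a' b).1 ↔ min a a' < min b b' := by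
  have h1 := path_ne h
  have h2 := path_ne3 h
  have h3 := path_ne h.2.2
  have h4 := path_ne3 h.2.2
  rcases swp_cases a' b with ⟨g1, g2⟩ | ⟨g1, g2⟩ <;> rw [g2] <;> simp only <;> omega

theorem Rel.asc {p P Q : List ℤ} {M N : Set ℤ} (h : Rel p P Q) (hP : Path M (P ++ Q) N) (k : ℕ) :
    Asc k P ↔ Asc k p := by
  induction h generalizing N with
  | nil => rfl
  | @snoc p P Q Q' x c c' h hs hc ih =>
    rw [Rel.path_snoc hs] at hP
    obtain ⟨K, k1, k2⟩ := path_append.1 hP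
    have hlen := h.length
    rcases lt_trichotomy (k + 1) P.length with hk | hk | hk
    · rw [asc_append_left _ _ _ hk, asc_append_left _ _ _ (by omega)]
      exact ih k1
    · rcases h.inv with h0 | ⟨p0, P0, Q0, Q1, x0, c0, c0', rfl, rfl, rfl, h4, h5, h6⟩
      · rw [h0.2.1] at hk; simp at hk
      · have hlen0 := h4.length
        simp only [List.length_append, List.length_cons, List.length_nil] at hk
        have ek : k = P0.length + 0 := by omega
        have ek' : k = p0.length + 0 := by omega
        rw [List.append_assoc, List.append_assoc]
        conv_lhs => rw [ek, asc_append_right]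
        conv_rhs => rw [ek', asc_append_right]
        simp only [List.cons_append, List.nil_append, asc_zero]
        have p1 : Path M ((P0 ++ [x0]) ++ (Q1 ++ [c0']) ++ [c, c']) N := hP
        obtain ⟨K0, j1, j2⟩ := path_append.1 k1
        have q1 : Path M ((P0 ++ [x0]) ++ (Q1 ++ [c0'])) K := k1
        rw [Rel.path_snoc h5] at q1
        obtain ⟨K1, j3, j4⟩ := path_append.1 q1
        have j5 : Path K1 [c0, c0', c, c'] N := by
          have : Path K1 ([c0, c0'] ++ [c, c']) N := path_append.2 ⟨K, j4, k2⟩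
          exact this
        rw [← domino_compare h6 hc j5]
        -- slide
        have s1 := slideL_slideR x Q'
        rw [hs] at s1
        have s0 := slideL_slideR x0 Q1
        rw [h5] at s0
        simp only at s0 s1
        have s2 : (slideL Q1 (swp c0' c).1).1 = x := by
          have : ∀ (u : List ℤ) (a f : ℤ), (slideL (u ++ [a]) f).1 = (slideL u (swp a f).1).1 := by
            intro u a f
            induction u with
            | nil => simp [slideL]
            | cons b u ih => simp only [List.cons_append, slideL, ih]
          rw [← this, s1]
        have s3 : (sw Q0 [c0, (swp c0' c).1]).1 = [x0, x] := by
          rw [sw_cons_right, s0]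
          simp only
          rw [sw_cons_right, s2]; simp [sw_nil_right]
        obtain ⟨K2, j6, j7⟩ := path_append.1 j3
        have j8 : Path K2 (Q0 ++ c0 :: (swp c0' c).1 :: (swp c0' c).2 :: [c']) N := by
          refine path_append.2 ⟨K1, j7, j5.1, j5.2.1, path_swp j5.2.2⟩
        have j9 : Path K2 ((Q0 ++ [c0, (swp c0' c).1]) ++ ((swp c0' c).2 :: [c'])) N := by
          simpa using j8
        obtain ⟨K3, j10⟩ := path_append_left j9
        have := asc_sw j10 0
        rw [s3] at this
        exact this
    · constructor
      · intro h; have := asc_lt_length h; simp at this; omega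
      · intro h; have := asc_lt_length h; simp at this; omega

/-- fixed pairs under switching -/
def G (m : ℕ) (N : Set ℤ) : Set (List ℤ × List ℤ) :=
  {x | x.1.length = m ∧ x.2.length = m ∧ Path M0 (x.1 ++ x.2) N ∧ sw x.1 x.2 = x}

theorem G_finite (m : ℕ) (N : Set ℤ) : (G m N).Finite := by
  have := (str_finite (m + m)).image (fun P => (P.take m, P.drop m))
  refine this.subset ?_
  rintro ⟨P, Q⟩ ⟨h1, h2, h3, -⟩
  simp only at h1 h2 h3
  refine ⟨P ++ Q, ⟨by simp [h1, h2], N, h3⟩, ?_⟩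
  simp [← h1]

theorem G_str {m : ℕ} {N : Set ℤ} {x : List ℤ × List ℤ} (h : x ∈ G m N) : x.1 ∈ Str m :=
  ⟨h.1, path_append_left h.2.2.1⟩

theorem G_dk {m : ℕ} {N : Set ℤ} {x : List ℤ × List ℤ} (h : x ∈ G m N) (k : ℕ) :
    (dk k x.1, dk k x.2) ∈ G m N := by
  obtain ⟨P, Q⟩ := x
  obtain ⟨h1, h2, h3, h4⟩ := h
  simp only at h1 h2 h3 h4
  obtain ⟨K, k1, k2⟩ := path_append.1 h3
  refine ⟨by simp [dk_length, h1], by simp [dk_length, h2],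
    path_append.2 ⟨K, path_dk k1, path_dk k2⟩, ?_⟩
  have e := sw_dk_left (u := P) (w := dk k Q) (path_append.2 ⟨K, k1, path_dk k2⟩) k
  simp only
  rw [e, sw_dk_right h3 k, h4]

theorem G_inv (m : ℕ) (N : Set ℤ) (k : ℕ) (P : List ℤ) :
    {x | x ∈ G m N ∧ x.1 = dk k P}.ncard = {x | x ∈ G m N ∧ x.1 = P}.ncard := by
  refine Set.ncard_congr (fun x _ => (dk k x.1, dk k x.2)) ?_ ?_ ?_
  · rintro x ⟨h1, h2⟩
    exact ⟨G_dk h1 k, by simp [h2, dk_dk]⟩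
  · rintro x y - - h
    simp only [Prod.mk.injEq] at h
    have e1 := congrArg (dk k) h.1
    have e2 := congrArg (dk k) h.2
    rw [dk_dk, dk_dk] at e1 e2
    exact Prod.ext e1 e2
  · rintro x ⟨h1, h2⟩
    exact ⟨(dk k x.1, dk k x.2), ⟨G_dk h1 k, by simp [h2]⟩, by simp [dk_dk]⟩

theorem G_BI (m : ℕ) (N : Set ℤ) (α : List ℕ) :
    {x | x ∈ G m N ∧ BI α x.1}.ncard =
      {p | (p.length = m ∧ DPath M0 p N) ∧ BI α p}.ncard := by
  refine ncard_eq_of_rel _ _ (fun x p => Rel p x.1 x.2) ?_ ?_ ?_ ?_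
  · rintro ⟨P, Q⟩ ⟨⟨h1, h2, h3, h4⟩, h5⟩
    obtain ⟨p, hp⟩ := Rel.exists_of_fixed m h1 h2 h4 h3
    have hl := hp.length
    exact ⟨p, ⟨⟨by rw [← hl.1]; exact h1, hp.dpath h3⟩,
      BI_congr hl.1 (fun k => hp.asc h3 k) h5⟩, hp⟩
  · rintro p ⟨⟨h1, h2⟩, h3⟩
    obtain ⟨P, Q, hp, hP⟩ := Rel.exists_of_dpath h2
    have hl := hp.length
    exact ⟨(P, Q), ⟨⟨by rw [← h1]; exact hl.1, by rw [← h1]; exact hl.2, hP, hp.fixed⟩,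
      BI_congr hl.1.symm (fun k => (hp.asc hP k).symm) h3⟩, hp⟩
  · intro a _ b _ b' _ r1 r2
    exact r1.unique_p r2
  · rintro a ha a' ha' b _ r1 r2
    have := r1.unique_PQ r2 ha.1.2.2.1 ha'.1.2.2.1
    exact Prod.ext this.1 this.2

end LRT

namespace LRT

/-- letters on runner `b` -/
def fil (b : Bool) (l : List (Bool × ℤ)) : List ℤ := (l.filter (fun x => x.1 == b)).map Prod.snd

theorem fil_nil (b : Bool) : fil b [] = [] := rfl
theorem fil_cons_same (b : Bool) (x : ℤ) (l : List (Bool × ℤ)) :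
    fil b ((b, x) :: l) = x :: fil b l := by simp [fil]
theorem fil_cons_diff {b b' : Bool} (h : b' ≠ b) (x : ℤ) (l : List (Bool × ℤ)) :
    fil b ((b', x) :: l) = fil b l := by simp [fil, h]
theorem fil_append (b : Bool) (l l' : List (Bool × ℤ)) :
    fil b (l ++ l') = fil b l ++ fil b l' := by simp [fil]
theorem fil_perm {b : Bool} {l l' : List (Bool × ℤ)} (h : l.Perm l') :
    (fil b l).Perm (fil b l') := (h.filter _).map _
theorem mem_fil {b : Bool} {l : List (Bool × ℤ)} {x : ℤ} : x ∈ fil b l ↔ (b, x) ∈ l := by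
  simp [fil]
theorem fil_length (l : List (Bool × ℤ)) :
    (fil false l).length + (fil true l).length = l.length := by
  induction l with
  | nil => rfl
  | cons a l ih =>
    obtain ⟨b, x⟩ := a
    cases b
    · rw [fil_cons_same, fil_cons_diff (by simp)]; simp; omega
    · rw [fil_cons_same, fil_cons_diff (by simp)]; simp; omega

theorem perm_of_fil {l l' : List (Bool × ℤ)} (h : ∀ b, fil b l = fil b l') : l.Perm l' := by
  rw [List.perm_iff_count]
  rintro ⟨b, x⟩
  have key : ∀ l : List (Bool × ℤ), l.count (b, x) = (fil b l).count x := by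
    intro l
    induction l with
    | nil => rfl
    | cons a l ih =>
      obtain ⟨b', y⟩ := a
      by_cases hb : b' = b
      · subst hb; rw [fil_cons_same, List.count_cons, List.count_cons, ih]; simp
      · rw [fil_cons_diff hb, List.count_cons, ih]; simp [hb]
  rw [key, key, h]

def enc1 : Bool × ℤ → ℤ
  | (false, x) => 2 * x - 1
  | (true, x) => 2 * x

def comb1 (A B : Set ℤ) : Set ℤ := {y | (∃ x ∈ A, y = 2 * x - 1) ∨ ∃ x ∈ B, y = 2 * x}

theorem enc1_inj : Function.Injective enc1 := by
  rintro ⟨b, x⟩ ⟨b', x'⟩ h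
  cases b <;> cases b' <;> simp only [enc1] at h <;> first | (exfalso; omega) | skip
  · have : x = x' := by omega
    rw [this]
  · have : x = x' := by omega
    rw [this]

theorem enc1_surj : Function.Surjective enc1 := by
  intro y
  rcases Int.even_or_odd' y with ⟨k, rfl | rfl⟩
  · exact ⟨(true, k), rfl⟩
  · exact ⟨(false, k + 1), by simp only [enc1]; ring⟩

theorem mem_comb1_odd {A B : Set ℤ} {x : ℤ} : 2 * x - 1 ∈ comb1 A B ↔ x ∈ A := by
  constructor
  · rintro (⟨y, hy, h⟩ | ⟨y, hy, h⟩)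
    · have : x = y := by omega
      rwa [this]
    · omega
  · intro h; exact Or.inl ⟨x, h, rfl⟩

theorem mem_comb1_even {A B : Set ℤ} {x : ℤ} : 2 * x ∈ comb1 A B ↔ x ∈ B := by
  constructor
  · rintro (⟨y, hy, h⟩ | ⟨y, hy, h⟩)
    · omega
    · have : x = y := by omega
      rwa [this]
  · intro h; exact Or.inr ⟨x, h, rfl⟩

theorem comb1_ext {S A B : Set ℤ} (h1 : ∀ x, 2 * x - 1 ∈ S ↔ x ∈ A) (h2 : ∀ x, 2 * x ∈ S ↔ x ∈ B) :
    S = comb1 A B := by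
  ext y
  obtain ⟨⟨b, x⟩, rfl⟩ := enc1_surj y
  cases b
  · simp only [enc1]; rw [h1, mem_comb1_odd]
  · simp only [enc1]; rw [h2, mem_comb1_even]

theorem comb1_inj {A B A' B' : Set ℤ} (h : comb1 A B = comb1 A' B') : A = A' ∧ B = B' := by
  constructor
  · ext x; rw [← mem_comb1_odd (B := B), h, mem_comb1_odd]
  · ext x; rw [← mem_comb1_even (A := A), h, mem_comb1_even]

theorem comb1_M0 : M0 = comb1 M0 M0 := by
  apply comb1_ext <;> intro x <;> simp only [M0, Set.mem_ofPred_eq] <;> omega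

theorem dpath_comb1 {A B : Set ℤ} {l : List (Bool × ℤ)} {A' B' : Set ℤ} :
    DPath (comb1 A B) (l.map enc1) (comb1 A' B') ↔
      Path A (fil false l) A' ∧ Path B (fil true l) B' := by
  induction l generalizing A B with
  | nil =>
    simp only [List.map_nil, DPath, fil_nil, Path]
    exact ⟨comb1_inj, fun h => by rw [h.1, h.2]⟩
  | cons a l ih =>
    obtain ⟨b, x⟩ := a
    cases b
    · rw [fil_cons_same, fil_cons_diff (by simp)]
      simp only [List.map_cons, DPath, enc1, Path]
      have e : dstep (comb1 A B) (2 * x - 1) = comb1 (stepTo A x) B := by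
        apply comb1_ext
        · intro y; simp only [mem_dstep, mem_stepTo, mem_comb1_odd]
          have : 2 * y - 1 = 2 * x - 1 + 2 ↔ y = x + 1 := by omega
          have h2 : 2 * y - 1 ≠ 2 * x - 1 ↔ y ≠ x := by omega
          rw [this, h2]
        · intro y; simp only [mem_dstep, mem_comb1_even]
          have : ¬ 2 * y = 2 * x - 1 + 2 := by omega
          have h2 : 2 * y ≠ 2 * x - 1 := by omega
          simp [this, h2]
      rw [e, ih, mem_comb1_odd, show 2 * x - 1 + 2 = 2 * (x + 1) - 1 by ring, mem_comb1_odd]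
      tauto
    · rw [fil_cons_same, fil_cons_diff (by simp)]
      simp only [List.map_cons, DPath, enc1, Path]
      have e : dstep (comb1 A B) (2 * x) = comb1 A (stepTo B x) := by
        apply comb1_ext
        · intro y; simp only [mem_dstep, mem_comb1_odd]
          have : ¬ 2 * y - 1 = 2 * x + 2 := by omega
          have h2 : 2 * y - 1 ≠ 2 * x := by omega
          simp [this, h2]
        · intro y; simp only [mem_dstep, mem_stepTo, mem_comb1_even]
          have : 2 * y = 2 * x + 2 ↔ y = x + 1 := by omega
          have h2 : 2 * y ≠ 2 * x ↔ y ≠ x := by omega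
          rw [this, h2]
      rw [e, ih, mem_comb1_even, show 2 * x + 2 = 2 * (x + 1) by ring, mem_comb1_even]
      tauto

/-- pairs of standard words, shuffled -/
def E (m : ℕ) (A B : Set ℤ) : Set (List (Bool × ℤ)) :=
  {l | l.length = m ∧ Path M0 (fil false l) A ∧ Path M0 (fil true l) B}

theorem E_bound {m : ℕ} {A B : Set ℤ} {l : List (Bool × ℤ)} (h : l ∈ E m A B) :
    ∀ x ∈ l, -(m : ℤ) ≤ x.2 ∧ x.2 ≤ m := by
  obtain ⟨h1, h2, h3⟩ := h
  have hl := fil_length l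
  rintro ⟨b, x⟩ hx
  rw [← mem_fil] at hx
  cases b
  · have := str_bound (m := (fil false l).length) ⟨rfl, A, h2⟩ x hx
    simp only; omega
  · have := str_bound (m := (fil true l).length) ⟨rfl, B, h3⟩ x hx
    simp only; omega

theorem E_finite (m : ℕ) (A B : Set ℤ) : (E m A B).Finite := by
  refine (finite_lists (Set.univ ×ˢ Set.Icc (-(m : ℤ)) m)
    (Set.finite_univ.prod (Set.finite_Icc _ _)) m).subset ?_
  intro l hl
  exact ⟨hl.1, fun c hc => ⟨trivial, E_bound hl c hc⟩⟩

theorem E_enc1 (m : ℕ) (A B : Set ℤ) (α : List ℕ) :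
    {p | (p.length = m ∧ DPath M0 p (comb1 A B)) ∧ BI α p}.ncard =
      {l | l ∈ E m A B ∧ BI α (l.map enc1)}.ncard := by
  refine ncard_eq_of_rel _ _ (fun p l => p = l.map enc1) ?_ ?_ ?_ ?_
  · rintro p ⟨⟨h1, h2⟩, h3⟩
    obtain ⟨l, rfl⟩ : ∃ l, List.map enc1 l = p := by
      have := List.map_surjective_iff.2 enc1_surj
      exact this p
    rw [comb1_M0, dpath_comb1] at h2
    exact ⟨l, ⟨⟨by simpa using h1, h2⟩, h3⟩, rfl⟩
  · rintro l ⟨⟨h1, h2⟩, h3⟩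
    refine ⟨_, ⟨⟨by simpa using h1, ?_⟩, h3⟩, rfl⟩
    rw [comb1_M0, dpath_comb1]; exact h2
  · rintro _ - l - l' - rfl h
    exact List.map_injective_iff.2 enc1_inj h
  · rintro a - a' - b - rfl rfl; rfl

def enc2 (K : ℤ) : Bool × ℤ → ℤ
  | (false, x) => x + K
  | (true, x) => x - K

def comb2 (K : ℤ) (A B : Set ℤ) : Set ℤ := {c | (0 < c ∧ c - K ∈ A) ∨ (c ≤ 0 ∧ c + K ∈ B)}

theorem path_comb2 {K : ℤ} {A B : Set ℤ} {l : List (Bool × ℤ)} {A' B' : Set ℤ}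
    (hb : ∀ x ∈ l, -K < x.2 ∧ x.2 < K)
    (h1 : Path A (fil false l) A') (h2 : Path B (fil true l) B') :
    Path (comb2 K A B) (l.map (enc2 K)) (comb2 K A' B') := by
  induction l generalizing A B with
  | nil =>
    simp only [List.map_nil, fil_nil, Path] at *
    rw [h1, h2]
  | cons a l ih =>
    have hb0 := hb a (by simp)
    obtain ⟨b, x⟩ := a
    have hb1 : ∀ x ∈ l, -K < x.2 ∧ x.2 < K := fun y hy => hb y (by simp [hy])
    simp only at hb0
    cases b
    · rw [fil_cons_same] at h1
      rw [fil_cons_diff (by simp)] at h2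
      obtain ⟨k1, k2, k3⟩ := h1
      simp only [List.map_cons, enc2, Path]
      have e : stepTo (comb2 K A B) (x + K) = comb2 K (stepTo A x) B := by
        ext y; simp only [mem_stepTo, comb2, Set.mem_ofPred_eq]
        have e1 : y - K = x + 1 ↔ y = x + K + 1 := by omega
        have e2 : y - K ≠ x ↔ y ≠ x + K := by omega
        rw [e1, e2]
        by_cases hy : 0 < y
        · simp only [hy, show ¬ y ≤ 0 by omega]; tauto
        · have f1 : ¬ y = x + K + 1 := by omega
          have f2 : y ≠ x + K := by omega
          tauto
      refine ⟨Or.inl ⟨by omega, by simpa using k1⟩, ?_, ?_⟩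
      · rintro (⟨g1, g2⟩ | ⟨g1, g2⟩)
        · exact k2 (by rw [show x + 1 = x + K + 1 - K by ring]; exact g2)
        · omega
      · rw [e]; exact ih hb1 k3 h2
    · rw [fil_cons_same] at h2
      rw [fil_cons_diff (by simp)] at h1
      obtain ⟨k1, k2, k3⟩ := h2
      simp only [List.map_cons, enc2, Path]
      have e : stepTo (comb2 K A B) (x - K) = comb2 K A (stepTo B x) := by
        ext y; simp only [mem_stepTo, comb2, Set.mem_ofPred_eq]
        have e1 : y + K = x + 1 ↔ y = x - K + 1 := by omega
        have e2 : y + K ≠ x ↔ y ≠ x - K := by omega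
        rw [e1, e2]
        by_cases hy : y ≤ 0
        · simp only [hy, show ¬ 0 < y by omega]; tauto
        · have f1 : ¬ y = x - K + 1 := by omega
          have f2 : y ≠ x - K := by omega
          tauto
      refine ⟨Or.inr ⟨by omega, by simpa using k1⟩, ?_, ?_⟩
      · rintro (⟨g1, g2⟩ | ⟨g1, g2⟩)
        · omega
        · exact k2 (by rw [show x + 1 = x - K + 1 + K by ring]; exact g2)
      · rw [e]; exact ih hb1 h1 k3

/-- the same runner words in every block -/
def Blk : List ℕ → List (Bool × ℤ) → List (Bool × ℤ) → Prop
  | [], l, l' => l = [] ∧ l' = []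
  | a :: α, l, l' => ∃ u v u' v', l = u ++ v ∧ l' = u' ++ v' ∧ u.length = a ∧ u'.length = a ∧
      (∀ b, fil b u = fil b u') ∧ Blk α v v'

theorem Blk.symm {α : List ℕ} {l l' : List (Bool × ℤ)} (h : Blk α l l') : Blk α l' l := by
  induction α generalizing l l' with
  | nil => exact ⟨h.2, h.1⟩
  | cons a α ih =>
    obtain ⟨u, v, u', v', h1, h2, h3, h4, h5, h6⟩ := h
    exact ⟨u', v', u, v, h2, h1, h4, h3, fun b => (h5 b).symm, ih h6⟩

theorem Blk.fil {α : List ℕ} {l l' : List (Bool × ℤ)} (h : Blk α l l') (b : Bool) :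
    fil b l = fil b l' := by
  induction α generalizing l l' with
  | nil => rw [h.1, h.2]
  | cons a α ih =>
    obtain ⟨u, v, u', v', rfl, rfl, h3, h4, h5, h6⟩ := h
    rw [fil_append, fil_append, h5, ih h6]

theorem Blk.E {α : List ℕ} {l l' : List (Bool × ℤ)} (h : Blk α l l') {m : ℕ} {A B : Set ℤ}
    (hl : l ∈ E m A B) : l' ∈ E m A B := by
  obtain ⟨h1, h2, h3⟩ := hl
  refine ⟨?_, by rwa [← h.fil], by rwa [← h.fil]⟩
  rw [← fil_length, ← h.fil, ← h.fil, fil_length, h1]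

theorem resort {e e' : Bool × ℤ → ℤ} {u : List (Bool × ℤ)}
    (he : ∀ b x y, (x < y ↔ e (b, x) < e (b, y))) (he' : ∀ b x y, (x < y ↔ e' (b, x) < e' (b, y)))
    (hinj : Set.InjOn e' {x | x ∈ u}) (h : (u.map e).Pairwise (· < ·)) :
    ∃ u', u'.length = u.length ∧ (∀ b, fil b u = fil b u') ∧ (u'.map e').Pairwise (· < ·) := by
  have hfil : ∀ (e : Bool × ℤ → ℤ) (_ : ∀ b x y, (x < y ↔ e (b, x) < e (b, y)))
      (u : List (Bool × ℤ)), (u.map e).Pairwise (· < ·) → ∀ b, (fil b u).Pairwise (· < ·) := by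
    intro e he u h b
    rw [List.pairwise_map] at h
    unfold fil
    rw [List.pairwise_map]
    refine (h.filter _).imp_of_mem ?_
    rintro ⟨b1, x⟩ ⟨b2, y⟩ hx hy hlt
    have e1 : b1 = b := by simpa using (List.mem_filter.1 hx).2
    have e2 : b2 = b := by simpa using (List.mem_filter.1 hy).2
    subst e1; subst e2
    exact (he _ _ _).2 hlt
  set u' := u.mergeSort (fun x y => decide (e' x ≤ e' y)) with hu'
  have hperm : u'.Perm u := List.mergeSort_perm _ _
  have hsort : u'.Pairwise (fun x y => e' x ≤ e' y) := by
    have := List.pairwise_mergeSort (le := fun x y => decide (e' x ≤ e' y))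
      (by intro a b c; simp; omega) (by intro a b; simp; omega) u
    simpa using this
  have hnd : u.Nodup := by
    rw [List.pairwise_map] at h
    exact h.imp (fun {a b} hab hc => by subst hc; exact lt_irrefl _ hab)
  have hnd' : u'.Nodup := hperm.nodup_iff.2 hnd
  have hstrict : (u'.map e').Pairwise (· < ·) := by
    rw [List.pairwise_map]
    refine (hsort.and hnd').imp_of_mem ?_
    rintro a b ha hb ⟨h1, h2⟩
    refine lt_of_le_of_ne h1 fun hc => h2 (hinj ?_ ?_ hc)
    · exact hperm.mem_iff.1 ha
    · exact hperm.mem_iff.1 hb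
  refine ⟨u', hperm.length_eq, fun b => ?_, hstrict⟩
  exact (fil_perm hperm).symm.eq_of_pairwise (le := (· < ·))
    (fun a b _ _ h1 h2 => absurd h1 (not_lt.2 h2.le))
    (hfil e he u h b) (hfil e' he' u' hstrict b)

theorem Blk.exists_resort {e e' : Bool × ℤ → ℤ} {α : List ℕ} {l : List (Bool × ℤ)}
    (he : ∀ b x y, (x < y ↔ e (b, x) < e (b, y))) (he' : ∀ b x y, (x < y ↔ e' (b, x) < e' (b, y)))
    (hinj : Set.InjOn e' {x | x ∈ l}) (h : BI α (l.map e)) :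
    ∃ l', Blk α l l' ∧ BI α (l'.map e') := by
  induction α generalizing l with
  | nil =>
    simp only [BI, List.map_eq_nil_iff] at h
    exact ⟨[], ⟨h, rfl⟩, rfl⟩
  | cons a α ih =>
    obtain ⟨u0, v0, h1, h2, h3, h4⟩ := h
    obtain ⟨u, v, rfl, rfl, rfl⟩ := List.map_eq_append_iff.1 h1
    obtain ⟨v', k1, k2⟩ := ih (hinj.mono (fun x hx => by
      have : x ∈ v := hx
      exact List.mem_append_right _ this)) h4
    obtain ⟨u', j1, j2, j3⟩ := resort he he' (u := u) (hinj.mono (fun x hx => by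
      have : x ∈ u := hx
      exact List.mem_append_left _ this)) h3
    rw [List.length_map] at h2
    exact ⟨u' ++ v', ⟨u, v, u', v', rfl, rfl, h2, by omega, j2, k1⟩,
      u'.map e', v'.map e', by simp, by simp; omega, j3, k2⟩

theorem Blk.unique {e : Bool × ℤ → ℤ} {α : List ℕ} {l l1 l2 : List (Bool × ℤ)}
    (hinj : Set.InjOn e {x | x ∈ l1 ∨ x ∈ l2})
    (b1 : Blk α l l1) (b2 : Blk α l l2) (h1 : BI α (l1.map e)) (h2 : BI α (l2.map e)) : l1 = l2 := by
  induction α generalizing l l1 l2 with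
  | nil => rw [b1.2, b2.2]
  | cons a α ih =>
    obtain ⟨u, v, u', v', rfl, rfl, h3, h4, h5, h6⟩ := b1
    obtain ⟨x, y, x', y', e1, rfl, k3, k4, k5, k6⟩ := b2
    obtain ⟨rfl, rfl⟩ := List.append_inj e1 (by omega)
    obtain ⟨s, t, f1, f2, f3, f4⟩ := h1
    obtain ⟨s2, t2, g1, g2, g3, g4⟩ := h2
    rw [List.map_append] at f1 g1
    obtain ⟨rfl, rfl⟩ := List.append_inj f1 (by rw [List.length_map]; omega)
    obtain ⟨rfl, rfl⟩ := List.append_inj g1 (by rw [List.length_map]; omega)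
    have ev : v' = y' := by
      refine ih (hinj.mono ?_) h6 k6 f4 g4
      rintro z (hz | hz)
      · left; exact List.mem_append_right _ hz
      · right; exact List.mem_append_right _ hz
    have eu : u' = x' := by
      have hp : u'.Perm x' := perm_of_fil (fun b => by rw [← h5, k5])
      have hm : u'.map e = x'.map e := by
        refine (hp.map e).eq_of_pairwise (le := (· < ·))
          (fun a b _ _ h1 h2 => absurd h1 (not_lt.2 h2.le)) f3 g3
      have : ∀ (p q : List (Bool × ℤ)), Set.InjOn e {x | x ∈ p ∨ x ∈ q} → p.map e = q.map e →
          p = q := by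
        intro p
        induction p with
        | nil => intro q _ h; simp at h; exact h.symm
        | cons a p ihp =>
          intro q hi h
          match q with
          | [] => simp at h
          | b :: q =>
            simp only [List.map_cons, List.cons.injEq] at h
            have hab : a = b := hi (by left; simp) (by right; simp) h.1
            rw [hab, ihp q (hi.mono ?_) h.2]
            rintro z (hz | hz)
            · left; exact List.mem_cons_of_mem _ hz
            · right; exact List.mem_cons_of_mem _ hz
      refine this _ _ (hinj.mono ?_) hm
      rintro z (hz | hz)
      · left; exact List.mem_append_left _ hz
      · right; exact List.mem_append_left _ hz
    rw [ev, eu]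

theorem enc1_mono (b : Bool) (x y : ℤ) : x < y ↔ enc1 (b, x) < enc1 (b, y) := by
  cases b <;> simp only [enc1] <;> omega
theorem enc2_mono (K : ℤ) (b : Bool) (x y : ℤ) : x < y ↔ enc2 K (b, x) < enc2 K (b, y) := by
  cases b <;> simp only [enc2] <;> omega
theorem enc2_inj {m : ℕ} {K : ℤ} (hK : (m : ℤ) < K) :
    Set.InjOn (enc2 K) {x | -(m : ℤ) ≤ x.2 ∧ x.2 ≤ m} := by
  rintro ⟨b, x⟩ hx ⟨b', y⟩ hy h
  simp only [Set.mem_ofPred_eq] at hx hy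
  cases b <;> cases b' <;> simp only [enc2] at h <;> first | (exfalso; omega) | skip
  · have : x = y := by omega
    rw [this]
  · have : x = y := by omega
    rw [this]

theorem E_resort {m : ℕ} {K : ℤ} (hK : (m : ℤ) < K) (A B : Set ℤ) (α : List ℕ) :
    {l | l ∈ E m A B ∧ BI α (l.map enc1)}.ncard =
      {l | l ∈ E m A B ∧ BI α (l.map (enc2 K))}.ncard := by
  refine ncard_eq_of_rel _ _ (Blk α) ?_ ?_ ?_ ?_
  · rintro l ⟨h1, h2⟩
    obtain ⟨l', h3, h4⟩ := Blk.exists_resort enc1_mono (enc2_mono K)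
      ((enc2_inj hK).mono (fun x hx => E_bound h1 x hx)) h2
    exact ⟨l', ⟨h3.E h1, h4⟩, h3⟩
  · rintro l ⟨h1, h2⟩
    obtain ⟨l', h3, h4⟩ := Blk.exists_resort (enc2_mono K) enc1_mono enc1_inj.injOn h2
    exact ⟨l', ⟨h3.E h1, h4⟩, h3.symm⟩
  · rintro l - l1 ⟨a1, a2⟩ l2 ⟨b1, b2⟩ r1 r2
    refine Blk.unique ((enc2_inj hK).mono ?_) r1 r2 a2 b2
    rintro x (hx | hx)
    · exact E_bound a1 x hx
    · exact E_bound b1 x hx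
  · rintro l1 ⟨a1, a2⟩ l2 ⟨b1, b2⟩ l - r1 r2
    exact Blk.unique enc1_inj.injOn r1.symm r2.symm a2 b2

theorem E_dk {m : ℕ} {K : ℤ} {A B : Set ℤ} {l : List (Bool × ℤ)}
    (h : l ∈ E m A B) (k : ℕ) : ∃ l' ∈ E m A B, l'.map (enc2 K) = dk k (l.map (enc2 K)) := by
  rcases dk_cases k (l.map (enc2 K)) with h0 | ⟨s, a, b, t, h1, h2, h3⟩
  · exact ⟨l, h, h0.symm⟩
  · rw [h2]
    obtain ⟨s', r, rfl, rfl, hr⟩ := List.map_eq_append_iff.1 h1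
    obtain ⟨a', r', rfl, rfl, hr'⟩ := List.map_eq_cons_iff.1 hr
    obtain ⟨b', t', rfl, rfl, rfl⟩ := List.map_eq_cons_iff.1 hr'
    refine ⟨s' ++ b' :: a' :: t', ?_, by simp⟩
    obtain ⟨k1, k2, k3⟩ := h
    obtain ⟨ba, x⟩ := a'
    obtain ⟨bb, y⟩ := b'
    have swapf : ∀ (b : Bool) (Z : Set ℤ), Path M0 (fil b (s' ++ (ba, x) :: (bb, y) :: t')) Z →
        Path M0 (fil b (s' ++ (bb, y) :: (ba, x) :: t')) Z := by
      intro b Z hZ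
      rw [fil_append] at hZ ⊢
      obtain ⟨Y, y1, y2⟩ := path_append.1 hZ
      refine path_append.2 ⟨Y, y1, ?_⟩
      by_cases e1 : ba = b
      · by_cases e2 : bb = b
        · subst e1; subst e2
          rw [fil_cons_same, fil_cons_same] at y2 ⊢
          have : x + 2 ≤ y ∨ y + 2 ≤ x := by
            cases bb <;> simp only [enc2] at h3 <;> omega
          exact path_swap (by omega) (by omega) (by omega) y2
        · subst e1
          rw [fil_cons_same, fil_cons_diff e2] at y2
          rwa [fil_cons_diff e2, fil_cons_same]
      · by_cases e2 : bb = b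
        · subst e2
          rw [fil_cons_diff e1, fil_cons_same] at y2
          rwa [fil_cons_same, fil_cons_diff e1]
        · rw [fil_cons_diff e1, fil_cons_diff e2] at y2
          rwa [fil_cons_diff e2, fil_cons_diff e1]
    exact ⟨by simpa using k1, swapf _ _ k2, swapf _ _ k3⟩

end LRT

namespace LRT

def kap (K : ℕ) : ℕ → ℕ := fun i => if i < K then K else 0

theorem isPartition_kap (K : ℕ) : IsPartition (kap K) := by
  refine ⟨fun i j h => ?_, K, fun n hn => ?_⟩
  · simp only [kap]; split_ifs <;> omega
  · simp only [kap]; split_ifs <;> omega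

theorem bd_kap (K : ℕ) : bd (kap K) = comb2 K M0 M0 := by
  ext c
  simp only [bd, comb2, M0, kap, Set.mem_ofPred_eq]
  constructor
  · rintro ⟨i, hi⟩
    split_ifs at hi <;> omega
  · rintro (⟨h1, h2⟩ | ⟨h1, h2⟩)
    · refine ⟨(K - c).toNat, ?_⟩
      split_ifs <;> omega
    · refine ⟨(-c).toNat, ?_⟩
      split_ifs <;> omega

def Uk (K : ℕ) : List ℤ := U 0 ((List.range K).map (kap K))

theorem path_Uk (K : ℕ) : Path M0 (Uk K) (comb2 K M0 M0) := by
  rw [← bd_kap]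
  exact path_U' (isPartition_kap K) (fun k hk => by simp only [kap]; split_ifs <;> omega)

def psi (K : ℕ) (l : List (Bool × ℤ)) : List ℤ := (sw (Uk K) (l.map (enc2 K))).1

theorem E_path {m K : ℕ} {A B : Set ℤ} (hK : m < K) {l : List (Bool × ℤ)} (h : l ∈ E m A B) :
    Path M0 (Uk K ++ l.map (enc2 K)) (comb2 K A B) := by
  refine path_append.2 ⟨_, path_Uk K, path_comb2 (fun x hx => ?_) h.2.1 h.2.2⟩
  have := E_bound h x hx
  omega

theorem psi_str {m K : ℕ} {A B : Set ℤ} (hK : m < K) {l : List (Bool × ℤ)} (h : l ∈ E m A B) :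
    psi K l ∈ Str m := by
  refine ⟨?_, ?_⟩
  · rw [psi, (sw_length _ _).1, List.length_map, h.1]
  · have := E_path hK h
    have h2 := path_sw (t := []) (by simpa using this)
    exact path_append_left h2

theorem enc2_map_inj {m K : ℕ} {A B : Set ℤ} (hK : m < K) {l l' : List (Bool × ℤ)}
    (h : l ∈ E m A B) (h' : l' ∈ E m A B) (he : l.map (enc2 K) = l'.map (enc2 K)) : l = l' := by
  have hi := enc2_inj (m := m) (K := K) (by omega)
  have hb := E_bound h
  have hb' := E_bound h'
  clear h h'
  induction l generalizing l' with
  | nil => simpa using he.symm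
  | cons a l ih =>
    cases l' with
    | nil => simp at he
    | cons b l' =>
      simp only [List.map_cons, List.cons.injEq] at he
      rw [hi (hb a (by simp)) (hb' b (by simp)) he.1,
        ih he.2 (fun x hx => hb x (by simp [hx])) (fun x hx => hb' x (by simp [hx]))]

theorem psi_BI {m K : ℕ} {A B : Set ℤ} (hK : m < K) {l : List (Bool × ℤ)} (h : l ∈ E m A B)
    (α : List ℕ) : BI α (l.map (enc2 K)) ↔ BI α (psi K l) := by
  have ha := fun k => asc_sw (E_path hK h) k
  constructor
  · exact BI_congr (sw_length _ _).1.symm (fun k => (ha k).symm)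
  · exact BI_congr (sw_length _ _).1 (fun k => ha k)

theorem psi_inv {m K : ℕ} {A B : Set ℤ} (hK : m < K) (k : ℕ) (P : List ℤ) :
    {l | l ∈ E m A B ∧ psi K l = dk k P}.ncard = {l | l ∈ E m A B ∧ psi K l = P}.ncard := by
  have key : ∀ l ∈ E m A B, ∀ l' ∈ E m A B, l'.map (enc2 K) = dk k (l.map (enc2 K)) →
      psi K l' = dk k (psi K l) := by
    intro l hl l' hl' h
    rw [psi, h, sw_dk_right (E_path hK hl)]; rfl
  apply ncard_eq_of_rel _ _ (fun l l' => l'.map (enc2 K) = dk k (l.map (enc2 K)))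
  · rintro l ⟨h1, h2⟩
    obtain ⟨l', h3, h4⟩ := E_dk (K := K) h1 k
    exact ⟨l', ⟨h3, by rw [key l h1 l' h3 h4, h2, dk_dk]⟩, h4⟩
  · rintro l ⟨h1, h2⟩
    obtain ⟨l', h3, h4⟩ := E_dk (K := K) h1 k
    exact ⟨l', ⟨h3, by rw [key l h1 l' h3 h4, h2]⟩, by rw [h4, dk_dk]⟩
  · rintro a - b ⟨hb, -⟩ b' ⟨hb', -⟩ h1 h2
    exact enc2_map_inj hK hb hb' (h1.trans h2.symm)
  · rintro a ⟨ha, -⟩ a' ⟨ha', -⟩ b - h1 h2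
    refine enc2_map_inj hK ha ha' ?_
    rw [← dk_dk k (a.map _), ← h1, h2, dk_dk]

theorem main_count {m K : ℕ} (A B : Set ℤ) (hK : m < K) : ∀ P ∈ Str m,
    {x | x ∈ G m (comb1 A B) ∧ x.1 = P}.ncard = {l | l ∈ E m A B ∧ psi K l = P}.ncard := by
  refine uniq' (G m (comb1 A B)) (E m A B) (G_finite _ _) (E_finite _ _ _) m Prod.fst (psi K)
    (fun x hx => G_str hx) (fun y hy => psi_str hK hy) (fun k P _ => G_inv m _ k P)
    (fun k P _ => psi_inv hK k P) (fun α => ?_)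
  rw [G_BI, E_enc1, E_resort (K := K) (by omega)]
  congr 1
  ext l
  simp only [Set.mem_ofPred_eq]
  exact and_congr_right fun h => psi_BI hK h α

end LRT

namespace LRT

def Lat (A B : List ℤ) : Prop := ∀ t : ℤ, B.countP (fun x => t ≤ x) ≤ A.countP (fun x => t < x)

def SS (A B : List ℤ) (t : ℤ) : ℤ :=
  (A.countP (fun x => t < x) : ℤ) - (B.countP (fun x => t ≤ x) : ℤ)

theorem lat_iff (A B : List ℤ) : Lat A B ↔ ∀ t, 0 ≤ SS A B t := by
  simp only [Lat, SS]
  exact forall_congr' fun t => by omega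

theorem cnt_ge_succ {A : List ℤ} (h : A.Pairwise (· < ·)) (t : ℤ) :
    (A.countP (fun x => t ≤ x) : ℤ) = A.countP (fun x => t + 1 ≤ x) + if t ∈ A then 1 else 0 := by
  induction A with
  | nil => simp
  | cons a A ih =>
    rw [List.pairwise_cons] at h
    have ih := ih h.2
    simp only [List.countP_cons, List.mem_cons, decide_eq_true_eq]
    push_cast
    rw [ih]
    by_cases h1 : t = a
    · have : t ∉ A := fun hA => by have := h.1 t hA; omega
      simp [h1, this]
      subst h1; simp [this]
    · by_cases h2 : t ≤ a
      · simp [h1, h2, show t + 1 ≤ a by omega]; ring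
      · simp [h1, h2, show ¬ t + 1 ≤ a by omega]

theorem cnt_lt_eq (A : List ℤ) (t : ℤ) :
    A.countP (fun x => t < x) = A.countP (fun x => t + 1 ≤ x) := by
  congr 1

theorem SS_succ {A B : List ℤ} (hA : A.Pairwise (· < ·)) (hB : B.Pairwise (· < ·)) (t : ℤ) :
    SS A B (t + 1) = SS A B t - (if t + 1 ∈ A then 1 else 0) + if t ∈ B then 1 else 0 := by
  have h1 := cnt_ge_succ hA (t + 1)
  have h2 := cnt_ge_succ hB t
  simp only [SS, cnt_lt_eq]
  omega

theorem slideR_perm (d : ℤ) (A : List ℤ) :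
    (d :: A).Perm ((slideR d A).2 :: (slideR d A).1) := by
  induction A generalizing d with
  | nil => simp [slideR]
  | cons a A ih =>
    simp only [slideR]
    have h := ih (swp d a).2
    have h1 : (d :: a :: A).Perm ((swp d a).1 :: (swp d a).2 :: A) := by
      rcases swp_cases d a with ⟨-, h⟩ | ⟨-, h⟩ <;> rw [h]
      exact List.Perm.swap _ _ _
    exact h1.trans ((h.cons _).trans (List.Perm.swap _ _ _))

theorem slide_facts {M N : Set ℤ} {d : ℤ} {A : List ℤ} (h : Path M (d :: A) N)
    (hA : A.Pairwise (· < ·)) :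
    ((slideR d A).2 = d - 1 ∧ d - 1 ∈ A) ∨
    (d ≤ (slideR d A).2 ∧ d ∉ A ∧ d - 1 ∉ A ∧ (slideR d A).2 + 1 ∉ A ∧
      ∀ x, d < x → x ≤ (slideR d A).2 → x ∈ A) := by
  induction A generalizing d M with
  | nil => right; simp [slideR]
  | cons a A ih =>
    rw [List.pairwise_cons] at hA
    have hne := path_ne h
    have h1 := path_swp h
    have h2 : Path (stepTo M (swp d a).1) ((swp d a).2 :: A) N := h1.2.2
    have ih := ih h2 hA.2
    have hs : (slideR d (a :: A)).2 = (slideR (swp d a).2 A).2 := by simp [slideR]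
    rw [hs]
    generalize (slideR (swp d a).2 A).2 = e at ih
    have hno : ∀ x, x ≤ a → x ∉ A := fun x hx hm => by have := hA.1 x hm; omega
    have hd : a < d → d ∉ A := by
      intro hlt hm
      obtain ⟨s, t, rfl⟩ := List.append_of_mem hm
      have h3 := path_between (m := a :: s) (t := t) (x := d) (by simpa using h)
      have h4 := h3.2
      have h5 := (List.pairwise_append.1 hA.2).2.2
      simp only [List.mem_cons] at h4
      rcases h4 with h4 | h4
      · omega
      · have := h5 _ h4 d (by simp); omega
    rcases swp_cases d a with ⟨h3, h4⟩ | ⟨h3, h4⟩ <;> rw [h4] at ih <;> simp only at ih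
    · rcases h3 with h3 | h3
      · left
        have : e = a := by
          rcases ih with ih | ih
          · exact absurd ih.2 (hno _ (by omega))
          · by_contra hc
            exact hd (by omega) (ih.2.2.2.2 d (by omega) (by omega))
        subst this
        simp [h3]
      · right
        rcases ih with ih | ih
        · exact absurd ih.2 (hno _ (by omega))
        · obtain ⟨i1, i2, i3, i4, i5⟩ := ih
          simp only [List.mem_cons, not_or]
          refine ⟨by omega, ⟨by omega, hno _ (by omega)⟩, ⟨by omega, hno _ (by omega)⟩,
            ⟨by omega, i4⟩, fun x hx hx' => ?_⟩
          by_cases hxa : x = a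
          · exact Or.inl hxa
          · exact Or.inr (i5 x (by omega) hx')
    · rcases ih with ih | ih
      · left; simp [ih]
      · right
        obtain ⟨i1, i2, i3, i4, i5⟩ := ih
        simp only [List.mem_cons, not_or]
        refine ⟨by omega, ⟨by omega, i2⟩, ⟨by omega, i3⟩,
            ⟨?_, i4⟩, fun x hx hx' => Or.inr (i5 x hx hx')⟩
        intro hea
        by_cases hde : d < e
        · exact hno e (by omega) (i5 e hde le_rfl)
        · omega

theorem lat_fwd {A B : List ℤ} {d e f : ℤ} (hA : A.Pairwise (· < ·)) (hB : B.Pairwise (· < ·))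
    (F1 : (e = d - 1 ∧ d - 1 ∈ A) ∨ (d ≤ e ∧ d ∉ A ∧ d - 1 ∉ A ∧ ∀ x, d < x → x ≤ e → x ∈ A))
    (F2 : (f = e - 1 ∧ e - 1 ∈ B) ∨ e ≤ f)
    (V : ∀ x, x ∈ A → x ∈ B → x - 1 ∈ B)
    (V' : d ∈ B → d - 1 ∈ A ∨ d - 1 ∈ B)
    (hS : ∀ t, 0 ≤ SS A B t) (t : ℤ) :
    0 ≤ SS A B t + (if t < d then 1 else 0) - (if t < e then 1 else 0) - (if t ≤ e then 1 else 0)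
      + (if t ≤ f then 1 else 0) := by
  rcases F1 with ⟨h1, -⟩ | ⟨h1, h2, h3, h4⟩
  · have := hS t
    split_ifs <;> omega
  · have key : ∀ n : ℕ, ∀ t, t = d + n → t < e → SS A B t ≠ 0 := by
      intro n
      induction n with
      | zero =>
        intro t ht hte h0
        have h5 := SS_succ hA hB t
        rw [if_pos (h4 _ (by omega) (by omega))] at h5
        have h6 := hS (t + 1)
        have h7 : t ∈ B := by by_contra hc; rw [if_neg hc] at h5; omega
        have ht : t = d := by omega
        subst ht
        have h8 := (V' h7).resolve_left h3
        have h9 := SS_succ hA hB (t - 1)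
        rw [sub_add_cancel, if_neg h2, if_pos h8] at h9
        have := hS (t - 1)
        omega
      | succ n ih =>
        intro t ht hte h0
        have h5 := SS_succ hA hB t
        rw [if_pos (h4 _ (by omega) (by omega))] at h5
        have h6 := hS (t + 1)
        have h7 : t ∈ B := by by_contra hc; rw [if_neg hc] at h5; omega
        have h10 := h4 t (by omega) (by omega)
        have h8 := V t h10 h7
        have h9 := SS_succ hA hB (t - 1)
        rw [sub_add_cancel, if_pos h10, if_pos h8] at h9
        exact ih (t - 1) (by push_cast at ht; omega) (by omega) (by omega)
    have key' : ∀ t, d ≤ t → t < e → SS A B t ≠ 0 := fun t ht => key (t - d).toNat t (by omega)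
    have hSt := hS t
    by_cases hb : d ≤ t ∧ t < e
    · have := key' t hb.1 hb.2
      split_ifs <;> omega
    · by_cases hc : t = e ∧ f = e - 1
      · obtain ⟨hc1, hc2⟩ := hc
        have hf : e - 1 ∈ B := by
          rcases F2 with F2 | F2
          · exact F2.2
          · omega
        have : SS A B t ≠ 0 := by
          intro h0
          subst hc1
          have h9 := SS_succ hA hB (t - 1)
          rw [sub_add_cancel, if_pos hf] at h9
          have := hS (t - 1)
          by_cases hdt : d = t
          · subst hdt
            rw [if_neg h2] at h9
            omega
          · rw [if_pos (h4 t (by omega) (by omega))] at h9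
            exact key' (t - 1) (by omega) (by omega) (by omega)
        split_ifs <;> omega
      · split_ifs <;> omega

theorem lat_bwd {A B : List ℤ} {d e f : ℤ} (hA : A.Pairwise (· < ·)) (hB : B.Pairwise (· < ·))
    (F1 : (d = e + 1 ∧ e + 1 ∈ A) ∨ d ≤ e)
    (F2 : f = e - 1 ∨ (e ≤ f ∧ f ∉ B ∧ f + 1 ∉ B ∧ ∀ x, e ≤ x → x < f → x ∈ B))
    (V : ∀ x, x ∈ A → x ∈ B → x + 1 ∈ A)
    (V' : f ∈ A → f + 1 ∈ A ∨ f + 1 ∈ B)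
    (hS : ∀ t, 0 ≤ SS A B t) (t : ℤ) :
    0 ≤ SS A B t - (if t < d then 1 else 0) + (if t < e then 1 else 0) + (if t ≤ e then 1 else 0)
      - (if t ≤ f then 1 else 0) := by
  rcases F2 with h1 | ⟨h1, h2, h3, h4⟩
  · have := hS t
    split_ifs <;> omega
  · have key : ∀ n : ℕ, ∀ t, t = f - n → e < t → SS A B t ≠ 0 := by
      intro n
      induction n with
      | zero =>
        intro t ht hte h0
        have h5 := SS_succ hA hB (t - 1)
        rw [sub_add_cancel, if_pos (h4 _ (by omega) (by omega))] at h5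
        have h6 := hS (t - 1)
        have h7 : t ∈ A := by by_contra hc; rw [if_neg hc] at h5; omega
        have ht : t = f := by omega
        subst ht
        have h8 := (V' h7).resolve_right h3
        have h9 := SS_succ hA hB t
        rw [if_neg h2, if_pos h8] at h9
        have := hS (t + 1)
        omega
      | succ n ih =>
        intro t ht hte h0
        have h5 := SS_succ hA hB (t - 1)
        rw [sub_add_cancel, if_pos (h4 _ (by omega) (by omega))] at h5
        have h6 := hS (t - 1)
        have h7 : t ∈ A := by by_contra hc; rw [if_neg hc] at h5; omega
        have h10 := h4 t (by omega) (by omega)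
        have h8 := V t h7 h10
        have h9 := SS_succ hA hB t
        rw [if_pos h10, if_pos h8] at h9
        exact ih (t + 1) (by push_cast at ht; omega) (by omega) (by omega)
    have key' : ∀ t, e < t → t ≤ f → SS A B t ≠ 0 :=
      fun t ht ht' => key (f - t).toNat t (by omega) ht
    have hSt := hS t
    by_cases hb : e < t ∧ t ≤ f
    · have := key' t hb.1 hb.2
      split_ifs <;> omega
    · by_cases hc : t = e ∧ d = e + 1
      · obtain ⟨hc1, hc2⟩ := hc
        have hf : e + 1 ∈ A := by
          rcases F1 with F1 | F1
          · exact F1.2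
          · omega
        have : SS A B t ≠ 0 := by
          intro h0
          subst hc1
          have h9 := SS_succ hA hB t
          rw [if_pos hf] at h9
          have := hS (t + 1)
          by_cases hdt : t = f
          · subst hdt
            rw [if_neg h2] at h9
            omega
          · rw [if_pos (h4 t (by omega) (by omega))] at h9
            exact key' (t + 1) (by omega) (by omega) (by omega)
        split_ifs <;> omega
      · split_ifs <;> omega

theorem slide_facts' {M N : Set ℤ} {d : ℤ} {A : List ℤ} (h : Path M (d :: A) N)
    (hA : A.Pairwise (· < ·)) :
    (d = (slideR d A).2 + 1 ∧ (slideR d A).2 + 1 ∈ (slideR d A).1) ∨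
    (d ≤ (slideR d A).2 ∧ (slideR d A).2 ∉ (slideR d A).1 ∧
      (slideR d A).2 + 1 ∉ (slideR d A).1 ∧
      ∀ x, d ≤ x → x < (slideR d A).2 → x ∈ (slideR d A).1) := by
  have hp := slideR_perm d A
  have hf := slide_facts h hA
  generalize (slideR d A).2 = e at *
  generalize (slideR d A).1 = A' at *
  have hm : ∀ x, x ∈ d :: A ↔ x ∈ e :: A' := fun x => hp.mem_iff
  simp only [List.mem_cons] at hm
  rcases hf with ⟨h1, h2⟩ | ⟨h1, h2, h3, h4, h5⟩
  · left
    refine ⟨by omega, ?_⟩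
    have := (hm d).1 (Or.inl rfl)
    rcases this with h | h
    · omega
    · rwa [show e + 1 = d by omega]
  · right
    have hn : (d :: A).Nodup := List.nodup_cons.2 ⟨h2, hA.imp (fun h => ne_of_lt h)⟩
    refine ⟨h1, (List.nodup_cons.1 (hp.nodup_iff.1 hn)).1, fun h => ?_, fun x hx hx' => ?_⟩
    · rcases (hm (e + 1)).2 (Or.inr h) with h | h
      · omega
      · exact h4 h
    · have : x = d ∨ x ∈ A := by
        by_cases hxd : x = d
        · exact Or.inl hxd
        · exact Or.inr (h5 x (by omega) (by omega))
      rcases (hm x).1 this with h | h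
      · omega
      · exact h

theorem path_betw {M N : Set ℤ} {A B : List ℤ} {x : ℤ} (h : Path M (A ++ B) N)
    (hA : A.Pairwise (· < ·)) (hB : B.Pairwise (· < ·)) (h1 : x ∈ A) (h2 : x ∈ B) :
    x - 1 ∈ B ∧ x + 1 ∈ A := by
  obtain ⟨s, t, rfl⟩ := List.append_of_mem h1
  obtain ⟨s', t', rfl⟩ := List.append_of_mem h2
  obtain ⟨K, -, h3⟩ := (path_append (M := M) (N := N) (u := s) (v := x :: ((t ++ s') ++ x :: t'))).1
    (by simpa using h)
  obtain ⟨h4, h5⟩ := path_between h3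
  have hA' := (List.pairwise_cons.1 (List.pairwise_append.1 hA).2.1).1
  have hB' := (List.pairwise_append.1 hB).2.2
  rw [List.mem_append] at h4 h5
  constructor
  · rcases h4 with h | h
    · have := hA' _ h; omega
    · simp [h]
  · rcases h5 with h | h
    · simp [h]
    · have := hB' _ h x (by simp); omega

theorem slideR_pairwise {M N : Set ℤ} {d : ℤ} {A : List ℤ} (h : Path M (d :: A) N) :
    A.Pairwise (· < ·) ↔ (slideR d A).1.Pairwise (· < ·) := by
  rw [pairwise_iff_asc, pairwise_iff_asc, slideR_length]
  exact forall_congr' fun k => imp_congr_right fun _ => (asc_slideR h k).symm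

theorem cnt_slideR (d : ℤ) (A : List ℤ) (p : ℤ → Bool) :
    (A.countP p : ℤ) + (if p d then 1 else 0) =
      ((slideR d A).1.countP p : ℤ) + (if p (slideR d A).2 then 1 else 0) := by
  have h := (slideR_perm d A).countP_eq p
  simp only [List.countP_cons] at h
  exact_mod_cast h

theorem SS_slide (d : ℤ) (A B : List ℤ) (t : ℤ) :
    SS (slideR d A).1 (slideR (slideR d A).2 B).1 t = SS A B t + (if t < d then 1 else 0)
      - (if t < (slideR d A).2 then 1 else 0) - (if t ≤ (slideR d A).2 then 1 else 0)
      + (if t ≤ (slideR (slideR d A).2 B).2 then 1 else 0) := by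
  have h1 := cnt_slideR d A (fun x => t < x)
  have h2 := cnt_slideR (slideR d A).2 B (fun x => t ≤ x)
  simp only [decide_eq_true_eq] at h1 h2
  simp only [SS]
  omega

theorem path_head {M N : Set ℤ} {u v w : List ℤ} (h : Path M (u ++ (v ++ w)) N) :
    ∃ N', Path M (u ++ v) N' := by
  rw [← List.append_assoc] at h
  exact path_append_left h

theorem lat_slide {M N : Set ℤ} {d : ℤ} {A B : List ℤ} (h : Path M (d :: (A ++ B)) N)
    (hA : A.Pairwise (· < ·)) (hB : B.Pairwise (· < ·)) :
    Lat A B ↔ Lat (slideR d A).1 (slideR (slideR d A).2 B).1 := by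
  obtain ⟨N1, hdA⟩ := path_append_left (u := d :: A) (v := B) (by simpa using h)
  have hAB := h.2.2
  have h1 := path_slideR h
  obtain ⟨K, hK1, hK2⟩ := path_append.1 h1
  have h2 := path_slideR (w := B) (t := []) (by simpa using hK2)
  have h3 := path_append.2 ⟨K, hK1, h2⟩
  have hA' := (slideR_pairwise hdA).1 hA
  have hB' := (slideR_pairwise hK2).1 hB
  have f1 := slide_facts hdA hA
  have f1' := slide_facts' hdA hA
  have f2 := slide_facts hK2 hB
  have f2' := slide_facts' hK2 hB
  have hSS := SS_slide d A B
  rw [lat_iff, lat_iff]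
  generalize (slideR d A).1 = A' at *
  generalize (slideR d A).2 = e at *
  generalize (slideR e B).1 = B' at *
  generalize (slideR e B).2 = f at *
  constructor
  · intro hS t
    rw [hSS]
    refine lat_fwd hA hB ?_ ?_ ?_ ?_ hS t
    · rcases f1 with f | f
      · exact Or.inl f
      · exact Or.inr ⟨f.1, f.2.1, f.2.2.1, f.2.2.2.2⟩
    · rcases f2 with f | f
      · exact Or.inl f
      · exact Or.inr f.1
    · exact fun x hx hx' => (path_betw hAB hA hB hx hx').1
    · intro hd
      obtain ⟨s, t, rfl⟩ := List.append_of_mem hd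
      have := (path_between (m := A ++ s) (t := t) (x := d) (by simpa using h)).1
      rw [List.mem_append] at this
      simp only [List.mem_append]
      tauto
  · intro hS t
    have hb : SS A B t = SS A' B' t - (if t < d then 1 else 0) + (if t < e then 1 else 0)
      + (if t ≤ e then 1 else 0) - (if t ≤ f then 1 else 0) := by rw [hSS]; ring
    rw [hb]
    obtain ⟨N2, hAB'⟩ := path_head h3
    refine lat_bwd hA' hB' ?_ ?_ ?_ ?_ hS t
    · rcases f1' with f | f
      · exact Or.inl f
      · exact Or.inr f.1
    · rcases f2' with f | f
      · left; omega
      · exact Or.inr f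
    · exact fun x hx hx' => (path_betw hAB' hA' hB' hx hx').2
    · intro hd
      obtain ⟨s, t, rfl⟩ := List.append_of_mem hd
      obtain ⟨K', -, h4⟩ := (path_append (u := s) (v := f :: ((t ++ B') ++ [f]))).1
        (by simpa using h3)
      have := (path_between h4).2
      rw [List.mem_append] at this
      simp only [List.mem_append, List.mem_cons]
      tauto

def Ch : List (List ℤ) → Prop
  | [] => True
  | [A] => A.Pairwise (· < ·)
  | A :: B :: bs => A.Pairwise (· < ·) ∧ Lat A B ∧ Ch (B :: bs)

theorem Ch.head {A : List ℤ} {bs : List (List ℤ)} (h : Ch (A :: bs)) : A.Pairwise (· < ·) := by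
  cases bs with
  | nil => exact h
  | cons B bs => exact h.1

def slB : ℤ → List (List ℤ) → List (List ℤ)
  | _, [] => []
  | d, A :: bs => (slideR d A).1 :: slB (slideR d A).2 bs

theorem slB_flatten (d : ℤ) (bs : List (List ℤ)) :
    (slB d bs).flatten = (slideR d bs.flatten).1 := by
  induction bs generalizing d with
  | nil => simp [slB, slideR]
  | cons A bs ih => simp [slB, slideR_append, ih]

theorem slB_lengths (d : ℤ) (bs : List (List ℤ)) :
    (slB d bs).map List.length = bs.map List.length := by
  induction bs generalizing d with
  | nil => simp [slB]
  | cons A bs ih => simp [slB, slideR_length, ih]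

theorem slB_Ch {M N : Set ℤ} {d : ℤ} {bs : List (List ℤ)} (h : Path M (d :: bs.flatten) N) :
    Ch bs ↔ Ch (slB d bs) := by
  induction bs generalizing d M with
  | nil => simp [slB, Ch]
  | cons A bs ih =>
    cases bs with
    | nil =>
      simp only [slB, Ch]
      exact slideR_pairwise (by simpa using h)
    | cons B bs =>
      rw [List.flatten_cons] at h
      have h1 := path_slideR h
      obtain ⟨K, hK1, hK2⟩ := path_append.1 h1
      have ih := ih hK2
      obtain ⟨N1, hdA⟩ := path_append_left (u := d :: A) (v := (B :: bs).flatten) h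
      obtain ⟨N2, hdAB⟩ := path_append_left (u := d :: (A ++ B)) (v := bs.flatten)
        (by simpa using h)
      have ihB : slB (slideR d A).2 (B :: bs) =
        (slideR (slideR d A).2 B).1 :: slB (slideR (slideR d A).2 B).2 bs := rfl
      obtain ⟨N3, hK3⟩ := path_append_left (u := (slideR d A).2 :: B) (v := bs.flatten)
        (by simpa using hK2)
      have e : slB d (A :: B :: bs) = (slideR d A).1 :: slB (slideR d A).2 (B :: bs) := rfl
      rw [e, ihB]
      rw [ihB] at ih
      simp only [Ch]
      constructor
      · rintro ⟨a, b, c⟩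
        exact ⟨(slideR_pairwise hdA).1 a, (lat_slide hdAB a c.head).1 b, ih.1 c⟩
      · rintro ⟨a, b, c⟩
        have a' := (slideR_pairwise hdA).2 a
        have c' := ih.2 c
        exact ⟨a', (lat_slide hdAB a' c'.head).2 b, c'⟩

theorem sw_Ch {M N : Set ℤ} {u : List ℤ} {bs : List (List ℤ)} (h : Path M (u ++ bs.flatten) N) :
    ∃ bs', (sw u bs.flatten).1 = bs'.flatten ∧ bs'.map List.length = bs.map List.length ∧
      (Ch bs ↔ Ch bs') := by
  induction u generalizing M with
  | nil => exact ⟨bs, rfl, rfl, Iff.rfl⟩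
  | cons d u ih =>
    obtain ⟨bs', h1, h2, h3⟩ := ih h.2.2
    have h4 : Path M (d :: (sw u bs.flatten).1 ++ (sw u bs.flatten).2) N :=
      ⟨h.1, h.2.1, by
        have := path_sw (t := []) (by simpa using h.2.2)
        simpa using this⟩
    obtain ⟨N1, h5⟩ := path_append_left h4
    rw [h1] at h5
    refine ⟨slB d bs', ?_, by rw [slB_lengths, h2], h3.trans (slB_Ch h5)⟩
    simp only [sw]
    rw [h1, slB_flatten]

theorem run_of {M N : Set ℤ} {w : List ℤ} {s T : ℤ} (h : Path M w N) (hw : w.Pairwise (· < ·))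
    (hs : s ∈ M) (hM : ∀ x ∈ M, s < x → T ≤ x) (h1 : ∀ x ∈ w, s ≤ x) (h2 : ∀ x ∈ w, x < T) :
    w = run s w.length ∧ ∀ x, x ∈ N → (x ∈ M ∧ x ≠ s) ∨ x = s + w.length := by
  induction w generalizing M s with
  | nil =>
    refine ⟨rfl, fun x hx => ?_⟩
    have : M = N := h
    subst this
    by_cases hxs : x = s
    · right; simp [hxs]
    · exact Or.inl ⟨hx, hxs⟩
  | cons c w ih =>
    obtain ⟨p1, p2, p3⟩ := h
    rw [List.pairwise_cons] at hw
    have hc : c = s := by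
      have a := h1 c (by simp)
      have b := h2 c (by simp)
      by_contra hne
      have := hM c p1 (by omega)
      omega
    subst hc
    obtain ⟨i1, i2⟩ := ih (s := c + 1) p3 hw.2 (Or.inr rfl) (fun x hx hlt => by
      rcases hx with hx | hx
      · exact hM x hx.1 (by omega)
      · omega) (fun x hx => by have := hw.1 x hx; omega) (fun x hx => h2 x (by simp [hx]))
    refine ⟨?_, fun x hx => ?_⟩
    · simp only [List.length_cons, run]
      rw [← i1]
    · rcases i2 x hx with ⟨hx | hx, hx'⟩ | hx
      · exact Or.inl hx
      · exact absurd hx hx'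
      · right; rw [hx, List.length_cons]; push_cast; ring

theorem path_first {M N : Set ℤ} {w : List ℤ} {s T : ℤ} (h : Path M w N)
    (hw : w.Pairwise (· < ·)) (hs : ∀ x ≤ s, x ∈ M) (hM : ∀ x ∈ M, s < x → T ≤ x)
    (h2 : ∀ x ∈ w, x < T) : ∀ x ∈ w, s ≤ x := by
  cases w with
  | nil => simp
  | cons c w =>
    have hc : s ≤ c := by
      by_contra hc
      exact h.2.1 (hs _ (by omega))
    rw [List.pairwise_cons] at hw
    intro x hx
    rcases List.mem_cons.1 hx with h | h
    · omega
    · have := hw.1 x h; omega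

theorem straight_aux {bs : List (List ℤ)} : ∀ {A : List ℤ} {M N : Set ℤ} {i T : ℤ},
    Ch (A :: bs) → Path M (A :: bs).flatten N → (∀ x ≤ -i, x ∈ M) →
    (∀ x ∈ M, -i < x → T ≤ x) → (∀ x ∈ A, x < T) → -i < T →
    (A :: bs).flatten = U i ((A :: bs).map List.length) := by
  induction bs with
  | nil =>
    intro A M N i T hC hP h1 h2 h3 h4
    simp only [List.flatten_cons, List.flatten_nil, List.append_nil] at hP
    have := (run_of hP hC.head (h1 _ le_rfl) h2 (path_first hP hC.head h1 h2 h3) h3).1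
    simp only [List.flatten_cons, List.flatten_nil, List.append_nil, List.map_cons, List.map_nil, U]
    exact this
  | cons B bs ih =>
    intro A M N i T hC hP h1 h2 h3 h4
    rw [List.flatten_cons] at hP
    obtain ⟨K, hK1, hK2⟩ := path_append.1 hP
    obtain ⟨r1, r2⟩ := run_of hK1 hC.head (h1 _ le_rfl) h2 (path_first hK1 hC.head h1 h2 h3) h3
    have hlen : -i + (A.length : ℤ) ≤ T := by
      by_cases hA : A.length = 0
      · rw [hA]; push_cast; omega
      · have := h3 (-i + A.length - 1) (by rw [r1, mem_run, run_length]; omega)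
        omega
    have hlow : ∀ x ≤ -(i + 1), x ∈ K := by
      intro x hx
      by_contra hc
      have := path_notMem_of_mem hK1 (h1 x (by omega)) hc
      rw [r1, mem_run] at this
      omega
    have := ih (A := B) (i := i + 1) (T := -i + A.length) hC.2.2 hK2 hlow
      (fun x hx hlt => by
        rcases r2 x hx with ⟨h, h'⟩ | h
        · have := h2 x h (by omega); omega
        · omega)
      (fun x hx => by
        have hl := hC.2.1 x
        have hpos : 0 < B.countP (fun y => x ≤ y) := List.countP_pos_iff.2 ⟨x, hx, by simp⟩
        obtain ⟨a, ha, hax⟩ := List.countP_pos_iff.1 (lt_of_lt_of_le hpos hl)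
        rw [r1, mem_run] at ha
        simp only [decide_eq_true_eq] at hax
        omega) (by omega)
    rw [List.flatten_cons, this, List.map_cons, List.map_cons, List.map_cons]
    conv_lhs => rw [r1]
    rfl

theorem straight {bs : List (List ℤ)} {N : Set ℤ} (hC : Ch bs) (hP : Path M0 bs.flatten N) :
    bs.flatten = U 0 (bs.map List.length) := by
  cases bs with
  | nil => rfl
  | cons A bs =>
    have hb : ∀ x ∈ A, x < (A.map (fun x => |x|)).sum + 1 := by
      intro x hx
      have h1 : |x| ≤ (A.map (fun x => |x|)).sum := by
        apply List.single_le_sum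
        · intro y hy
          obtain ⟨z, -, rfl⟩ := List.mem_map.1 hy
          exact abs_nonneg z
        · exact List.mem_map_of_mem hx
      have := le_abs_self x
      omega
    refine straight_aux hC hP (T := (A.map (fun x => |x|)).sum + 1) (fun x hx => ?_)
      (fun x hx hlt => ?_) hb ?_
    · simp only [M0, Set.mem_ofPred_eq]; omega
    · simp only [M0, Set.mem_ofPred_eq] at hx; omega
    · have : 0 ≤ (A.map (fun x => |x|)).sum := List.sum_nonneg (by
        intro y hy
        obtain ⟨z, -, rfl⟩ := List.mem_map.1 hy
        exact abs_nonneg z)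
      omega

def Ub : ℤ → List ℕ → List (List ℤ)
  | _, [] => []
  | i, a :: α => run (-i) a :: Ub (i + 1) α

theorem Ub_flatten (i : ℤ) (α : List ℕ) : (Ub i α).flatten = U i α := by
  induction α generalizing i with
  | nil => rfl
  | cons a α ih => simp [Ub, U, ih]

theorem Ub_lengths (i : ℤ) (α : List ℕ) : (Ub i α).map List.length = α := by
  induction α generalizing i with
  | nil => rfl
  | cons a α ih => simp [Ub, run_length, ih]

theorem cnt_run (s t : ℤ) (a : ℕ) :
    ((run s a).countP (fun x => t ≤ x) : ℤ) = max 0 (min (a : ℤ) (s + a - t)) := by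
  induction a with
  | zero => simp [run]
  | succ a ih =>
    rw [run_succ, List.countP_append]
    push_cast
    rw [ih]
    by_cases h : t ≤ s + a
    · simp [List.countP_cons, h]; omega
    · simp [List.countP_cons, h]; omega

theorem lat_run {s : ℤ} {a b : ℕ} (h : b ≤ a) : Lat (run s a) (run (s - 1) b) := by
  intro t
  rw [cnt_lt_eq]
  have h1 := cnt_run s (t + 1) a
  have h2 := cnt_run (s - 1) t b
  omega

theorem Ub_Ch (i : ℤ) {α : List ℕ} (h : α.Pairwise (· ≥ ·)) : Ch (Ub i α) := by
  induction α generalizing i with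
  | nil => trivial
  | cons a α ih =>
    rw [List.pairwise_cons] at h
    cases α with
    | nil => exact run_sorted _ _
    | cons b α =>
      have := ih (i + 1) h.2
      refine ⟨run_sorted _ _, ?_, this⟩
      have := lat_run (s := -i) (h.1 b (by simp))
      rwa [show -i - 1 = -(i + 1) by ring] at this

theorem exists_split {α : List ℕ} {w : List ℤ} (h : w.length = α.sum) :
    ∃ bs : List (List ℤ), bs.flatten = w ∧ bs.map List.length = α := by
  induction α generalizing w with
  | nil => exact ⟨[], by simpa using (List.length_eq_zero_iff.1 (by simpa using h)).symm⟩
  | cons a α ih =>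
    rw [List.sum_cons] at h
    obtain ⟨bs, h1, h2⟩ := ih (w := w.drop a) (by simp; omega)
    exact ⟨w.take a :: bs, by simp [h1], by simp [h2]; omega⟩

theorem flatten_inj {bs bs' : List (List ℤ)} (h : bs.flatten = bs'.flatten)
    (hl : bs.map List.length = bs'.map List.length) : bs = bs' := by
  induction bs generalizing bs' with
  | nil => cases bs' <;> simp_all
  | cons A bs ih =>
    cases bs' with
    | nil => simp at hl
    | cons A' bs' =>
      simp only [List.map_cons, List.cons.injEq, List.flatten_cons] at h hl
      obtain ⟨h1, h2⟩ := List.append_inj h hl.1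
      rw [h1, ih h2 hl.2]

theorem psi_eq_U {m K : ℕ} {A B : Set ℤ} (hK : m < K) {l : List (Bool × ℤ)} (h : l ∈ E m A B)
    {bs : List (List ℤ)} (hb : bs.flatten = l.map (enc2 K)) (hC : Ch bs) :
    psi K l = U 0 (bs.map List.length) := by
  have hp := E_path hK h
  rw [← hb] at hp
  obtain ⟨bs', h1, h2, h3⟩ := sw_Ch hp
  obtain ⟨-, N, hN⟩ := psi_str hK h
  rw [psi, ← hb] at hN ⊢
  rw [h1] at hN ⊢
  rw [straight (h3.1 hC) hN, h2]

theorem fixed_Ch {N : Set ℤ} {α : List ℕ} (hα : α.Pairwise (· ≥ ·)) {Q : List ℤ}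
    (hQ : Path M0 (U 0 α ++ Q) N) (hs : sw (U 0 α) Q = (U 0 α, Q)) :
    ∃ bs, bs.flatten = Q ∧ bs.map List.length = α ∧ Ch bs := by
  have hl : Q.length = α.sum := by
    have := (sw_length (U 0 α) Q).2
    rw [hs] at this
    rw [← U_length 0 α]; exact this
  obtain ⟨bs, h1, h2⟩ := exists_split hl
  refine ⟨bs, h1, h2, ?_⟩
  subst h1
  obtain ⟨bs', h3, h4, h5⟩ := sw_Ch hQ
  rw [h5]
  rw [hs] at h3
  have : bs' = Ub 0 α := flatten_inj (by rw [Ub_flatten]; exact h3.symm)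
    (by rw [h4, h2, Ub_lengths])
  rw [this]
  exact Ub_Ch 0 hα

end LRT

namespace LRT

theorem path_cells {w : List ℤ} : ∀ {π π' : ℕ → ℕ}, IsPartition π → IsPartition π' →
    Path (bd π) w (bd π') → w.Pairwise (· < ·) →
    (∀ i, π i ≤ π' i) ∧ (∀ i, π' (i + 1) ≤ π i) ∧
    ∀ x, x ∈ w ↔ ∃ i j : ℕ, π i ≤ j ∧ j < π' i ∧ x = (j : ℤ) - i := by
  induction w with
  | nil =>
    intro π π' h h' hP _
    have : π = π' := bd_inj h h' hP
    subst this
    refine ⟨fun _ => le_rfl, fun i => h.1 (by omega), fun x => ?_⟩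
    simp only [List.not_mem_nil, false_iff, not_exists]
    rintro i j ⟨h1, h2, -⟩
    omega
  | cons c w ih =>
    intro π π' h h' hP hw
    rw [List.pairwise_cons] at hw
    obtain ⟨i, hi, hp, hs⟩ := bd_step h hP.1 hP.2.1
    have hP2 := hP.2.2
    rw [hs] at hP2
    obtain ⟨h1, h2, h3⟩ := ih hp h' hP2 hw.2
    have hle : ∀ k, π k ≤ Function.update π i (π i + 1) k := by
      intro k
      by_cases hk : k = i
      · subst hk; simp
      · simp [hk]
    have hui : Function.update π i (π i + 1) i = π i + 1 := by simp
    have hun : ∀ k, k ≠ i → Function.update π i (π i + 1) k = π k := fun k hk => by simp [hk]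
    refine ⟨fun k => (hle k).trans (h1 k), fun k => ?_, fun x => ?_⟩
    · by_cases hk : k = i
      · subst hk
        by_contra hc
        have hh := h2 k
        rw [hui] at hh
        have h4 := (h3 (c - 1)).2 ⟨k + 1, π k, by rw [hun _ (by omega)]; exact h.1 (by omega),
          by omega, by push_cast; omega⟩
        have := hw.1 _ h4
        omega
      · have := h2 k
        rwa [hun k hk] at this
    · rw [List.mem_cons, h3]
      constructor
      · rintro (hx | ⟨k, j, hk, hj, hx⟩)
        · exact ⟨i, π i, le_rfl, by have := h1 i; rw [hui] at this; omega, by omega⟩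
        · exact ⟨k, j, (hle k).trans hk, hj, hx⟩
      · rintro ⟨k, j, hk, hj, hx⟩
        by_cases hki : k = i ∧ j = π i
        · left; rw [hx, hki.1, hki.2]; omega
        · right
          refine ⟨k, j, ?_, hj, hx⟩
          by_cases hki' : k = i
          · subst hki'; rw [hui]; omega
          · rw [hun k hki']; exact hk

def cells (π π' : ℕ → ℕ) : Set (ℕ × ℕ) := {c | π c.1 ≤ c.2 ∧ c.2 < π' c.1}

theorem cells_finite (π : ℕ → ℕ) {π' : ℕ → ℕ} (h : IsPartition π') : (cells π π').Finite := by
  obtain ⟨ha, n, hn⟩ := h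
  apply Set.Finite.subset ((Finset.range n ×ˢ Finset.range (π' 0)).finite_toSet)
  rintro ⟨i, j⟩ ⟨h1, h2⟩
  simp only [Finset.coe_product, Finset.coe_range, Set.mem_prod, Set.mem_Iio]
  constructor
  · by_contra hc
    have := hn i (by omega)
    simp only at h2
    omega
  · exact lt_of_lt_of_le h2 (ha (Nat.zero_le i))

theorem cells_countP {w : List ℤ} {π π' : ℕ → ℕ} (h : IsPartition π) (h' : IsPartition π')
    (hP : Path (bd π) w (bd π')) (hw : w.Pairwise (· < ·)) (p : ℤ → Prop) [DecidablePred p] :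
    w.countP (fun x => p x) = {c : ℕ × ℕ | c ∈ cells π π' ∧ p ((c.2 : ℤ) - c.1)}.ncard := by
  obtain ⟨h1, h2, h3⟩ := path_cells h h' hP hw
  have hnd : w.Nodup := hw.imp (fun h => ne_of_lt h)
  have e1 : w.countP (fun x => p x) = ((w.toFinset.filter p : Finset ℤ) : Set ℤ).ncard := by
    rw [Set.ncard_coe_finset, List.countP_eq_length_filter,
      ← List.toFinset_card_of_nodup (hnd.filter _)]
    congr 1
    ext x
    simp
  have key : ∀ i i' j j' : ℕ, i < i' → (i, j) ∈ cells π π' → (i', j') ∈ cells π π' →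
      (j : ℤ) - i = j' - i' → False := by
    rintro i i' j j' hlt ⟨a1, a2⟩ ⟨b1, b2⟩ he
    simp only at a1 a2 b1 b2
    obtain ⟨k, rfl⟩ : ∃ k, i' = k + 1 := ⟨i' - 1, by omega⟩
    have := h2 k
    have := h.1 (show i ≤ k by omega)
    push_cast at he
    omega
  rw [e1]
  symm
  apply Set.ncard_congr (fun c _ => (c.2 : ℤ) - c.1)
  · rintro ⟨i, j⟩ ⟨hc, hp⟩
    simp only [Finset.coe_filter, List.mem_toFinset, Set.mem_ofPred_eq]
    exact ⟨(h3 _).2 ⟨i, j, hc.1, hc.2, rfl⟩, hp⟩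
  · rintro ⟨i, j⟩ ⟨i', j'⟩ ⟨hc, -⟩ ⟨hc', -⟩ he
    simp only at he
    rcases lt_trichotomy i i' with hh | hh | hh
    · exact (key _ _ _ _ hh hc hc' he).elim
    · subst hh
      have : j = j' := by omega
      rw [this]
    · exact (key _ _ _ _ hh hc' hc he.symm).elim
  · intro x hx
    simp only [Finset.coe_filter, List.mem_toFinset, Set.mem_ofPred_eq] at hx
    obtain ⟨i, j, a, b, rfl⟩ := (h3 x).1 hx.1
    exact ⟨(i, j), ⟨⟨a, b⟩, hx.2⟩, rfl⟩

structure Chain (lam mu σ : ℕ → ℕ) (π : ℕ → ℕ → ℕ) (b : ℕ → List ℤ) : Prop where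
  part : ∀ k, IsPartition (π k)
  path : ∀ k, Path (bd (π k)) (b k) (bd (π (k + 1)))
  pw : ∀ k, (b k).Pairwise (· < ·)
  lat : ∀ k, Lat (b k) (b (k + 1))
  start : π 0 = lam
  final : ∃ n, ∀ k, n ≤ k → π k = σ
  len : ∀ k, (b k).length = mu k

noncomputable def tab (π : ℕ → ℕ → ℕ) : ℕ × ℕ → ℕ := fun c => sInf {k | c.2 < π k c.1}

section
variable {lam mu σ : ℕ → ℕ} {π : ℕ → ℕ → ℕ} {b : ℕ → List ℤ}

theorem Chain.mono (h : Chain lam mu σ π b) (i : ℕ) : Monotone (fun k => π k i) :=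
  monotone_nat_of_le_succ fun k => (path_cells (h.part k) (h.part (k + 1)) (h.path k) (h.pw k)).1 i

theorem Chain.strip (h : Chain lam mu σ π b) (k i : ℕ) : π (k + 1) (i + 1) ≤ π k i :=
  (path_cells (h.part k) (h.part (k + 1)) (h.path k) (h.pw k)).2.1 i

theorem Chain.tab_iff (h : Chain lam mu σ π b) (c : ℕ × ℕ) (k : ℕ) :
    tab π c = k + 1 ↔ c ∈ cells (π k) (π (k + 1)) := by
  unfold tab
  rw [Nat.sInf_upward_closed_eq_succ_iff]
  · simp only [Set.mem_ofPred_eq, cells, not_lt]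
    exact and_comm
  · intro k1 k2 hk h1
    exact lt_of_lt_of_le h1 (h.mono c.1 hk)

theorem Chain.tab_zero (h : Chain lam mu σ π b) (c : ℕ × ℕ) :
    tab π c = 0 ↔ ¬ InSkew lam σ c := by
  obtain ⟨n, hn⟩ := h.final
  unfold tab InSkew
  rw [Nat.sInf_eq_zero]
  simp only [Set.mem_ofPred_eq, h.start]
  constructor
  · rintro (h1 | h1)
    · omega
    · have : n ∉ {k | c.2 < π k c.1} := by rw [h1]; simp
      simp only [Set.mem_ofPred_eq, hn n le_rfl] at this
      omega
  · intro hc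
    by_cases h1 : c.2 < lam c.1
    · exact Or.inl h1
    · right
      ext k
      simp only [Set.mem_ofPred_eq, Set.mem_empty_iff_false, iff_false]
      intro h2
      have := h.mono c.1 (le_max_right n k)
      simp only at this
      rw [hn _ (le_max_left n k)] at this
      omega

theorem Chain.lattice (h : Chain lam mu σ π b) (r c k : ℕ) :
    {x : ℕ × ℕ | tab π x = k + 1 + 1 ∧ (x.1 < r ∨ (x.1 = r ∧ c ≤ x.2))}.ncard ≤
    {x : ℕ × ℕ | tab π x = k + 1 ∧ (x.1 < r ∨ (x.1 = r ∧ c ≤ x.2))}.ncard := by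
  simp only [h.tab_iff]
  have hf1 := cells_finite (π k) (h.part (k + 1))
  have hf2 := cells_finite (π (k + 1)) (h.part (k + 1 + 1))
  set L := {x : ℕ × ℕ | x ∈ cells (π (k + 1)) (π (k + 1 + 1)) ∧
    (x.1 < r ∨ (x.1 = r ∧ c ≤ x.2))} with hL
  have hLf : L.Finite := hf2.subset fun x hx => hx.1
  rcases L.eq_empty_or_nonempty with h0 | hne
  · rw [h0]; simp
  · obtain ⟨x0, hx0, hmin⟩ := Set.exists_min_image L (fun x => (x.2 : ℤ) - x.1) hLf hne
    have h1 := cells_countP (h.part k) (h.part (k + 1)) (h.path k) (h.pw k)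
      (fun x => (x0.2 : ℤ) - x0.1 < x)
    have h2 := cells_countP (h.part (k + 1)) (h.part (k + 1 + 1)) (h.path (k + 1)) (h.pw (k + 1))
      (fun x => (x0.2 : ℤ) - x0.1 ≤ x)
    have h3 := h.lat k ((x0.2 : ℤ) - x0.1)
    rw [h1, h2] at h3
    refine le_trans (Set.ncard_le_ncard ?_ (hf2.subset fun x hx => hx.1)) (h3.trans
      (Set.ncard_le_ncard ?_ (hf1.subset fun x hx => hx.1)))
    · intro x hx
      exact ⟨hx.1, hmin x hx⟩
    · rintro ⟨i, j⟩ ⟨hc, hlt⟩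
      refine ⟨hc, ?_⟩
      obtain ⟨i0, j0⟩ := x0
      obtain ⟨⟨a1, a2⟩, a3⟩ := hx0
      obtain ⟨b1, b2⟩ := hc
      simp only at *
      have : i ≤ i0 := by
        by_contra hh
        have := (h.part (k + 1)).1 (show i0 ≤ i by omega)
        omega
      by_cases hi : i = i0
      · subst hi; omega
      · omega

theorem Chain.isLR (h : Chain lam mu σ π b) : IsLRFilling lam mu σ (tab π) := by
  have hskew : ∀ c k, tab π c = k + 1 → InSkew lam σ c := by
    intro c k hc
    by_contra hn
    rw [← h.tab_zero] at hn
    omega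
  have hex : ∀ c, InSkew lam σ c → ∃ k, tab π c = k + 1 := by
    intro c hc
    have : tab π c ≠ 0 := fun h0 => (h.tab_zero c).1 h0 hc
    exact ⟨tab π c - 1, by omega⟩
  refine ⟨fun c hc => (h.tab_zero c).2 hc, fun c hc => ?_, ?_, ?_, ?_, ?_⟩
  · obtain ⟨k, hk⟩ := hex c hc; omega
  · intro i j j' h1 h2 hj
    obtain ⟨k, hk⟩ := hex _ h1
    obtain ⟨k', hk'⟩ := hex _ h2
    rw [hk, hk']
    rw [h.tab_iff] at hk hk'
    by_contra hlt
    have := h.mono i (show k' + 1 ≤ k by omega)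
    obtain ⟨a1, a2⟩ := hk
    obtain ⟨b1, b2⟩ := hk'
    simp only at *
    omega
  · intro i j h1 h2
    obtain ⟨k, hk⟩ := hex _ h1
    obtain ⟨k', hk'⟩ := hex _ h2
    rw [hk, hk']
    rw [h.tab_iff] at hk hk'
    by_contra hlt
    have := h.mono (i + 1) (show k' + 1 ≤ k + 1 by omega)
    have := h.strip k i
    obtain ⟨a1, a2⟩ := hk
    obtain ⟨b1, b2⟩ := hk'
    simp only at *
    omega
  · intro k
    rw [Nat.card_coe_set_eq]
    have h1 := cells_countP (h.part k) (h.part (k + 1)) (h.path k) (h.pw k) (fun _ => True)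
    simp only [decide_true, and_true] at h1
    have h2 : List.countP (fun _ => true) (b k) = (b k).length := by simp
    rw [← h.len k, ← h2, h1]
    congr 1
    ext c
    simp [h.tab_iff]
  · intro r c k l hkl
    simp only [Nat.card_coe_set_eq]
    obtain ⟨d, rfl⟩ : ∃ d, l = k + d := ⟨l - k, by omega⟩
    clear hkl
    induction d with
    | zero => exact le_rfl
    | succ d ih => exact (h.lattice r c (k + d)).trans ih

theorem Chain.mem (h : Chain lam mu σ π b) (k : ℕ) (x : ℤ) :
    x ∈ b k ↔ ∃ c : ℕ × ℕ, tab π c = k + 1 ∧ x = (c.2 : ℤ) - c.1 := by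
  rw [(path_cells (h.part k) (h.part (k + 1)) (h.path k) (h.pw k)).2.2 x]
  simp only [h.tab_iff]
  constructor
  · rintro ⟨i, j, h1, h2, h3⟩
    exact ⟨(i, j), ⟨h1, h2⟩, h3⟩
  · rintro ⟨⟨i, j⟩, ⟨h1, h2⟩, h3⟩
    exact ⟨i, j, h1, h2, h3⟩
end

theorem sorted_ext {u v : List ℤ} (hu : u.Pairwise (· < ·)) (hv : v.Pairwise (· < ·))
    (h : ∀ x, x ∈ u ↔ x ∈ v) : u = v := by
  have hp : u.Perm v := (List.perm_ext_iff_of_nodup (hu.imp (fun h => ne_of_lt h))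
    (hv.imp (fun h => ne_of_lt h))).2 h
  exact hp.eq_of_pairwise (fun a b _ _ h1 h2 => by omega) hu hv

theorem Ch.getD {bs : List (List ℤ)} (h : Ch bs) :
    (∀ k, (bs.getD k []).Pairwise (· < ·)) ∧ ∀ k, Lat (bs.getD k []) (bs.getD (k + 1) []) := by
  induction bs with
  | nil => simp [Lat]
  | cons A bs ih =>
    cases bs with
    | nil =>
      refine ⟨fun k => ?_, fun k => ?_⟩
      · cases k with
        | zero => exact h
        | succ k => simp
      · cases k <;> simp [Lat]
    | cons B bs =>
      obtain ⟨h1, h2, h3⟩ := h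
      obtain ⟨i1, i2⟩ := ih h3
      refine ⟨fun k => ?_, fun k => ?_⟩
      · cases k with
        | zero => exact h1
        | succ k => exact i1 k
      · cases k with
        | zero => exact h2
        | succ k => exact i2 k

theorem exists_chain {bs : List (List ℤ)} : ∀ {lam σ : ℕ → ℕ}, IsPartition lam → IsPartition σ →
    Path (bd lam) bs.flatten (bd σ) → ∃ π : ℕ → ℕ → ℕ, (∀ k, IsPartition (π k)) ∧
      (∀ k, Path (bd (π k)) (bs.getD k []) (bd (π (k + 1)))) ∧ π 0 = lam ∧
      ∀ k, bs.length ≤ k → π k = σ := by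
  induction bs with
  | nil =>
    intro lam σ h1 h2 h
    have : lam = σ := bd_inj h1 h2 h
    subst this
    exact ⟨fun _ => lam, fun _ => h1, fun k => by simp [Path], rfl, fun _ _ => rfl⟩
  | cons A bs ih =>
    intro lam σ h1 h2 h
    rw [List.flatten_cons] at h
    obtain ⟨K, hK1, hK2⟩ := path_append.1 h
    obtain ⟨ρ, hρ, rfl, -⟩ := path_bd h1 hK1
    obtain ⟨π, p1, p2, p3, p4⟩ := ih hρ h2 hK2
    refine ⟨fun k => Nat.casesOn k lam π, fun k => ?_, fun k => ?_, rfl, fun k hk => ?_⟩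
    · cases k with
      | zero => exact h1
      | succ k => exact p1 k
    · cases k with
      | zero => simpa [p3] using hK1
      | succ k => exact p2 k
    · cases k with
      | zero => simp at hk
      | succ k => exact p4 k (by simpa using hk)

theorem LR_finite {lam mu σ : ℕ → ℕ} (hmu : IsPartition mu) (hσ : IsPartition σ) :
    Finite {T : ℕ × ℕ → ℕ // IsLRFilling lam mu σ T} := by
  obtain ⟨-, N, hN⟩ := hmu
  have hF := cells_finite lam hσ
  have hval : ∀ T, IsLRFilling lam mu σ T → ∀ c, T c < N + 1 := by
    rintro T ⟨h1, h2, h3, h4, h5, h6⟩ c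
    by_contra hc
    have h7 := h5 (T c - 1)
    have h8 : {c' : ℕ × ℕ | T c' = T c - 1 + 1}.Finite := by
      refine hF.subset fun x hx => ?_
      simp only [Set.mem_ofPred_eq] at hx
      by_contra hn
      have := h1 x hn
      omega
    rw [hN _ (by omega), Nat.card_coe_set_eq, Set.ncard_eq_zero h8] at h7
    · have : c ∈ {c' : ℕ × ℕ | T c' = T c - 1 + 1} := by
        simp only [Set.mem_ofPred_eq]; omega
      rw [h7] at this
      exact this
  have : Finite (cells lam σ) := hF
  apply Finite.of_injective
    (fun T : {T : ℕ × ℕ → ℕ // IsLRFilling lam mu σ T} =>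
      (fun c : cells lam σ => (⟨T.1 c.1, hval T.1 T.2 c.1⟩ : Fin (N + 1))))
  rintro ⟨T, hT⟩ ⟨T', hT'⟩ he
  apply Subtype.ext
  funext c
  by_cases hc : c ∈ cells lam σ
  · have := congrFun he ⟨c, hc⟩
    simpa using this
  · show T c = T' c
    rw [hT.1 c hc, hT'.1 c hc]

theorem G_le_LR {ν σ : ℕ → ℕ} (hν : IsPartition ν) (hσ : IsPartition σ) {n : ℕ}
    (hn : ∀ k, n ≤ k → ν k = 0) (m : ℕ) :
    {x | x ∈ G m (bd σ) ∧ x.1 = U 0 ((List.range n).map ν)}.ncard ≤ LR ν ν σ := by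
  set α := (List.range n).map ν with hα
  have hαp : α.Pairwise (· ≥ ·) := by
    rw [hα, List.pairwise_map]
    exact (List.pairwise_lt_range (n := n)).imp (fun h => hν.1 h.le)
  have hαlen : α.length = n := by simp [hα]
  have key : ∀ x : {x // x ∈ G m (bd σ) ∧ x.1 = U 0 α}, ∃ (π : ℕ → ℕ → ℕ) (bs : List (List ℤ)),
      bs.flatten = x.1.2 ∧ bs.length = n ∧ Chain ν ν σ π (fun k => bs.getD k []) := by
    rintro ⟨⟨P, Q⟩, ⟨h1, h2, h3, h4⟩, h5⟩
    simp only at h1 h2 h3 h4 h5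
    subst h5
    obtain ⟨bs, b1, b2, b3⟩ := fixed_Ch hαp h3 h4
    have hbl : bs.length = n := by rw [← hαlen, ← b2, List.length_map]
    obtain ⟨K, hK1, hK2⟩ := path_append.1 h3
    have hK := path_det hK1 (path_U' hν hn)
    subst hK
    rw [← b1] at hK2
    obtain ⟨π, p1, p2, p3, p4⟩ := exists_chain hν hσ hK2
    refine ⟨π, bs, b1, hbl, p1, p2, b3.getD.1, b3.getD.2, p3, ⟨_, p4⟩, fun k => ?_⟩
    by_cases hk : k < n
    · have h6 : (bs.map List.length)[k]? = α[k]? := by rw [b2]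
      simp only [List.getElem?_map, hα] at h6
      rw [List.getElem?_eq_getElem (by omega), List.getElem?_eq_getElem (by simpa using hk)] at h6
      rw [List.getD_eq_getElem?_getD, List.getElem?_eq_getElem (by omega)]
      simpa using h6
    · rw [hn k (by omega), List.getD_eq_getElem?_getD, List.getElem?_eq_none (by omega)]
      simp
  choose π bs h1 h2 h3 using key
  have := LR_finite (lam := ν) hν hσ
  rw [← Nat.card_coe_set_eq, LR]
  apply Nat.card_le_card_of_injective
    (fun x => (⟨tab (π x), (h3 x).isLR⟩ : {T : ℕ × ℕ → ℕ // IsLRFilling ν ν σ T}))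
  intro x y hxy
  have he : tab (π x) = tab (π y) := congrArg Subtype.val hxy
  have hb : ∀ k, (bs x).getD k [] = (bs y).getD k [] := fun k =>
    sorted_ext ((h3 x).pw k) ((h3 y).pw k) (fun z => by
      have a := (h3 x).mem k z
      have b := (h3 y).mem k z
      rw [a, b, he])
  have hbs : bs x = bs y := by
    apply List.ext_getElem (by rw [h2, h2])
    intro k hk hk'
    have := hb k
    rwa [List.getD_eq_getElem?_getD, List.getD_eq_getElem?_getD, List.getElem?_eq_getElem hk,
      List.getElem?_eq_getElem hk'] at this
  apply Subtype.ext
  apply Prod.ext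
  · exact x.2.2.trans y.2.2.symm
  · rw [← h1 x, ← h1 y, hbs]

end LRT

namespace LRT

noncomputable def cnt (T : ℕ × ℕ → ℕ) (k i c : ℕ) : ℕ :=
  {x : ℕ × ℕ | T x = k + 1 ∧ (x.1 < i ∨ (x.1 = i ∧ c ≤ x.2))}.ncard

noncomputable def tl (T : ℕ × ℕ → ℕ) (i j : ℕ) : ℤ :=
  (cnt T (T (i, j) - 1) i (j + 1) : ℤ) - ((T (i, j) - 1 : ℕ) : ℤ)

noncomputable def al (lam : ℕ → ℕ) (T : ℕ × ℕ → ℕ) (i j : ℕ) : Bool × ℤ :=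
  if j < lam i then (false, (lam i : ℤ) - 1 - j - i) else (true, tl T i j)

noncomputable def row (lam ν : ℕ → ℕ) (T : ℕ × ℕ → ℕ) (i : ℕ) : List (Bool × ℤ) :=
  ((List.range (ν i)).map (al lam T i)).reverse

noncomputable def wd (lam ν : ℕ → ℕ) (T : ℕ × ℕ → ℕ) (n : ℕ) : List (Bool × ℤ) :=
  ((List.range n).map (row lam ν T)).flatten

section
variable {lam mu ν : ℕ → ℕ} {T : ℕ × ℕ → ℕ}

theorem T_in (h : IsLRFilling lam mu ν T) {i j : ℕ} (hT : T (i, j) ≠ 0) :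
    lam i ≤ j ∧ j < ν i := by
  by_contra hc
  exact hT (h.1 (i, j) hc)

theorem T_pos (h : IsLRFilling lam mu ν T) {i j : ℕ} (h1 : lam i ≤ j) (h2 : j < ν i) :
    1 ≤ T (i, j) := h.2.1 (i, j) ⟨h1, h2⟩

theorem lev_finite (hν : IsPartition ν) (h : IsLRFilling lam mu ν T) (k : ℕ) :
    {x : ℕ × ℕ | T x = k + 1}.Finite := by
  refine (cells_finite lam hν).subset fun x hx => ?_
  simp only [Set.mem_ofPred_eq] at hx
  by_contra hn
  have := h.1 x hn
  omega

theorem cnt_lat (h : IsLRFilling lam mu ν T) {k l : ℕ} (i c : ℕ) (hkl : k ≤ l) :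
    cnt T l i c ≤ cnt T k i c := by
  rcases hkl.eq_or_lt with rfl | hlt
  · exact le_rfl
  · have := h.2.2.2.2.2 i c k l hlt
    simp only [Nat.card_coe_set_eq] at this
    exact this

theorem cnt_anti (hν : IsPartition ν) (h : IsLRFilling lam mu ν T) (k i : ℕ) {c c' : ℕ}
    (hc : c ≤ c') : cnt T k i c' ≤ cnt T k i c := by
  apply Set.ncard_le_ncard
  · rintro x ⟨h1, h2⟩
    exact ⟨h1, by omega⟩
  · exact (lev_finite hν h k).subset fun x hx => hx.1

theorem cnt_step (hν : IsPartition ν) (h : IsLRFilling lam mu ν T) {k i j : ℕ}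
    (hT : T (i, j) = k + 1) : cnt T k i j = cnt T k i (j + 1) + 1 := by
  have hf : {x : ℕ × ℕ | T x = k + 1 ∧ (x.1 < i ∨ (x.1 = i ∧ j + 1 ≤ x.2))}.Finite :=
    (lev_finite hν h k).subset fun x hx => hx.1
  unfold cnt
  rw [← Set.ncard_insert_of_notMem (a := (i, j)) _ hf]
  · congr 1
    ext ⟨a, b⟩
    simp only [Set.mem_insert_iff, Set.mem_ofPred_eq, Prod.mk.injEq]
    constructor
    · rintro ⟨h1, h2⟩
      by_cases hab : a = i ∧ b = j
      · exact Or.inl hab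
      · exact Or.inr ⟨h1, by omega⟩
    · rintro (⟨rfl, rfl⟩ | ⟨h1, h2⟩)
      · exact ⟨hT, by omega⟩
      · exact ⟨h1, by omega⟩
  · simp

theorem cnt_same {k i j : ℕ} (hT : T (i, j) ≠ k + 1) : cnt T k i j = cnt T k i (j + 1) := by
  unfold cnt
  congr 1
  ext ⟨a, b⟩
  simp only [Set.mem_ofPred_eq]
  constructor
  · rintro ⟨h1, h2⟩
    refine ⟨h1, ?_⟩
    by_cases hab : a = i ∧ b = j
    · exact absurd (hab.1 ▸ hab.2 ▸ h1) hT
    · omega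
  · rintro ⟨h1, h2⟩
    exact ⟨h1, by omega⟩

theorem cnt_const {k i c : ℕ} (d : ℕ) (hT : ∀ j, c ≤ j → j < c + d → T (i, j) ≠ k + 1) :
    cnt T k i c = cnt T k i (c + d) := by
  induction d with
  | zero => rfl
  | succ d ih =>
    rw [ih (fun j h1 h2 => hT j h1 (by omega)), cnt_same (hT (c + d) (by omega) (by omega))]
    rfl

theorem cnt_next (h : IsLRFilling lam mu ν T) (k i : ℕ) {c : ℕ}
    (hc : ∀ j, c ≤ j → T (i + 1, j) ≠ k + 1) :
    cnt T k (i + 1) c = cnt T k i 0 := by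
  unfold cnt
  congr 1
  ext ⟨a, b⟩
  simp only [Set.mem_ofPred_eq]
  refine and_congr_right fun h1 => ⟨fun h2 => by
    rcases h2 with h2 | ⟨rfl, h2⟩
    · omega
    · exact absurd h1 (hc b h2), fun h2 => by omega⟩

theorem cnt_zero (h : IsLRFilling lam mu ν T) (k : ℕ) : cnt T k 0 (ν 0) = 0 := by
  unfold cnt
  have : {x : ℕ × ℕ | T x = k + 1 ∧ (x.1 < 0 ∨ (x.1 = 0 ∧ ν 0 ≤ x.2))} = ∅ := by
    ext ⟨a, b⟩
    simp only [Set.mem_ofPred_eq, Set.mem_empty_iff_false, iff_false]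
    rintro ⟨h1, h2⟩
    have := T_in h (i := a) (j := b) (by omega)
    rcases h2 with h2 | ⟨rfl, h2⟩ <;> omega
  rw [this, Set.ncard_empty]

theorem cnt_end (h : IsLRFilling lam mu ν T) (k : ℕ) {n : ℕ} (hn : ∀ k, n ≤ k → ν k = 0) :
    cnt T k n (ν n) = mu k := by
  rw [← h.2.2.2.2.1 k, Nat.card_coe_set_eq]
  unfold cnt
  congr 1
  ext ⟨a, b⟩
  simp only [Set.mem_ofPred_eq, and_iff_left_iff_imp]
  intro h1
  have h2 := T_in h (i := a) (j := b) (by omega)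
  by_contra hc
  have := hn a (by omega)
  omega

theorem cnt_part (hν : IsPartition ν) (h : IsLRFilling lam mu ν T) (hmu : IsPartition mu)
    (i c : ℕ) : IsPartition (fun k => cnt T k i c) := by
  refine ⟨fun k l hkl => cnt_lat h i c hkl, ?_⟩
  obtain ⟨-, N, hN⟩ := hmu
  refine ⟨N, fun k hk => ?_⟩
  have h1 := h.2.2.2.2.1 k
  rw [hN k hk, Nat.card_coe_set_eq] at h1
  have h2 : cnt T k i c ≤ {x : ℕ × ℕ | T x = k + 1}.ncard :=
    Set.ncard_le_ncard (fun x hx => hx.1) (lev_finite hν h k)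
  simp only
  omega

theorem fil_true_row (hν : IsPartition ν) (h : IsLRFilling lam mu ν T) (hmu : IsPartition mu)
    (i a : ℕ) (ha : a ≤ ν i) :
    Path (bd (fun k => cnt T k i a)) (fil true ((List.range a).map (al lam T i)).reverse)
      (bd (fun k => cnt T k i 0)) := by
  induction a with
  | zero => simp [fil, Path]
  | succ a ih =>
    have ih := ih (by omega)
    rw [List.range_succ, List.map_append, List.reverse_append, List.map_singleton,
      List.reverse_singleton, List.singleton_append]
    by_cases hl : a < lam i
    · have e : (fun k => cnt T k i (a + 1)) = fun k => cnt T k i a := by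
        funext k
        refine (cnt_same ?_).symm
        rw [h.1 (i, a) (fun hc => by have := hc.1; simp only at this; omega)]
        omega
      rw [e, al, if_pos hl, fil_cons_diff (by simp)]
      exact ih
    · rw [al, if_neg hl, fil_cons_same]
      have hpos := T_pos h (i := i) (j := a) (by omega) (by omega)
      set k := T (i, a) - 1 with hk
      have hT : T (i, a) = k + 1 := by omega
      have hst := cnt_step hν h hT
      have hb := bd_step_conv (cnt_part hν h hmu i (a + 1)) (i := k) (by
        intro k' hk'
        have h1 := cnt_lat h (k := k') (l := k) i a (by omega)
        have h2 : cnt T k' i a = cnt T k' i (a + 1) := cnt_same (by omega)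
        omega)
      have he : Function.update (fun k => cnt T k i (a + 1)) k (cnt T k i (a + 1) + 1) =
          fun k => cnt T k i a := by
        funext k'
        by_cases hkk : k' = k
        · subst hkk; simp [hst]
        · rw [Function.update_of_ne hkk]
          exact (cnt_same (by omega)).symm
      rw [he] at hb
      refine ⟨hb.1, hb.2.1, ?_⟩
      have ht : tl T i a = (cnt T k i (a + 1) : ℤ) - k := rfl
      rw [ht, hb.2.2]
      exact ih

theorem wd_succ (n : ℕ) : wd lam ν T (n + 1) = wd lam ν T n ++ row lam ν T n := by
  simp [wd, List.range_succ]

theorem fil_true_wd (hν : IsPartition ν) (h : IsLRFilling lam mu ν T) (hmu : IsPartition mu)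
    (n : ℕ) : Path M0 (fil true (wd lam ν T n)) (bd (fun k => cnt T k n (ν n))) := by
  induction n with
  | zero =>
    have : (fun k => cnt T k 0 (ν 0)) = fun _ => 0 := funext fun k => cnt_zero h k
    rw [this, bd_zero]
    simp [wd, fil, Path]
  | succ n ih =>
    rw [wd_succ, fil_append]
    refine path_append.2 ⟨_, ih, ?_⟩
    have := fil_true_row hν h hmu n (ν n) le_rfl
    have e : (fun k => cnt T k (n + 1) (ν (n + 1))) = fun k => cnt T k n 0 := by
      funext k
      apply cnt_next h
      intro j hj hT
      have := T_in h (i := n + 1) (j := j) (by omega)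
      omega
    rw [e]
    exact this

theorem row_length (i : ℕ) : (row lam ν T i).length = ν i := by simp [row]

theorem fil_false_row (i a : ℕ) :
    fil false ((List.range a).map (al lam T i)).reverse =
      run ((lam i : ℤ) - i - min a (lam i)) (min a (lam i)) := by
  induction a with
  | zero => simp [fil, run]
  | succ a ih =>
    rw [List.range_succ, List.map_append, List.reverse_append, List.map_singleton,
      List.reverse_singleton, List.singleton_append]
    by_cases hl : a < lam i
    · rw [al, if_pos hl, fil_cons_same, ih, min_eq_left (by omega), min_eq_left (by omega)]
      simp only [run]
      congr 1
      · push_cast; ring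
      · congr 1; push_cast; ring
    · rw [al, if_neg hl, fil_cons_diff (by simp), ih, min_eq_right (by omega),
        min_eq_right (by omega)]
      

theorem fil_true_row_len (i : ℕ) :
    (fil true (row lam ν T i)).length = ν i - lam i := by
  have h1 := fil_length (row lam ν T i)
  have h2 := fil_false_row (lam := lam) (T := T) i (ν i)
  have h3 : (fil false (row lam ν T i)).length = min (ν i) (lam i) := by
    rw [row, h2, run_length]
  rw [row_length] at h1
  omega

theorem fil_true_wd_len (n : ℕ) :
    (fil true (wd lam ν T n)).length = ∑ i ∈ Finset.range n, (ν i - lam i) := by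
  induction n with
  | zero => simp [wd, fil]
  | succ n ih => rw [wd_succ, fil_append, List.length_append, ih, fil_true_row_len,
      Finset.sum_range_succ]

theorem wd_len (n : ℕ) : (wd lam ν T n).length = ∑ i ∈ Finset.range n, ν i := by
  induction n with
  | zero => simp [wd]
  | succ n ih => rw [wd_succ, List.length_append, ih, row_length, Finset.sum_range_succ]

theorem sub_of_sum (hν : IsPartition ν) (h : IsLRFilling lam mu ν T) (hmu : IsPartition mu)
    {n : ℕ} (hnν : ∀ k, n ≤ k → ν k = 0) (hnl : ∀ k, n ≤ k → lam k = 0)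
    (hnm : ∀ k, n ≤ k → mu k = 0)
    (hsum : ∑ i ∈ Finset.range n, ν i = ∑ i ∈ Finset.range n, lam i + ∑ i ∈ Finset.range n, mu i) :
    ∀ i, lam i ≤ ν i := by
  have h1 := fil_true_wd hν h hmu n
  have e : (fun k => cnt T k n (ν n)) = mu := funext fun k => cnt_end h k hnν
  rw [e, ← bd_zero] at h1
  obtain ⟨ρ, r1, r2, -, r3⟩ := path_bd isPartition_zero h1
  have := bd_inj hmu r1 r2
  subst this
  have h2 := r3 n hnm
  rw [fil_true_wd_len] at h2
  simp only [Finset.sum_const_zero, zero_add] at h2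
  have h3 : ∑ i ∈ Finset.range n, ν i = ∑ i ∈ Finset.range n, (lam i + (ν i - lam i)) := by
    rw [Finset.sum_add_distrib, ← h2, hsum]
  have h4 := (Finset.sum_eq_sum_iff_of_le (s := Finset.range n) (f := ν)
    (g := fun i => lam i + (ν i - lam i)) (fun i _ => by omega)).1 h3
  intro i
  by_cases hi : i < n
  · have := h4 i (Finset.mem_range.2 hi); omega
  · rw [hnl i (by omega)]; omega

theorem fil_false_wd (hsub : ∀ i, lam i ≤ ν i) (n : ℕ) :
    fil false (wd lam ν T n) = U 0 ((List.range n).map lam) := by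
  induction n with
  | zero => simp [wd, fil, U]
  | succ n ih =>
    rw [wd_succ, fil_append, ih, List.range_succ, List.map_append, U_append, row, fil_false_row,
      min_eq_right (hsub n)]
    simp [U]

theorem wd_mem_E (hlam : IsPartition lam) (hν : IsPartition ν) (h : IsLRFilling lam mu ν T)
    (hmu : IsPartition mu) (hsub : ∀ i, lam i ≤ ν i)
    {n : ℕ} (hnν : ∀ k, n ≤ k → ν k = 0) (hnl : ∀ k, n ≤ k → lam k = 0) :
    wd lam ν T n ∈ E (∑ i ∈ Finset.range n, ν i) (bd lam) (bd mu) := by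
  refine ⟨wd_len n, ?_, ?_⟩
  · rw [fil_false_wd hsub]
    exact path_U' hlam hnl
  · have h1 := fil_true_wd hν h hmu n
    have e : (fun k => cnt T k n (ν n)) = mu := funext fun k => cnt_end h k hnν
    rwa [e] at h1

theorem tl_row (hν : IsPartition ν) (h : IsLRFilling lam mu ν T) {i j j' : ℕ}
    (h1 : lam i ≤ j') (h2 : j' < j) (h3 : j < ν i) : tl T i j < tl T i j' := by
  have p1 := T_pos h (i := i) (j := j) (by omega) h3
  have p2 := T_pos h (i := i) (j := j') h1 (by omega)
  have hle := h.2.2.1 i j' j ⟨h1, by simp only; omega⟩ ⟨by simp only; omega, h3⟩ h2.le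
  unfold tl
  set k := T (i, j) - 1 with hk
  set k' := T (i, j') - 1 with hk'
  have a := cnt_step hν h (k := k) (i := i) (j := j) (by omega)
  have b := cnt_anti hν h k i (show j' + 1 ≤ j by omega)
  have c := cnt_lat h (k := k') (l := k) i (j' + 1) (by omega)
  omega

theorem tl_col (hlam : IsPartition lam) (hν : IsPartition ν) (h : IsLRFilling lam mu ν T) (i : ℕ) :
    ∀ j : ℕ, lam i ≤ j → j < ν (i + 1) → tl T (i + 1) j < tl T i j := by
  have hν' : ν (i + 1) ≤ ν i := hν.1 (by omega)
  have hl' : lam (i + 1) ≤ lam i := hlam.1 (by omega)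
  intro j
  induction j using Nat.strong_induction_on with
  | _ j ih =>
  intro h1 h2
  have s1 : InSkew lam ν (i, j) := ⟨h1, by simp only; omega⟩
  have s2 : InSkew lam ν (i + 1, j) := ⟨by simp only; omega, h2⟩
  have p1 := h.2.1 _ s1
  have p2 := h.2.1 _ s2
  have hlt := h.2.2.2.1 i j s1 s2
  have right : ∀ q, j ≤ q → T (i + 1, q) = 0 ∨ T (i + 1, j) ≤ T (i + 1, q) := by
    intro q hq
    by_cases hs : InSkew lam ν (i + 1, q)
    · exact Or.inr (h.2.2.1 _ _ _ s2 hs hq)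
    · exact Or.inl (h.1 _ hs)
  have left : ∀ q, q ≤ j → T (i, q) ≤ T (i, j) := by
    intro q hq
    by_cases hs : InSkew lam ν (i, q)
    · exact h.2.2.1 _ _ _ hs s1 hq
    · rw [h.1 _ hs]; omega
  unfold tl
  set k := T (i, j) - 1 with hk
  set l := T (i + 1, j) - 1 with hl
  have a1 := cnt_step hν h (k := l) (i := i + 1) (j := j) (by omega)
  have a2 := cnt_step hν h (k := k) (i := i) (j := j) (by omega)
  by_cases hc : k + 2 ≤ l
  · have b1 := cnt_lat h (k := k + 1) (l := l) (i + 1) j (by omega)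
    have b2 := cnt_next h (k + 1) i (c := j) (fun q hq => by
      rcases right q hq with e | e <;> omega)
    have b3 := cnt_const (T := T) (k := k + 1) (i := i) (c := 0) (j + 1) (fun q _ hq => by
      have := left q (by omega)
      omega)
    rw [Nat.zero_add] at b3
    have b4 := cnt_lat h (k := k) (l := k + 1) i (j + 1) (by omega)
    omega
  · have hlk : l = k + 1 := by omega
    by_cases hj : ∃ q, j = q + 1 ∧ lam i ≤ q ∧ T (i, q) = T (i, j)
    · obtain ⟨q, rfl, hq, hT⟩ := hj
      have s3 : InSkew lam ν (i, q) := ⟨hq, by simp only; omega⟩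
      have s4 : InSkew lam ν (i + 1, q) := ⟨by simp only; omega, by simp only; omega⟩
      have e1 := h.2.2.2.1 i q s3 s4
      have e2 := h.2.2.1 _ _ _ s4 s2 (by omega)
      have e3 := ih q (by omega) hq (by omega)
      unfold tl at e3
      rw [show T (i, q) - 1 = k by omega, show T (i + 1, q) - 1 = l by omega] at e3
      omega
    · have b1 := cnt_lat h (k := k) (l := l) (i + 1) j (by omega)
      have b2 := cnt_next h k i (c := j) (fun q hq => by
        rcases right q hq with e | e <;> omega)
      have b3 := cnt_const (T := T) (k := k) (i := i) (c := 0) j (fun q _ hq => by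
        intro hT
        have f1 := T_in h (i := i) (j := q) (by omega)
        refine hj ⟨j - 1, by omega, by omega, ?_⟩
        have f2 := left (j - 1) (by omega)
        have f3 := h.2.2.1 i q (j - 1) f1 ⟨by simp only; omega, by simp only; omega⟩ (by omega)
        omega)
      rw [Nat.zero_add] at b3
      omega
end

end LRT

namespace LRT

section
variable {lam mu ν : ℕ → ℕ} {T : ℕ × ℕ → ℕ}

theorem al_mem {n i j : ℕ} (hi : i < n) (hj : j < ν i) : al lam T i j ∈ wd lam ν T n := by
  unfold wd
  rw [List.mem_flatten]
  refine ⟨row lam ν T i, List.mem_map.2 ⟨i, List.mem_range.2 hi, rfl⟩, ?_⟩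
  unfold row
  rw [List.mem_reverse]
  exact List.mem_map.2 ⟨j, List.mem_range.2 hj, rfl⟩

theorem row_enc (K : ℤ) (i : ℕ) : (row lam ν T i).map (enc2 K) =
    ((List.range (ν i)).map (fun j => enc2 K (al lam T i j))).reverse := by
  unfold row
  rw [List.map_reverse, List.map_map]
  rfl

theorem pairwise_of {f : ℕ → ℤ} {a : ℕ} (h : ∀ j' j, j' < j → j < a → f j < f j') :
    (((List.range a).map f).reverse).Pairwise (· < ·) := by
  rw [List.pairwise_reverse, List.pairwise_map]
  refine List.Pairwise.imp_of_mem ?_ (List.pairwise_lt_range (n := a))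
  intro x y _ hy hxy
  exact h x y hxy (List.mem_range.1 hy)

theorem lat_of {f g : ℕ → ℤ} {a b : ℕ} (hba : b ≤ a) (h : ∀ j, j < b → g j < f j) :
    Lat ((List.range a).map f).reverse ((List.range b).map g).reverse := by
  intro t
  rw [List.countP_reverse, List.countP_reverse, List.countP_map, List.countP_map]
  refine le_trans (List.countP_mono_left (q := (fun x => decide (t < x)) ∘ f) ?_)
    ((List.range_sublist.2 hba).countP_le)
  intro x hx hp
  have := h x (List.mem_range.1 hx)
  simp only [Function.comp, decide_eq_true_eq] at hp ⊢
  omega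

theorem Ch_of {f : ℕ → List ℤ} (n : ℕ) : ∀ s, (∀ i, (f i).Pairwise (· < ·)) →
    (∀ i, Lat (f i) (f (i + 1))) → Ch ((List.range' s n).map f) := by
  induction n with
  | zero => intro s _ _; trivial
  | succ n ih =>
    intro s h1 h2
    have := ih (s + 1) h1 h2
    cases n with
    | zero => exact h1 s
    | succ n =>
      simp only [List.range'_succ, List.map_cons] at this ⊢
      exact ⟨h1 s, h2 s, this⟩

theorem wd_psi (hlam : IsPartition lam) (hν : IsPartition ν) (h : IsLRFilling lam mu ν T)
    (hmu : IsPartition mu) (hsub : ∀ i, lam i ≤ ν i)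
    {n m K : ℕ} (hnν : ∀ k, n ≤ k → ν k = 0) (hnl : ∀ k, n ≤ k → lam k = 0)
    (hm : ∑ i ∈ Finset.range n, ν i = m) (hK : m < K) :
    wd lam ν T n ∈ E m (bd lam) (bd mu) ∧
      psi K (wd lam ν T n) = U 0 ((List.range n).map ν) := by
  have hE := wd_mem_E hlam hν h hmu hsub hnν hnl
  rw [hm] at hE
  refine ⟨hE, ?_⟩
  have hbnd : ∀ i j, j < ν i → -(m : ℤ) ≤ (al lam T i j).2 ∧ (al lam T i j).2 ≤ m := by
    intro i j hj
    have hi : i < n := by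
      by_contra hc
      rw [hnν i (by omega)] at hj
      omega
    exact E_bound hE _ (al_mem hi hj)
  have key := psi_eq_U hK hE
    (bs := (List.range n).map (fun i => (row lam ν T i).map (enc2 K))) ?_ ?_
  · rw [key, List.map_map]
    congr 1
    apply List.map_congr_left
    intro i _
    simp [row_length]
  · unfold wd
    rw [List.map_flatten, List.map_map]
    rfl
  · rw [List.range_eq_range']
    apply Ch_of
    · intro i
      rw [row_enc]
      apply pairwise_of
      intro j' j h1 h2
      have b1 := hbnd i j h2
      have b2 := hbnd i j' (by omega)
      unfold al at b1 b2 ⊢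
      by_cases hj : j < lam i
      · rw [if_pos hj, if_pos (by omega)]
        simp only [enc2]
        omega
      · rw [if_neg hj] at b1 ⊢
        by_cases hj' : j' < lam i
        · rw [if_pos hj'] at b2 ⊢
          simp only [enc2] at b1 b2 ⊢
          omega
        · rw [if_neg hj']
          simp only [enc2]
          have := tl_row hν h (by omega) h1 h2
          omega
    · intro i
      rw [row_enc, row_enc]
      have hν' : ν (i + 1) ≤ ν i := hν.1 (by omega)
      have hl' : lam (i + 1) ≤ lam i := hlam.1 (by omega)
      apply lat_of hν'
      intro j hj
      have b1 := hbnd (i + 1) j hj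
      have b2 := hbnd i j (by omega)
      unfold al at b1 b2 ⊢
      by_cases h1 : j < lam (i + 1)
      · rw [if_pos h1, if_pos (by omega)]
        simp only [enc2]
        push_cast
        omega
      · rw [if_neg h1] at b1 ⊢
        by_cases h2 : j < lam i
        · rw [if_pos h2] at b2 ⊢
          simp only [enc2] at b1 b2 ⊢
          omega
        · rw [if_neg h2]
          simp only [enc2]
          have := tl_col hlam hν h i j (by omega) hj
          omega

theorem cnt_congr {T' : ℕ × ℕ → ℕ} {i c : ℕ}
    (h : ∀ a b, (a < i ∨ (a = i ∧ c ≤ b)) → T (a, b) = T' (a, b)) (k : ℕ) :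
    cnt T k i c = cnt T' k i c := by
  unfold cnt
  congr 1
  ext ⟨a, b⟩
  simp only [Set.mem_ofPred_eq]
  constructor
  · rintro ⟨h1, h2⟩
    exact ⟨by rw [← h a b h2]; exact h1, h2⟩
  · rintro ⟨h1, h2⟩
    exact ⟨by rw [h a b h2]; exact h1, h2⟩

theorem rows_eq {T' : ℕ × ℕ → ℕ} (n : ℕ) (h : wd lam ν T n = wd lam ν T' n) :
    ∀ i, i < n → row lam ν T i = row lam ν T' i := by
  induction n with
  | zero => intro i hi; omega
  | succ n ih =>
    rw [wd_succ, wd_succ] at h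
    obtain ⟨h1, h2⟩ := List.append_inj h (by rw [wd_len, wd_len])
    intro i hi
    rcases Nat.lt_succ_iff_lt_or_eq.1 hi with hi | rfl
    · exact ih h1 i hi
    · exact h2

theorem wd_inj (hν : IsPartition ν) (hmu : IsPartition mu) {T' : ℕ × ℕ → ℕ}
    (h : IsLRFilling lam mu ν T) (h' : IsLRFilling lam mu ν T')
    {n : ℕ} (hnν : ∀ k, n ≤ k → ν k = 0) (he : wd lam ν T n = wd lam ν T' n) : T = T' := by
  have hal : ∀ i j, j < ν i → al lam T i j = al lam T' i j := by
    intro i j hj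
    have hi : i < n := by
      by_contra hc
      rw [hnν i (by omega)] at hj
      omega
    have h1 := rows_eq n he i hi
    unfold row at h1
    have h2 := List.reverse_injective h1
    exact List.map_inj_left.1 h2 j (List.mem_range.2 hj)
  have main : ∀ i, ∀ d j, ν i ≤ j + d → T (i, j) = T' (i, j) := by
    intro i
    induction i using Nat.strong_induction_on with
    | _ i ihi =>
    intro d
    induction d with
    | zero =>
      intro j hj
      rw [h.1 (i, j) (fun hc => by have := hc.2; simp only at this; omega),
        h'.1 (i, j) (fun hc => by have := hc.2; simp only at this; omega)]
    | succ d ihd =>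
      intro j hj
      by_cases hs : InSkew lam ν (i, j)
      · have hs1 : lam i ≤ j := hs.1
        have hs2 : j < ν i := hs.2
        have p1 := h.2.1 _ hs
        have p2 := h'.2.1 _ hs
        have e := hal i j hs2
        unfold al at e
        rw [if_neg (by omega), if_neg (by omega)] at e
        have e := congrArg Prod.snd e
        simp only at e
        unfold tl at e
        rw [← cnt_congr (T := T) (T' := T') (i := i) (c := j + 1) (fun a b hab => by
          rcases hab with hab | ⟨rfl, hab⟩
          · exact ihi a hab (ν a) b (by omega)
          · exact ihd b (by omega))] at e
        have := bead_inj (cnt_part hν h hmu i (j + 1)).1 e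
        omega
      · rw [h.1 _ hs, h'.1 _ hs]
  funext ⟨i, j⟩
  exact main i (ν i) j (by omega)

end

theorem LR_le_E {lam mu ν : ℕ → ℕ} (hlam : IsPartition lam) (hmu : IsPartition mu)
    (hν : IsPartition ν) {n m K : ℕ} (hnν : ∀ k, n ≤ k → ν k = 0) (hnl : ∀ k, n ≤ k → lam k = 0)
    (hnm : ∀ k, n ≤ k → mu k = 0) (hm : ∑ i ∈ Finset.range n, ν i = m) (hK : m < K)
    (hsum : ∑ i ∈ Finset.range n, ν i =
      ∑ i ∈ Finset.range n, lam i + ∑ i ∈ Finset.range n, mu i) :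
    LR lam mu ν ≤ {l | l ∈ E m (bd lam) (bd mu) ∧ psi K l = U 0 ((List.range n).map ν)}.ncard := by
  have hf : {l | l ∈ E m (bd lam) (bd mu) ∧ psi K l = U 0 ((List.range n).map ν)}.Finite :=
    (E_finite m _ _).subset fun l hl => hl.1
  have := hf.to_subtype
  rw [← Nat.card_coe_set_eq]
  refine Nat.card_le_card_of_injective (fun T => ⟨wd lam ν T.1 n,
    wd_psi hlam hν T.2 hmu (sub_of_sum hν T.2 hmu hnν hnl hnm hsum) hnν hnl hm hK⟩) ?_
  intro T T' he
  exact Subtype.ext (wd_inj hν hmu T.2 T'.2 hnν (congrArg Subtype.val he))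

theorem U_str {ν : ℕ → ℕ} (hν : IsPartition ν) {n m : ℕ} (hnν : ∀ k, n ≤ k → ν k = 0)
    (hm : ∑ i ∈ Finset.range n, ν i = m) : U 0 ((List.range n).map ν) ∈ Str m := by
  refine ⟨?_, _, path_U' hν hnν⟩
  rw [U_length, ← hm]
  rfl

theorem key_lemma {lam mu ν σ : ℕ → ℕ} (hlam : IsPartition lam) (hmu : IsPartition mu)
    (hν : IsPartition ν) (hσ : IsPartition σ) (hb : bd σ = comb1 (bd lam) (bd mu))
    {n : ℕ} (hnν : ∀ k, n ≤ k → ν k = 0) (hnl : ∀ k, n ≤ k → lam k = 0)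
    (hnm : ∀ k, n ≤ k → mu k = 0)
    (hsum : ∑ i ∈ Finset.range n, ν i =
      ∑ i ∈ Finset.range n, lam i + ∑ i ∈ Finset.range n, mu i) :
    LR lam mu ν ≤ LR ν ν σ ∧ (LR lam mu ν ≠ 0 → ∀ N, (∀ k, N ≤ k → σ k = 0) →
      ∑ i ∈ Finset.range N, σ i = 2 * ∑ i ∈ Finset.range n, ν i) := by
  set m := ∑ i ∈ Finset.range n, ν i with hm
  have h1 := LR_le_E (K := m + 1) hlam hmu hν hnν hnl hnm hm.symm (by omega) hsum
  rw [← main_count _ _ (by omega) _ (U_str hν hnν hm.symm), ← hb] at h1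
  refine ⟨h1.trans (G_le_LR hν hσ hnν m), fun hne N hN => ?_⟩
  obtain ⟨x, hx⟩ := Set.nonempty_of_ncard_ne_zero (by omega :
    {x | x ∈ G m (bd σ) ∧ x.1 = U 0 ((List.range n).map ν)}.ncard ≠ 0)
  obtain ⟨⟨g1, g2, g3, g4⟩, -⟩ := hx
  rw [← bd_zero] at g3
  obtain ⟨ρ, r1, r2, -, r3⟩ := path_bd isPartition_zero g3
  have := bd_inj hσ r1 r2
  subst this
  have h2 := r3 N hN
  rw [List.length_append, g1, g2] at h2
  simp only [Finset.sum_const_zero, zero_add] at h2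
  omega

end LRT

namespace LRT

def tauS (r : ℕ) (lam mu : ℕ → ℕ) : Multiset ℕ :=
  (Multiset.range r).map (fun k => 2 * (lam k + (r - k)) - 1) +
      (Multiset.range r).map (fun k => 2 * (mu k + (r - k)))

theorem tauS_nodup {r : ℕ} {lam mu : ℕ → ℕ} (hlam : IsPartition lam) (hmu : IsPartition mu) :
    (tauS r lam mu).Nodup := by
  unfold tauS
  rw [Multiset.nodup_add]
  refine ⟨?_, ?_, ?_⟩
  · refine Multiset.Nodup.map_on ?_ (Multiset.nodup_range r)
    intro x hx y hy hxy
    rw [Multiset.mem_range] at hx hy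
    rcases lt_trichotomy x y with h | h | h
    · have := hlam.1 h.le; omega
    · exact h
    · have := hlam.1 h.le; omega
  · refine Multiset.Nodup.map_on ?_ (Multiset.nodup_range r)
    intro x hx y hy hxy
    rw [Multiset.mem_range] at hx hy
    rcases lt_trichotomy x y with h | h | h
    · have := hmu.1 h.le; omega
    · exact h
    · have := hmu.1 h.le; omega
  · rw [Multiset.disjoint_left]
    intro a ha hb
    obtain ⟨x, hx, rfl⟩ := Multiset.mem_map.1 ha
    obtain ⟨y, hy, hxy⟩ := Multiset.mem_map.1 hb
    rw [Multiset.mem_range] at hx hy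
    omega

theorem mem_tauS {r : ℕ} {lam mu : ℕ → ℕ} {a : ℕ} : a ∈ tauS r lam mu ↔
    (∃ k < r, a = 2 * (lam k + (r - k)) - 1) ∨ ∃ k < r, a = 2 * (mu k + (r - k)) := by
  unfold tauS
  simp only [Multiset.mem_add, Multiset.mem_map, Multiset.mem_range]
  constructor
  · rintro (⟨k, h1, h2⟩ | ⟨k, h1, h2⟩)
    · exact Or.inl ⟨k, h1, h2.symm⟩
    · exact Or.inr ⟨k, h1, h2.symm⟩
  · rintro (⟨k, h1, h2⟩ | ⟨k, h1, h2⟩)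
    · exact Or.inl ⟨k, h1, h2.symm⟩
    · exact Or.inr ⟨k, h1, h2.symm⟩

theorem tau_spec {r : ℕ} {lam mu : ℕ → ℕ} (hlam : IsPartition lam) (hmu : IsPartition mu) :
    ∃ f : ℕ → ℕ, (∀ p q, p < q → q < 2 * r → f p < f q) ∧
      (∀ p, p < 2 * r → p + 1 ≤ f p) ∧
      (∀ a, a ∈ tauS r lam mu ↔ ∃ p < 2 * r, f p = a) ∧
      ∀ m, tauFFLP r lam mu m = if m < 2 * r then f (2 * r - 1 - m) - (2 * r - m) else 0 := by
  set L := (tauS r lam mu).sort (· ≤ ·) with hL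
  have hlen : L.length = 2 * r := by
    rw [hL, Multiset.length_sort]
    simp [tauS]
    omega
  have hsort : L.Pairwise (· ≤ ·) := Multiset.pairwise_sort _ _
  have hnd : L.Nodup := by
    rw [← Multiset.coe_nodup, hL, Multiset.sort_eq]
    exact tauS_nodup hlam hmu
  have hget : ∀ p (hp : p < 2 * r), L.getD p 0 = L[p]'(by omega) := by
    intro p hp
    exact List.getD_eq_getElem _ _ (by omega)
  have hlt : ∀ p q, p < q → q < 2 * r → L.getD p 0 < L.getD q 0 := by
    intro p q h1 h2
    rw [hget p (by omega), hget q h2]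
    have h3 := List.pairwise_iff_getElem.1 hsort p q (by omega) (by omega) h1
    have h4 := List.pairwise_iff_getElem.1 hnd p q (by omega) (by omega) h1
    omega
  have hmem : ∀ a, a ∈ tauS r lam mu ↔ ∃ p < 2 * r, L.getD p 0 = a := by
    intro a
    rw [← Multiset.mem_sort (r := (· ≤ ·)), ← hL, List.mem_iff_getElem]
    constructor
    · rintro ⟨p, hp, rfl⟩
      exact ⟨p, by omega, hget p (by omega)⟩
    · rintro ⟨p, hp, h⟩
      exact ⟨p, by omega, by rw [← h, hget p hp]⟩
  refine ⟨fun p => L.getD p 0, hlt, ?_, hmem, fun m => rfl⟩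
  intro p
  induction p with
  | zero =>
    intro hp
    have := (hmem _).2 ⟨0, hp, rfl⟩
    rw [mem_tauS] at this
    rcases this with ⟨k, h1, h2⟩ | ⟨k, h1, h2⟩ <;> simp only <;> omega
  | succ p ih =>
    intro hp
    have h1 := ih (by omega)
    have h2 := hlt p (p + 1) (by omega) hp
    simp only at h1 ⊢
    omega

theorem tau_part {r : ℕ} {lam mu : ℕ → ℕ} (hlam : IsPartition lam) (hmu : IsPartition mu) :
    IsPartition (tauFFLP r lam mu) ∧ ∀ k, 2 * r ≤ k → tauFFLP r lam mu k = 0 := by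
  obtain ⟨f, f1, f2, f3, f4⟩ := tau_spec (r := r) hlam hmu
  have h0 : ∀ k, 2 * r ≤ k → tauFFLP r lam mu k = 0 := by
    intro k hk
    rw [f4, if_neg (by omega)]
  refine ⟨⟨antitone_nat_of_succ_le fun m => ?_, 2 * r, h0⟩, h0⟩
  by_cases hm : m + 1 < 2 * r
  · rw [f4, f4, if_pos hm, if_pos (by omega)]
    have := f1 (2 * r - 1 - (m + 1)) (2 * r - 1 - m) (by omega) (by omega)
    omega
  · rw [h0 (m + 1) (by omega)]
    omega

theorem bd_tau {r : ℕ} {lam mu : ℕ → ℕ} (hlam : IsPartition lam) (hmu : IsPartition mu)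
    (hlr : ∀ k, r ≤ k → lam k = 0) (hmr : ∀ k, r ≤ k → mu k = 0) :
    bd (tauFFLP r lam mu) = comb1 (bd lam) (bd mu) := by
  obtain ⟨f, f1, f2, f3, f4⟩ := tau_spec (r := r) hlam hmu
  have hfar : ∀ m : ℕ, 2 * r ≤ m → -(m : ℤ) ∈ bd (tauFFLP r lam mu) := by
    intro m hm
    exact ⟨m, by rw [f4, if_neg (by omega)]; simp⟩
  have hnear : ∀ a ∈ tauS r lam mu, (a : ℤ) - 2 * r ∈ bd (tauFFLP r lam mu) := by
    intro a ha
    obtain ⟨p, hp, rfl⟩ := (f3 a).1 ha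
    refine ⟨2 * r - 1 - p, ?_⟩
    rw [f4, if_pos (by omega), show 2 * r - 1 - (2 * r - 1 - p) = p by omega]
    have := f2 p hp
    omega
  ext x
  constructor
  · rintro ⟨m, rfl⟩
    by_cases hm : m < 2 * r
    · have h1 := f2 (2 * r - 1 - m) (by omega)
      have h2 := (f3 _).2 ⟨2 * r - 1 - m, by omega, rfl⟩
      rw [f4, if_pos hm]
      rw [mem_tauS] at h2
      rcases h2 with ⟨k, hk, e⟩ | ⟨k, hk, e⟩
      · exact Or.inl ⟨(lam k : ℤ) - k, ⟨k, rfl⟩, by omega⟩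
      · exact Or.inr ⟨(mu k : ℤ) - k, ⟨k, rfl⟩, by omega⟩
    · rw [f4, if_neg hm]
      rcases Nat.even_or_odd' m with ⟨k, rfl | rfl⟩
      · exact Or.inr ⟨(mu k : ℤ) - k, ⟨k, rfl⟩, by rw [hmr k (by omega)]; push_cast; ring⟩
      · exact Or.inl ⟨(lam k : ℤ) - k, ⟨k, rfl⟩, by rw [hlr k (by omega)]; push_cast; ring⟩
  · rintro (⟨y, ⟨k, rfl⟩, rfl⟩ | ⟨y, ⟨k, rfl⟩, rfl⟩)
    · by_cases hk : k < r
      · have := hnear _ (mem_tauS.2 (Or.inl ⟨k, hk, rfl⟩))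
        convert this using 1
        omega
      · have := hfar (2 * k + 1) (by omega)
        convert this using 1
        rw [hlr k (by omega)]
        push_cast
        ring
    · by_cases hk : k < r
      · have := hnear _ (mem_tauS.2 (Or.inr ⟨k, hk, rfl⟩))
        convert this using 1
        omega
      · have := hfar (2 * k) (by omega)
        convert this using 1
        rw [hmr k (by omega)]
        push_cast
        ring

theorem sum_ext {f : ℕ → ℕ} {a b : ℕ} (hab : a ≤ b) (h : ∀ k, a ≤ k → f k = 0) :
    ∑ i ∈ Finset.range b, f i = ∑ i ∈ Finset.range a, f i := by
  refine (Finset.sum_subset (Finset.range_mono hab) ?_).symm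
  intro k _ hk
  exact h k (by simpa using hk)

end LRT

open LRT

/-- FFLP Proposition 4.5.  For partitions `λ, μ` with at most `r`
parts and `ν` with at most `2r` parts satisfying `|ν| = |λ| + |μ|`, one has
`c^ν_{λμ} ≤ c^{τ(ν,ν)}_{τ(λ,μ) τ(λ,μ)}` (with `τ(λ,μ)` computed with parameter `r`
and `τ(ν,ν)` with parameter `2r`). -/
theorem lr_le_lr_tau (r : ℕ) (lam mu ν : ℕ → ℕ)
    (hlam : IsPartition lam) (hmu : IsPartition mu) (hν : IsPartition ν)
    (hlamparts : ∀ n, r ≤ n → lam n = 0) (hmuparts : ∀ n, r ≤ n → mu n = 0)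
    (hνparts : ∀ n, 2 * r ≤ n → ν n = 0)
    (hsum : ∑ i ∈ Finset.range (2 * r), ν i =
      ∑ i ∈ Finset.range r, lam i + ∑ i ∈ Finset.range r, mu i) :
    LR lam mu ν ≤ LR (tauFFLP r lam mu) (tauFFLP r lam mu) (tauFFLP (2 * r) ν ν) := by
  by_cases hz : LR lam mu ν = 0
  · rw [hz]; exact Nat.zero_le _
  obtain ⟨s1, s2⟩ := tau_part (r := r) hlam hmu
  obtain ⟨t1, t2⟩ := tau_part (r := 2 * r) hν hν
  obtain ⟨k1, k2⟩ := key_lemma hlam hmu hν s1 (bd_tau hlam hmu hlamparts hmuparts)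
    (n := 2 * r) hνparts (fun k hk => hlamparts k (by omega)) (fun k hk => hmuparts k (by omega))
    (by rw [sum_ext (f := lam) (a := r) (by omega) hlamparts,
          sum_ext (f := mu) (a := r) (by omega) hmuparts, hsum])
  have k3 := k2 hz (2 * r) s2
  obtain ⟨k4, -⟩ := key_lemma hν hν s1 t1 (bd_tau hν hν hνparts hνparts)
    (n := 2 * r) s2 hνparts hνparts (by rw [k3]; ring)
  exact k1.trans k4
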